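/- For q = 2 and n ≥ 3, we have (2,n) ∈ B(3,2) for every n ∈ {13, 17, 19, 21, 22, 23} and for all n ≥ 25. -/

import Mathlib

open Polynomial

noncomputable section

/-- An element of a finite field is *primitive* if it generates the multiplicative group. -/
def IsPrimitiveElem {L : Type} [Field L] [Fintype L] (α : L) : Prop :=
  orderOf α = Fintype.card L - 1

/-- `β` is a *normal element* of `L` over `K`, where `n = [L : K]`:
the conjugates `β, β^q, …, β^(q^(n-1))` form a `K`-basis of `L`. -/
def IsNormalElem (K : Type) {L : Type} [Field K] [Fintype K] [Field L] [Algebra K L]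
    (n : ℕ) (β : L) : Prop :=
  LinearIndependent K (fun i : Fin n => β ^ Fintype.card K ^ (i : ℕ)) ∧
    Submodule.span K (Set.range fun i : Fin n => β ^ Fintype.card K ^ (i : ℕ)) = ⊤

/-- The set `Υ_Q(m₁, m₂)` of rational functions over the field `F` with `Q` elements. -/
def Upsilon (F : Type) [Field F] [Fintype F] (m₁ m₂ : ℕ) : Set (RatFunc F) :=
  {f | ∃ f₁ f₂ : F[X], f₂ ≠ 0 ∧
      f = algebraMap F[X] (RatFunc F) f₁ / algebraMap F[X] (RatFunc F) f₂ ∧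
      f₁.natDegree ≤ m₁ ∧ f₂.natDegree ≤ m₂ ∧ IsCoprime f₁ f₂ ∧
      ∃ (k : ℕ) (g : F[X]), 0 < k ∧ g.Monic ∧ Irreducible g ∧ g ≠ X ∧
        Nat.gcd k (Fintype.card F - 1) = 1 ∧
        g ^ k ∣ f₁ * f₂ ∧ ¬ g ^ (k + 1) ∣ f₁ * f₂}

/-- Evaluation of a rational function at a point of the same field (`0` if undefined). -/
def ratEval {F : Type} [Field F] (f : RatFunc F) (α : F) : F :=
  f.eval (RingHom.id F) α

/-- `α` is `s`-free. -/
def IsFree {F : Type} [Field F] (s : ℕ) (α : F) : Prop :=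
  α ≠ 0 ∧ ∀ d : ℕ, d ∣ s → d ≠ 1 → ¬ ∃ β : F, β ^ d = α

/-- The `F_q[x]`-module action `h ∘ β = ∑ hᵢ β^(qⁱ)` on `L`. -/
def polyAct {K L : Type} [Field K] [Fintype K] [Field L] [Algebra K L]
    (h : K[X]) (β : L) : L :=
  h.sum fun i a => algebraMap K L a * β ^ Fintype.card K ^ i

/-- `α` is `g`-free with respect to the `F_q[x]`-module structure of `L`. -/
def IsPolyFree (K : Type) {L : Type} [Field K] [Fintype K] [Field L] [Algebra K L]
    (g : K[X]) (α : L) : Prop :=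
  ∀ h : K[X], h.Monic → h ∣ g → (∃ lam : L, α = polyAct h lam) → h = 1

/-- `N_f(e₁, e₂, g)`: the number of `α ∈ L` such that `α` is `e₁`-free,
`f(α)` is `e₂`-free and `α` is `g`-free. -/
def NElems (K : Type) {L : Type} [Field K] [Fintype K] [Field L] [Fintype L] [Algebra K L]
    (f : RatFunc L) (e₁ e₂ : ℕ) (g : K[X]) : ℕ :=
  Nat.card {α : L | IsFree e₁ α ∧ IsFree e₂ (ratEval f α) ∧ IsPolyFree K g α}

/-- `W(ℓ)`: the number of squarefree divisors of `ℓ`. -/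
def Wnat (ℓ : ℕ) : ℕ := (ℓ.divisors.filter Squarefree).card

/-- `W_q(g)`: the number of monic squarefree divisors of `g` in `F_q[x]`. -/
def Wpoly {K : Type} [Field K] (g : K[X]) : ℕ :=
  Nat.card {h : K[X] // h.Monic ∧ Squarefree h ∧ h ∣ g}

/-- `Φ(g) = |(F_q[x]/(g))ˣ|`. -/
def PhiPoly {K : Type} [Field K] (g : K[X]) : ℕ :=
  Nat.card ((K[X] ⧸ Ideal.span ({g} : Set K[X]))ˣ)

/-- `(q, n) ∈ B(m₁, m₂)`: for every `f ∈ Υ_{qⁿ}(m₁, m₂)` there is a primitive element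
`α` of `F_{qⁿ}`, normal over `F_q`, with `f(α)` also primitive. -/
def memB (m₁ m₂ q n : ℕ) : Prop :=
  ∀ (K L : Type) [Field K] [Field L] [Fintype K] [Fintype L] [Algebra K L],
    Fintype.card K = q → Fintype.card L = q ^ n →
    ∀ f ∈ Upsilon L m₁ m₂,
      ∃ α : L, IsPrimitiveElem α ∧ IsNormalElem K n α ∧ IsPrimitiveElem (ratEval f α)

/-- `𝔑(q, n)`: the number of primitive elements of `F_{qⁿ}` that are normal over `F_q`. -/
def NNum (K L : Type) [Field K] [Fintype K] [Field L] [Fintype L] [Algebra K L] (n : ℕ) : ℕ :=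
  Nat.card {α : L | IsPrimitiveElem α ∧ IsNormalElem K n α}

end


theorem powersum_bound {ι : Type*} [Fintype ι] (z : ι → ℂ) (C : ℝ) (N0 : ℕ)
    (h : ∀ N : ℕ, N0 ≤ N → ‖∑ i, z i ^ N‖ ≤ C) (i : ι) : ‖z i‖ ≤ 1 := by
  classical
  by_contra hlt
  push Not at hlt
  -- distinct values
  set S : Finset ℂ := Finset.univ.image z with hS
  set ℓ : ℂ[X] := ∏ y ∈ S.erase (z i), (X - Polynomial.C y) with hℓ
  have hne : ℓ.eval (z i) ≠ 0 := by
    rw [hℓ, eval_prod]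
    refine Finset.prod_ne_zero_iff.2 fun y hy => ?_
    simp only [eval_sub, eval_X, eval_C]
    exact sub_ne_zero.2 (Finset.ne_of_mem_erase hy).symm
  have hz : ∀ j, z j ≠ z i → ℓ.eval (z j) = 0 := by
    intro j hj
    rw [hℓ, eval_prod]
    refine Finset.prod_eq_zero (i := z j) ?_ (by simp)
    simp [hS, hj]
  set n : ℕ := (Finset.univ.filter fun j => z j = z i).card with hn
  have hnpos : 0 < n := Finset.card_pos.2 ⟨i, by simp⟩
  have key : ∀ N, ∑ t ∈ Finset.range (ℓ.natDegree + 1), ℓ.coeff t * ∑ j, z j ^ (N + t)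
      = n * (z i ^ N * ℓ.eval (z i)) := by
    intro N
    have : ∑ t ∈ Finset.range (ℓ.natDegree + 1), ℓ.coeff t * ∑ j, z j ^ (N + t)
        = ∑ j, z j ^ N * ℓ.eval (z j) := by
      simp_rw [Finset.mul_sum]
      rw [Finset.sum_comm]
      refine Finset.sum_congr rfl fun j _ => ?_
      rw [eval_eq_sum_range, Finset.mul_sum]
      refine Finset.sum_congr rfl fun t _ => by ring
    rw [this, hn, Finset.card_eq_sum_ones, Finset.sum_filter]
    push_cast
    rw [Finset.sum_mul]
    refine Finset.sum_congr rfl fun j _ => ?_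
    by_cases hj : z j = z i
    · simp [hj]
    · simp [hj, hz j hj]
  set B : ℝ := ∑ t ∈ Finset.range (ℓ.natDegree + 1), ‖ℓ.coeff t‖ * C with hB
  have bound : ∀ N, N0 ≤ N → ‖z i‖ ^ N * ‖ℓ.eval (z i)‖ ≤ B := by
    intro N hN
    have h1 : ‖(n : ℂ) * (z i ^ N * ℓ.eval (z i))‖ ≤ B := by
      rw [← key N]
      refine (norm_sum_le _ _).trans (Finset.sum_le_sum fun t _ => ?_)
      rw [norm_mul]
      exact mul_le_mul_of_nonneg_left (h _ (by omega)) (norm_nonneg _)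
    rw [norm_mul, norm_mul, norm_pow, Complex.norm_natCast] at h1
    have : (1 : ℝ) ≤ n := by exact_mod_cast hnpos
    have h0 : 0 ≤ ‖z i‖ ^ N * ‖ℓ.eval (z i)‖ := by positivity
    nlinarith
  have hp : 0 < ‖ℓ.eval (z i)‖ := norm_pos_iff.2 hne
  obtain ⟨N, hN⟩ := pow_unbounded_of_one_lt (B / ‖ℓ.eval (z i)‖) hlt
  have h1 := bound (N + N0) (by omega)
  rw [div_lt_iff₀ hp] at hN
  have h2 : ‖z i‖ ^ N ≤ ‖z i‖ ^ (N + N0) := pow_le_pow_right₀ hlt.le (by omega)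
  nlinarith

/-- Newton-type recurrence determines power sums. -/
theorem newton_exists (a S : ℕ → ℂ) (M : ℕ) (h0 : a 0 = 1) (hM : ∀ k, M < k → a k = 0)
    (hrec : ∀ k : ℕ, 1 ≤ k → (k : ℂ) * a k =
      ∑ p ∈ Finset.HasAntidiagonal.antidiagonal (k : ℕ) with p.1 < k, a p.1 * S p.2) :
    ∃ ω : Fin M → ℂ, ∀ j, 1 ≤ j → S j = - ∑ i, ω i ^ j := by
  classical
  -- reversed polynomial
  set P : ℂ[X] := ∑ k ∈ Finset.range (M + 1), C (a k) * X ^ (M - k) with hP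
  have hcoeff : ∀ k, k ≤ M → P.coeff (M - k) = a k := by
    intro k hk
    rw [hP, finsetSum_coeff, Finset.sum_eq_single k]
    · simp
    · intro b hb hbk
      rw [coeff_C_mul, coeff_X_pow, if_neg, mul_zero]
      simp at hb; omega
    · simp; omega
  have hdeg : P.natDegree ≤ M := by
    refine natDegree_sum_le_of_forall_le _ _ fun k _ => ?_
    exact (natDegree_C_mul_X_pow_le _ _).trans (by omega)
  have hmon : P.Monic := by
    refine monic_of_natDegree_le_of_coeff_eq_one M hdeg ?_
    simpa [h0] using hcoeff 0 (by omega)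
  have hnd : P.natDegree = M := by
    refine le_antisymm hdeg (le_natDegree_of_ne_zero ?_)
    have := hcoeff 0 (by omega)
    simp only [Nat.sub_zero] at this
    rw [this, h0]; exact one_ne_zero
  have hsp : P.Splits := IsAlgClosed.splits P
  have hcard : P.roots.card = M := by rw [← hnd]; exact hsp.natDegree_eq_card_roots.symm
  obtain ⟨ω, hω⟩ : ∃ ω : Fin M → ℂ, P.roots = Finset.univ.val.map ω := by
    obtain ⟨l, hl⟩ := Quot.exists_rep P.roots
    have hlen : l.length = M := by rw [← hcard, ← hl]; rfl
    subst hlen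
    refine ⟨l.get, ?_⟩
    rw [← hl]
    simp [Fin.univ_def]
  refine ⟨ω, ?_⟩
  have hes : ∀ k, MvPolynomial.aeval ω (MvPolynomial.esymm (Fin M) ℂ k) = (-1) ^ k * a k := by
    intro k
    rw [MvPolynomial.aeval_esymm_eq_multiset_esymm, ← hω]
    by_cases hk : k ≤ M
    · have := Polynomial.coeff_eq_esymm_roots_of_card (p := P) (by rw [hcard, hnd]) (k := M - k) (by omega)
      rw [hcoeff k hk, hmon.leadingCoeff, hnd, one_mul] at this
      have e : M - (M - k) = k := by omega
      rw [e] at this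
      rw [this, ← mul_assoc, ← pow_add, ← two_mul, pow_mul]; simp
    · rw [hM k (by omega), mul_zero, Multiset.esymm, Multiset.powersetCard_eq_empty]
      · simp
      · omega
  have hps : ∀ k, MvPolynomial.aeval ω (MvPolynomial.psum (Fin M) ℂ k) = ∑ i, ω i ^ k := by
    intro k; simp [MvPolynomial.psum]
  have hnewt : ∀ k : ℕ, (k : ℂ) * a k =
      ∑ p ∈ Finset.HasAntidiagonal.antidiagonal (k : ℕ) with p.1 < k, a p.1 * (- ∑ i, ω i ^ p.2) := by
    intro k
    have := congrArg (MvPolynomial.aeval ω) (MvPolynomial.mul_esymm_eq_sum (Fin M) ℂ k)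
    simp only [map_mul, map_natCast, hes, map_sum, map_pow, map_neg, map_one, hps] at this
    have h2 : ((-1 : ℂ) ^ k) * ((-1) ^ k) = 1 := by rw [← pow_add, ← two_mul, pow_mul]; simp
    calc (k : ℂ) * a k = (-1) ^ k * (k * ((-1) ^ k * a k)) := by linear_combination (-(k * a k)) * h2
      _ = _ := by
        rw [this, pow_succ, ← mul_assoc, ← mul_assoc, h2, Finset.mul_sum]
        refine Finset.sum_congr rfl fun p _ => ?_
        have h3 : ((-1 : ℂ) ^ p.1) * ((-1) ^ p.1) = 1 := by rw [← pow_add, ← two_mul, pow_mul]; simp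
        linear_combination (- a p.1 * ∑ i, ω i ^ p.2) * h3
  intro j
  induction j using Nat.strong_induction_on with
  | _ j ih =>
    intro hj
    have e := (hrec j hj).symm.trans (hnewt j)
    have hm : (0, j) ∈ (Finset.HasAntidiagonal.antidiagonal j).filter fun p => p.1 < j := by simp; omega
    rw [← Finset.add_sum_erase _ _ hm, ← Finset.add_sum_erase _ _ hm] at e
    rw [h0, one_mul, one_mul] at e
    have : ∑ x ∈ ((Finset.HasAntidiagonal.antidiagonal j).filter fun p => p.1 < j).erase (0, j), a x.1 * S x.2
      = ∑ x ∈ ((Finset.HasAntidiagonal.antidiagonal j).filter fun p => p.1 < j).erase (0, j),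
          a x.1 * (- ∑ i, ω i ^ x.2) := by
      refine Finset.sum_congr rfl fun p hp => ?_
      simp only [Finset.mem_erase, Finset.mem_filter, Finset.HasAntidiagonal.mem_antidiagonal] at hp
      have hp1 : p.1 ≠ 0 := fun h => hp.1 (by ext <;> simp <;> omega)
      rw [ih p.2 (by omega) (by omega)]
    rw [this] at e
    exact add_right_cancel e


theorem natDegree_resultant_le {E : Type*} [Field E] (f g : E[X][X]) (m n B : ℕ)
    (hf : ∀ i, (f.coeff i).natDegree ≤ B) (hg : ∀ i, (g.coeff i).natDegree ≤ B) :
    (resultant f g m n).natDegree ≤ (m + n) * B := by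
  classical
  have hent : ∀ i j, (sylvester f g m n i j).natDegree ≤ B := by
    intro i j
    simp only [sylvester, Matrix.of_apply]
    induction j using Fin.addCases with
    | left j => simp only [Fin.addCases_left]; split_ifs <;> simp [hg]
    | right j => simp only [Fin.addCases_right]; split_ifs <;> simp [hf]
  rw [resultant, Matrix.det_apply]
  refine natDegree_sum_le_of_forall_le _ _ fun σ _ => ?_
  refine (natDegree_smul_le _ _).trans ?_
  refine (natDegree_prod_le _ _).trans ?_
  refine (Finset.sum_le_card_nsmul _ _ B fun i _ => hent _ _).trans ?_
  simp

/-- `u f^τ` is a `p`-th power of a rational function implies `f` is const times a `p`-th power. -/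
theorem not_ratpow {E : Type} [Field E] (f : E[X]) (hf0 : f ≠ 0) (p τ : ℕ) (hp : p.Prime)
    (hτ : Nat.Coprime τ p) (u : E) (hu : u ≠ 0)
    (hf : ∀ (v : E) (b : E[X]), f ≠ C v * b ^ p) (b : RatFunc E) :
    b ^ p ≠ algebraMap E[X] (RatFunc E) (C u * f ^ τ) := by
  intro h
  have hinteg : IsIntegral E[X] b := by
    refine IsIntegral.of_pow hp.pos ?_
    rw [h]; exact isIntegral_algebraMap
  obtain ⟨b', rfl⟩ := IsIntegrallyClosed.isIntegral_iff.1 hinteg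
  rw [← map_pow] at h
  have h1 : b' ^ p = C u * f ^ τ := IsFractionRing.injective E[X] (RatFunc E) h
  -- τ * α = 1 + p * β
  obtain ⟨α, hα⟩ := Nat.exists_mul_mod_eq_one_of_coprime hτ hp.one_lt
  obtain ⟨-, hα⟩ := hα
  set β := τ * α / p with hβ
  have hαβ : τ * α = 1 + p * β := by
    have := Nat.div_add_mod (τ * α) p
    rw [← hβ, hα] at this; omega
  have h2 : (b' ^ α) ^ p = C (u ^ α) * (f * (f ^ β) ^ p) := by
    calc (b' ^ α) ^ p = (b' ^ p) ^ α := by ring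
      _ = C (u ^ α) * f ^ (τ * α) := by rw [h1, mul_pow, ← pow_mul, C_pow]
      _ = _ := by rw [hαβ, pow_add, pow_mul, pow_one]; ring
  have hdvd : f ^ β ∣ b' ^ α := by
    rw [← UniqueFactorizationMonoid.pow_dvd_pow_iff_dvd hp.ne_zero, h2]
    exact ⟨C (u ^ α) * f, by ring⟩
  obtain ⟨g, hg⟩ := hdvd
  rw [hg, mul_pow] at h2
  have h3 : g ^ p = C (u ^ α) * f := by
    have hne : (f ^ β) ^ p ≠ 0 := pow_ne_zero _ (pow_ne_zero _ hf0)
    apply mul_left_cancel₀ hne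
    rw [h2]; ring
  apply hf (u ^ α)⁻¹ g
  rw [h3, ← mul_assoc, ← C_mul, inv_mul_cancel₀ (pow_ne_zero _ hu), C_1, one_mul]

theorem pow_two_pow_mod {E : Type} [Field E] [CharP E 2] (f : E[X]) (t : ℕ) :
    (X : E[X]) ^ (2 ^ t) ∣ f ^ (2 ^ t) - C (f.eval 0 ^ (2 ^ t)) := by
  have h : X ∣ f - C (f.eval 0) := by
    have := X_sub_C_dvd_sub_C_eval (a := (0 : E)) (p := f)
    rwa [C_0, sub_zero] at this
  rw [C_pow, ← sub_pow_char_pow]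
  exact pow_dvd_pow_of_dvd h _

theorem stepanov_key {E : Type} [Field E] [CharP E 2] (t d τ e l m : ℕ) (hd : Odd d)
    (hτd : Nat.Coprime τ d) (he : e * d = 2 ^ t + τ) (f : E[X]) (hm : f.natDegree ≤ m)
    (hf0 : f.eval 0 ≠ 0)
    (hf : ∀ p, p.Prime → p ∣ d → ∀ (v : E) (b : E[X]), f ≠ C v * b ^ p)
    (hsz : (2 * d) * (l + m * τ) < 2 ^ t)
    (k : E[X][X]) (hk0 : k ≠ 0) (hkd : k.natDegree < d) (hkl : ∀ i, (k.coeff i).natDegree ≤ l)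
    (hdvd : (X : E[X]) ^ (2 ^ t) ∣ k.eval (f ^ e)) : False := by
  have hfne : f ≠ 0 := by rintro rfl; simp at hf0
  set u : E := f.eval 0 ^ (2 ^ t) with hu
  have hune : u ≠ 0 := pow_ne_zero _ hf0
  set a : E[X] := C u * f ^ τ with ha
  set g : E[X][X] := X ^ d - C a with hg
  have hdpos : 0 < d := hd.pos
  have hgdeg : g.natDegree = d := natDegree_X_pow_sub_C
  have hirr : Irreducible (X ^ d - C (algebraMap E[X] (RatFunc E) a)) := by
    refine X_pow_sub_C_irreducible_of_odd hd fun p hp hpd b => ?_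
    exact not_ratpow f hfne p τ hp (Nat.Coprime.coprime_dvd_right hpd hτd) u hune (hf p hp hpd) b
  have hinj : Function.Injective (algebraMap E[X] (RatFunc E)) := IsFractionRing.injective _ _
  have hgm : g.map (algebraMap E[X] (RatFunc E)) = X ^ d - C (algebraMap E[X] (RatFunc E) a) := by
    simp [hg]
  have hcop : IsCoprime (k.map (algebraMap E[X] (RatFunc E))) (g.map (algebraMap E[X] (RatFunc E))) := by
    rw [hgm]
    refine ((hirr.coprime_iff_not_dvd).2 fun hd' => ?_).symm
    have hkne : k.map (algebraMap E[X] (RatFunc E)) ≠ 0 := (Polynomial.map_ne_zero_iff hinj).2 hk0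
    have := natDegree_le_of_dvd hd' hkne
    rw [natDegree_X_pow_sub_C, natDegree_map_eq_of_injective hinj] at this
    omega
  have hres : resultant k g k.natDegree g.natDegree ≠ 0 := by
    intro h0
    have h1 := resultant_map_map k g k.natDegree g.natDegree (algebraMap E[X] (RatFunc E))
    rw [h0, map_zero] at h1
    have h2 : resultant (k.map (algebraMap E[X] (RatFunc E))) (g.map (algebraMap E[X] (RatFunc E))) = 0 := by
      rw [natDegree_map_eq_of_injective hinj, natDegree_map_eq_of_injective hinj]; exact h1
    exact (resultant_eq_zero_iff.1 h2).2 hcop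
  obtain ⟨p, q, -, -, hpq⟩ := exists_mul_add_mul_eq_C_resultant k g le_rfl le_rfl
    (Or.inr (by omega : g.natDegree ≠ 0))
  set R := resultant k g k.natDegree g.natDegree with hR
  have hRd : R.natDegree ≤ (k.natDegree + g.natDegree) * (l + m * τ) := by
    refine natDegree_resultant_le _ _ _ _ _ (fun i => (hkl i).trans (by omega)) fun i => ?_
    have had : a.natDegree ≤ m * τ := by
      refine (natDegree_C_mul_le _ _).trans (natDegree_pow_le.trans ?_)
      rw [mul_comm]; exact Nat.mul_le_mul_right _ hm
    rw [hg, coeff_sub, coeff_X_pow, coeff_C]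
    refine (natDegree_sub_le _ _).trans ?_
    split_ifs <;> simp <;> omega
  have hgev : (X : E[X]) ^ (2 ^ t) ∣ g.eval (f ^ e) := by
    have : g.eval (f ^ e) = f ^ τ * (f ^ (2 ^ t) - C u) := by
      rw [hg, eval_sub, eval_pow, eval_X, eval_C, ← pow_mul, he, ha, pow_add]; ring
    rw [this]
    exact Dvd.dvd.mul_left (pow_two_pow_mod f t) _
  have hRdvd : (X : E[X]) ^ (2 ^ t) ∣ R := by
    have := congrArg (Polynomial.eval (f ^ e)) hpq
    rw [eval_add, eval_mul, eval_mul, eval_C] at this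
    rw [← this]
    exact dvd_add (Dvd.dvd.mul_right hdvd _) (Dvd.dvd.mul_right hgev _)
  have := natDegree_le_of_dvd hRdvd hres
  rw [natDegree_X_pow] at this
  have h3 : (k.natDegree + g.natDegree) * (l + m * τ) ≤ (2 * d) * (l + m * τ) :=
    Nat.mul_le_mul_right _ (by omega)
  omega

theorem stepanov_indep {E : Type} [Field E] [CharP E 2] (t d τ e l m J : ℕ) (hd : Odd d)
    (hτd : Nat.Coprime τ d) (he : e * d = 2 ^ t + τ) (f : E[X]) (hm : f.natDegree ≤ m)
    (hf0 : f.eval 0 ≠ 0)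
    (hf : ∀ p, p.Prime → p ∣ d → ∀ (v : E) (b : E[X]), f ≠ C v * b ^ p)
    (hsz : (2 * d) * (l + m * τ) < 2 ^ t)
    (u : ℕ → ℕ → E[X]) (hul : ∀ i j, (u i j).natDegree ≤ l)
    (hsum : ∑ j ∈ Finset.range J, ∑ i ∈ Finset.range d,
      u i j * X ^ (j * 2 ^ t) * (f ^ e) ^ i = 0) :
    ∀ j < J, ∀ i < d, u i j = 0 := by
  classical
  by_contra hcon
  push Not at hcon
  have hex : ∃ j, j < J ∧ ∃ i, i < d ∧ u i j ≠ 0 := by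
    obtain ⟨j, hj, i, hi, h⟩ := hcon; exact ⟨j, hj, i, hi, h⟩
  obtain ⟨hJ, i0, hi0, hne⟩ := Nat.find_spec hex
  have hmin := fun j (h : j < Nat.find hex) => Nat.find_min hex h
  generalize Nat.find hex = j0 at *
  set k : E[X][X] := ∑ i ∈ Finset.range d, C (u i j0) * X ^ i with hk
  have hkc : ∀ i, k.coeff i = if i < d then u i j0 else 0 := by
    intro i
    rw [hk, finsetSum_coeff]
    simp only [coeff_C_mul, coeff_X_pow]
    simp
  refine stepanov_key t d τ e l m hd hτd he f hm hf0 hf hsz k ?_ ?_ ?_ ?_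
  · intro h0
    have := hkc i0
    rw [h0, if_pos hi0, coeff_zero] at this
    exact hne this.symm
  · have : k.natDegree ≤ d - 1 := by
      refine natDegree_sum_le_of_forall_le _ _ fun i hi => ?_
      rw [Finset.mem_range] at hi
      exact (natDegree_C_mul_X_pow_le _ _).trans (by omega)
    have := hd.pos
    omega
  · intro i; rw [hkc]; split_ifs
    · exact hul _ _
    · simp
  · have h1 : (X : E[X]) ^ (j0 * 2 ^ t) * k.eval (f ^ e) = ∑ i ∈ Finset.range d,
      u i j0 * X ^ (j0 * 2 ^ t) * (f ^ e) ^ i := by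
      rw [hk, eval_finsetSum, Finset.mul_sum]
      refine Finset.sum_congr rfl fun i _ => ?_
      simp; ring
    rw [← Finset.add_sum_erase _ _ (Finset.mem_range.2 hJ), ← h1] at hsum
    have h2 : (X : E[X]) ^ (j0 * 2 ^ t) * X ^ (2 ^ t) ∣ (X : E[X]) ^ (j0 * 2 ^ t) * k.eval (f ^ e) := by
      rw [eq_neg_of_add_eq_zero_left hsum, dvd_neg]
      refine Finset.dvd_sum fun j hj => Finset.dvd_sum fun i hi => ?_
      rw [Finset.mem_erase, Finset.mem_range] at hj
      rw [Finset.mem_range] at hi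
      rcases lt_or_gt_of_ne hj.1 with hlt | hgt
      · have : u i j = 0 := by
          by_contra h
          exact hmin j hlt ⟨hj.2, i, hi, h⟩
        simp [this]
      · refine Dvd.dvd.mul_right (Dvd.dvd.mul_left ?_ _) _
        rw [← pow_add]
        refine pow_dvd_pow _ ?_
        nlinarith [Nat.mul_le_mul_right (2 ^ t) hgt]
    exact (mul_dvd_mul_iff_left (pow_ne_zero _ X_ne_zero)).1 h2

theorem stepanov_aux (m d t κ l J : ℕ) (hd : Odd d) (E : Type) [Field E] [Fintype E] [CharP E 2]
    (hcard : Fintype.card E = 2 ^ t * 2 ^ t) (hdvd : d ∣ 2 ^ t * 2 ^ t - 1)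
    (f : E[X]) (hm : f.natDegree ≤ m) (hf0 : f.eval 0 ≠ 0)
    (hf : ∀ p, p.Prime → p ∣ d → ∀ (v : E) (b : E[X]), f ≠ C v * b ^ p)
    (hsz : (2 * d) * (l + m * d) < 2 ^ t)
    (hdim : l * 2 ^ t + J + m * (2 ^ t + 1) * d < d * J * l) (S : Finset E)
    (hS : ∀ x ∈ S, f.eval x ^ ((2 ^ t * 2 ^ t - 1) / d) = 1) :
    S.card ≤ l + J * 2 ^ t + m * (2 ^ t + d) := by
  classical
  set s := 2 ^ t with hs
  have hspos : 0 < s := by positivity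
  have hdpos := hd.pos
  set c := (s * s - 1) / d with hc
  have hcd : c * d = s * s - 1 := Nat.div_mul_cancel hdvd
  set τ := d - s % d with hτ
  set e := s / d + 1 with he'
  have hmodlt : s % d < d := Nat.mod_lt _ hdpos
  have he : e * d = s + τ := by
    have := Nat.div_add_mod s d
    have h2 : e * d = d * (s / d) + d := by rw [he']; ring
    omega
  have hcop : Nat.Coprime τ d := by
    have h1 : Nat.Coprime s d := by
      rw [hs]; exact Nat.Coprime.pow_left _ (Nat.coprime_two_left.2 hd)
    have : Nat.Coprime (s % d) d := by
      rw [Nat.Coprime, ← Nat.gcd_rec, Nat.gcd_comm]; exact h1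
    rw [hτ]; exact (Nat.coprime_self_sub_left hmodlt.le).2 this
  have hτle : τ ≤ d := Nat.sub_le _ _
  have hss : 1 ≤ s * s := Nat.mul_pos hspos hspos
  obtain ⟨tt, htt, httle⟩ : ∃ tt, c + tt = s * e ∧ tt ≤ s + 1 := by
    have h1 : (s * e) * d = s * s + s * τ := by rw [mul_assoc, he]; ring
    have hle : c ≤ s * e := by
      refine Nat.le_of_mul_le_mul_right (c := d) ?_ hdpos
      rw [hcd, h1]; omega
    refine ⟨s * e - c, by omega, ?_⟩
    refine Nat.le_of_mul_le_mul_right (c := d) ?_ hdpos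
    rw [Nat.sub_mul, h1, hcd]
    have : s * τ ≤ s * d := Nat.mul_le_mul_left _ hτle
    have : (s + 1) * d = s * d + d := by ring
    omega
  -- s-th roots
  have hroot : ∃ r : E → E, ∀ x, r x ^ s = x := by
    have hinj : Function.Injective (fun x : E => x ^ s) := by
      have := iterateFrobenius_inj E 2 t
      intro x y hxy
      exact this (by simpa [iterateFrobenius_def] using hxy)
    have hsurj := Finite.surjective_of_injective hinj
    choose r hr using hsurj
    exact ⟨r, hr⟩
  obtain ⟨r, hr⟩ := hroot
  -- linear algebra
  set D := l * s + J + m * (s + 1) * d with hD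
  let ι := Fin d × Fin J × Fin l
  let Φ₀ : (ι → E) →ₗ[E] E[X] :=
    { toFun := fun v => ∑ p : ι, C (v p) * (X ^ ((p.2.2 : ℕ) * s + p.2.1) * f ^ (tt * p.1))
      map_add' := by
        intro v w
        rw [← Finset.sum_add_distrib]
        refine Finset.sum_congr rfl fun p _ => ?_
        simp [add_mul]
      map_smul' := by
        intro a v
        simp only [RingHom.id_apply, Finset.smul_sum]
        refine Finset.sum_congr rfl fun p _ => ?_
        simp [smul_eq_C_mul, mul_assoc] }
  have hΦ : ∀ v, Φ₀ v ∈ degreeLT E D := by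
    intro v
    refine Submodule.sum_mem _ fun p _ => ?_
    rw [mem_degreeLT]
    have hJl : 0 < d * J * l := lt_of_le_of_lt (Nat.zero_le _) hdim
    have hlt : (C (v p) * (X ^ ((p.2.2 : ℕ) * s + p.2.1) * f ^ (tt * p.1))).natDegree < D := by
      refine lt_of_le_of_lt (natDegree_C_mul_le _ _) ?_
      refine lt_of_le_of_lt natDegree_mul_le ?_
      rw [natDegree_X_pow]
      have h1 : (f ^ (tt * (p.1 : ℕ))).natDegree ≤ m * (s + 1) * d := by
        refine natDegree_pow_le.trans ?_
        calc tt * (p.1 : ℕ) * f.natDegree ≤ (s + 1) * d * m :=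
              Nat.mul_le_mul (Nat.mul_le_mul httle p.1.2.le) hm
          _ = _ := by ring
      have h2 : (p.2.2 : ℕ) * s ≤ l * s := Nat.mul_le_mul_right _ p.2.2.2.le
      have h3 := p.2.1.2
      omega
    exact lt_of_le_of_lt degree_le_natDegree (by exact_mod_cast hlt)
  let Φ : (ι → E) →ₗ[E] degreeLT E D := Φ₀.codRestrict _ hΦ
  have hker : LinearMap.ker Φ ≠ ⊥ := by
    refine LinearMap.ker_ne_bot_of_finrank_lt ?_
    rw [(degreeLTEquiv E D).finrank_eq]
    simp only [Module.finrank_fintype_fun_eq_card, Fintype.card_fin, ι, Fintype.card_prod]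
    rw [← mul_assoc]; exact hdim
  obtain ⟨v, hv, hv0⟩ := Submodule.exists_mem_ne_zero_of_ne_bot hker
  have hv' : Φ₀ v = 0 := by
    have : Φ v = 0 := hv
    exact congrArg Subtype.val this
  -- the auxiliary polynomial
  let u : ℕ → ℕ → E[X] := fun i j => ∑ k : Fin l,
    if h : i < d ∧ j < J then C (r (v (⟨i, h.1⟩, ⟨j, h.2⟩, k))) * X ^ (k : ℕ) else 0
  have hul : ∀ i j, (u i j).natDegree ≤ l := by
    intro i j
    refine natDegree_sum_le_of_forall_le _ _ fun k _ => ?_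
    split_ifs
    · exact (natDegree_C_mul_X_pow_le _ _).trans k.2.le
    · simp
  set H : E[X] := ∑ j ∈ Finset.range J, ∑ i ∈ Finset.range d,
      u i j * X ^ (j * 2 ^ t) * (f ^ e) ^ i with hH
  have hsz' : (2 * d) * (l + m * τ) < 2 ^ t := by
    refine lt_of_le_of_lt ?_ hsz
    gcongr
  have hHne : H ≠ 0 := by
    intro h0
    have := stepanov_indep t d τ e l m J hd hcop he f hm hf0 hf hsz' u hul h0
    apply hv0
    funext p
    obtain ⟨i, j, k⟩ := p
    have h1 := congrArg (fun p : E[X] => p.coeff (k : ℕ)) (this j j.2 i i.2)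
    simp only [u, finsetSum_coeff, coeff_zero] at h1
    have hij : (i : ℕ) < d ∧ (j : ℕ) < J := ⟨i.2, j.2⟩
    simp only [hij, and_self, dite_true, coeff_C_mul, coeff_X_pow, Fin.val_inj] at h1
    simp only [mul_ite, mul_one, mul_zero, Finset.sum_ite_eq, Finset.mem_univ, if_true] at h1
    rw [← hr (v (i, j, k)), h1]
    simp [hspos.ne']
  have hHeval : ∀ x ∈ S, H.eval x = 0 := by
    intro x hx
    have hfx := hS x hx
    have h1 : H.eval x ^ s = (Φ₀ v).eval x := by
      have hexp : H = ∑ p : ι, C (r (v p)) * X ^ (p.2.2 : ℕ) * X ^ ((p.2.1 : ℕ) * s) * (f ^ e) ^ (p.1 : ℕ) := by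
        rw [hH, Finset.sum_comm]
        rw [Finset.sum_range, Fintype.sum_prod_type]
        refine Finset.sum_congr rfl fun i _ => ?_
        rw [Finset.sum_range, Fintype.sum_prod_type]
        refine Finset.sum_congr rfl fun j _ => ?_
        simp only [u]
        rw [Finset.sum_mul, Finset.sum_mul]
        refine Finset.sum_congr rfl fun k _ => ?_
        have hij : (i : ℕ) < d ∧ (j : ℕ) < J := ⟨i.2, j.2⟩
        simp [hij, hs]
      rw [hexp, eval_finsetSum, hs, sum_pow_char_pow, ← hs]
      simp only [Φ₀, LinearMap.coe_mk, AddHom.coe_mk]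
      rw [eval_finsetSum]
      refine Finset.sum_congr rfl fun p _ => ?_
      simp only [eval_mul, eval_C, eval_pow, eval_X, mul_pow, hr]
      have e1 : (x ^ ((p.2.1 : ℕ) * s)) ^ s = x ^ (p.2.1 : ℕ) := by
        rw [← pow_mul, mul_assoc, ← hcard, mul_comm, pow_mul, FiniteField.pow_card]
      have e2 : ((f.eval x ^ e) ^ (p.1 : ℕ)) ^ s = f.eval x ^ (tt * (p.1 : ℕ)) := by
        calc ((f.eval x ^ e) ^ (p.1 : ℕ)) ^ s = (f.eval x ^ (s * e)) ^ (p.1 : ℕ) := by ring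
          _ = _ := by rw [← htt, pow_add, hfx, one_mul, ← pow_mul]
      rw [e1, e2, pow_add, ← pow_mul]
      ring
    rw [hv', eval_zero] at h1
    exact pow_eq_zero_iff hspos.ne' |>.1 h1
  have hdeg : H.natDegree ≤ l + J * s + m * (s + d) := by
    refine natDegree_sum_le_of_forall_le _ _ fun j hj => ?_
    refine natDegree_sum_le_of_forall_le _ _ fun i hi => ?_
    rw [Finset.mem_range] at hi hj
    have h1 : ((f ^ e) ^ i).natDegree ≤ m * (s + d) := by
      rw [← pow_mul]
      refine natDegree_pow_le.trans ?_
      calc e * i * f.natDegree ≤ e * d * m := Nat.mul_le_mul (Nat.mul_le_mul_left _ hi.le) hm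
        _ = m * (s + τ) := by rw [he]; ring
        _ ≤ _ := Nat.mul_le_mul_left _ (by omega)
    have h2 : ((X : E[X]) ^ (j * 2 ^ t)).natDegree ≤ J * s := by
      rw [natDegree_X_pow]; exact Nat.mul_le_mul_right _ hj.le
    refine natDegree_mul_le.trans (add_le_add (natDegree_mul_le.trans (add_le_add (hul i j) h2)) h1)
  refine le_trans ?_ hdeg
  refine le_trans (Finset.card_le_card (t := H.roots.toFinset) fun x hx => ?_)
    ((Multiset.toFinset_card_le _).trans (card_roots' _))
  rw [Multiset.mem_toFinset, mem_roots hHne]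
  exact hHeval x hx

theorem stepanov (m d : ℕ) (hd : Odd d) : ∃ C₀ : ℕ, ∀ (t : ℕ) (E : Type) [Field E] [Fintype E]
    [CharP E 2] (_ : Fintype.card E = 2 ^ t * 2 ^ t) (_ : d ∣ 2 ^ t * 2 ^ t - 1)
    (f : E[X]) (_ : f.natDegree ≤ m) (_ : f.eval 0 ≠ 0)
    (_ : ∀ p, p.Prime → p ∣ d → ∀ (v : E) (b : E[X]), f ≠ C v * b ^ p) (S : Finset E)
    (_ : ∀ x ∈ S, f.eval x ^ ((2 ^ t * 2 ^ t - 1) / d) = 1),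
    d * S.card ≤ 2 ^ t * 2 ^ t + C₀ * 2 ^ t := by
  set κ := 33 + 16 * (m * d) with hκ
  set s0 := 4 * d + 4 * d * (m * d) + 21 with hs0
  refine ⟨d * s0 + (1 + d * κ + d * m * (1 + d)), ?_⟩
  intro t E _ _ _ hcard hdvd f hm hf0 hf S hS
  have hdpos := hd.pos
  have hspos : 0 < 2 ^ t := by positivity
  by_cases hsmall : 2 ^ t < s0
  · have h1 : S.card ≤ 2 ^ t * 2 ^ t := by rw [← hcard]; exact Finset.card_le_univ S
    generalize 2 ^ t = s at *
    have h2 : d * S.card ≤ d * s * s := by rw [mul_assoc]; exact Nat.mul_le_mul_left _ h1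
    have h3 : d * s * s ≤ d * s0 * s := by gcongr
    have : (d * s0 + (1 + d * κ + d * m * (1 + d))) * s = d * s0 * s + (1 + d * κ + d * m * (1 + d)) * s := by ring
    omega
  push Not at hsmall
  set l := 2 ^ t / (4 * d) with hl
  set J := 2 ^ t / d + κ with hJ
  have hl1 : l * (4 * d) ≤ 2 ^ t := Nat.div_mul_le_self _ _
  have hl2 : 2 ^ t < (l + 1) * (4 * d) := by
    have := Nat.lt_div_mul_add (a := 2 ^ t) (b := 4 * d) (by omega)
    rw [add_mul, one_mul]; omega
  have hlpos : 1 ≤ l := (Nat.one_le_div_iff (by omega)).2 (by omega)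
  have hJ1 : d * J ≤ 2 ^ t + d * κ := by
    rw [hJ, mul_add]; exact Nat.add_le_add_right (Nat.mul_div_le _ _) _
  have hJ2 : 2 ^ t + d * κ ≤ d * J + d := by
    have := Nat.div_add_mod (2 ^ t) d
    have h2 := Nat.mod_lt (2 ^ t) hdpos
    have h3 : d * J = d * (2 ^ t / d) + d * κ := by rw [hJ, mul_add]
    linarith
  have hJ3 : J ≤ 2 ^ t + κ := Nat.add_le_add_right (Nat.div_le_self _ _) _
  have hsz : (2 * d) * (l + m * d) < 2 ^ t := by
    have : (2 * d) * (l + m * d) * 2 = l * (4 * d) + 4 * d * (m * d) := by ring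
    omega
  have hdim : l * 2 ^ t + J + m * (2 ^ t + 1) * d < d * J * l := by
    generalize 2 ^ t = s at *
    have h1 : (s + d * κ) * l ≤ d * J * l + d * l := by
      rw [← add_mul]; exact Nat.mul_le_mul_right _ hJ2
    have h2 : s ≤ 8 * (d * l) := by nlinarith
    have h3 : (s + d * κ) * l = l * s + 33 * (d * l) + 16 * ((m * d) * (d * l)) := by rw [hκ]; ring
    have h4 : (m * d) * s ≤ (m * d) * (8 * (d * l)) := Nat.mul_le_mul_left _ h2
    have h5 : m * (s + 1) * d = (m * d) * s + m * d := by ring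
    have h6 : (m * d) * 21 ≤ (m * d) * s := Nat.mul_le_mul_left _ (by omega)
    nlinarith
  have := stepanov_aux m d t κ l J hd E hcard hdvd f hm hf0 hf hsz hdim S hS
  generalize 2 ^ t = s at *
  calc d * S.card ≤ d * (l + J * s + m * (s + d)) := Nat.mul_le_mul_left _ this
    _ = d * l + (d * J) * s + d * m * s + d * m * d := by ring
    _ ≤ s + (s + d * κ) * s + d * m * s + d * m * d * s := by
        have a1 : d * l ≤ s := by nlinarith
        have a2 : (d * J) * s ≤ (s + d * κ) * s := Nat.mul_le_mul_right _ hJ1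
        have a3 : d * m * d * 1 ≤ d * m * d * s := Nat.mul_le_mul_left _ (by omega)
        omega
    _ ≤ _ := by nlinarith [Nat.zero_le (d * s0 * s)]


section lfun
variable {L : Type} [Field L] [Fintype L]

/-- monic polynomials of degree k -/
noncomputable def MP (L : Type) [Field L] [Fintype L] (k : ℕ) : Finset L[X] :=
  letI := Classical.decEq L[X]
  (Finset.univ : Finset (Fin k → L)).image (fun c => X ^ k + ∑ i : Fin k, C (c i) * X ^ (i : ℕ))

theorem mem_MP {k : ℕ} {h : L[X]} : h ∈ MP L k ↔ h.Monic ∧ h.natDegree = k := by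
  classical
  have hlt : ∀ c : Fin k → L, (∑ i : Fin k, C (c i) * X ^ (i : ℕ)).degree < (k : WithBot ℕ) := by
    intro c
    refine (degree_sum_le _ _).trans_lt ?_
    refine (Finset.sup_lt_iff (WithBot.bot_lt_coe k)).2 ?_
    intro i _
    exact (degree_C_mul_X_pow_le _ _).trans_lt (WithBot.coe_lt_coe.2 i.2)
  unfold MP
  simp only [Finset.mem_image, Finset.mem_univ, true_and]
  constructor
  · rintro ⟨c, rfl⟩
    refine ⟨monic_X_pow_add (hlt c), ?_⟩
    rw [natDegree_add_eq_left_of_degree_lt, natDegree_X_pow]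
    rw [degree_X_pow]; exact hlt c
  · rintro ⟨hm, hk⟩
    refine ⟨fun i => h.coeff i, ?_⟩
    conv_rhs => rw [hm.as_sum]
    rw [hk, Finset.sum_range]

theorem MP_zero : MP L 0 = {1} := by
  ext h
  rw [mem_MP, Finset.mem_singleton]
  constructor
  · rintro ⟨a, b⟩; exact a.natDegree_eq_zero.1 b
  · rintro rfl; simp

theorem sum_dvd_MP (ψ : L[X] →* ℂ) (g : L[X]) (hg : g.Monic) (k : ℕ) (hk : g.natDegree ≤ k) :
    letI := Classical.decPred fun h : L[X] => g ∣ h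
    ∑ h ∈ (MP L k).filter (fun h => g ∣ h), ψ h = ψ g * ∑ h ∈ MP L (k - g.natDegree), ψ h := by
  classical
  rw [Finset.mul_sum]
  symm
  refine Finset.sum_bij (fun h _ => g * h) ?_ ?_ ?_ ?_
  · intro h hh
    rw [mem_MP] at hh
    simp only [Finset.mem_filter, mem_MP, dvd_mul_right, and_true]
    refine ⟨hg.mul hh.1, ?_⟩
    rw [hg.natDegree_mul hh.1, hh.2]; omega
  · intro a _ b _ hab
    exact mul_left_cancel₀ hg.ne_zero hab
  · intro h hh
    simp only [Finset.mem_filter, mem_MP] at hh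
    obtain ⟨⟨h1, h2⟩, r, rfl⟩ := hh
    have hr : r.Monic := hg.of_mul_monic_left h1
    refine ⟨r, ?_, rfl⟩
    rw [mem_MP]; refine ⟨hr, ?_⟩
    rw [hg.natDegree_mul hr] at h2; omega
  · intro h hh; rw [map_mul]

noncomputable def IrrLe (L : Type) [Field L] [Fintype L] (K : ℕ) : Finset L[X] :=
  letI := Classical.decEq L[X]
  letI := Classical.decPred fun h : L[X] => Irreducible h
  ((Finset.range (K + 1)).biUnion (MP L)).filter Irreducible

theorem mem_IrrLe {K : ℕ} {h : L[X]} :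
    h ∈ IrrLe L K ↔ h.Monic ∧ h.natDegree ≤ K ∧ Irreducible h := by
  classical
  unfold IrrLe
  simp only [Finset.mem_filter, Finset.mem_biUnion, Finset.mem_range, mem_MP]
  constructor
  · rintro ⟨⟨a, b, c, d⟩, e⟩; exact ⟨c, by omega, e⟩
  · rintro ⟨c, d, e⟩; exact ⟨⟨_, by omega, c, rfl⟩, e⟩

open Classical in
theorem natDegree_eq_sum_irr (k : ℕ) (h : L[X]) (hh : h ∈ MP L k) :
    k = ∑ g ∈ IrrLe L k, g.natDegree * ((Finset.Icc 1 k).filter (fun e => g ^ e ∣ h)).card := by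
  classical
  rw [mem_MP] at hh
  obtain ⟨hm, hk⟩ := hh
  have hne := hm.ne_zero
  set s := UniqueFactorizationMonoid.normalizedFactors h with hs
  have hmon : ∀ g ∈ s, g.Monic ∧ Irreducible g ∧ g ∣ h := by
    intro g hg
    exact ⟨by
      have h1 := UniqueFactorizationMonoid.normalize_normalized_factor g hg
      have h2 := (UniqueFactorizationMonoid.irreducible_of_normalized_factor g hg).ne_zero
      rw [← h1]; exact monic_normalize h2,
      UniqueFactorizationMonoid.irreducible_of_normalized_factor g hg,
      UniqueFactorizationMonoid.dvd_of_mem_normalizedFactors hg⟩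
  have hprod : s.prod = h := by
    have := UniqueFactorizationMonoid.prod_normalizedFactors hne
    refine eq_of_monic_of_associated ?_ hm this
    have := monic_multiset_prod_of_monic s id (fun g hg => (hmon g hg).1)
    rwa [Multiset.map_id] at this
  have hdeg : k = (s.map natDegree).sum := by
    rw [← hk, ← hprod, natDegree_multiset_prod_of_monic]
    intro g hg; exact (hmon g hg).1
  rw [Finset.sum_multiset_map_count] at hdeg
  refine hdeg.trans ?_
  have hsub : s.toFinset ⊆ IrrLe L k := by
    intro g hg
    rw [Multiset.mem_toFinset] at hg
    obtain ⟨a, b, c⟩ := hmon g hg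
    rw [mem_IrrLe]
    exact ⟨a, hk ▸ natDegree_le_of_dvd c hne, b⟩
  rw [Finset.sum_subset hsub]
  · refine Finset.sum_congr rfl fun g hg => ?_
    rw [mem_IrrLe] at hg
    obtain ⟨a, b, c⟩ := hg
    rw [smul_eq_mul, mul_comm]
    congr 1
    have hcount : ∀ e, g ^ e ∣ h ↔ e ≤ s.count g := by
      intro e
      rw [UniqueFactorizationMonoid.dvd_iff_normalizedFactors_le_normalizedFactors
        (pow_ne_zero _ c.ne_zero) hne,
        UniqueFactorizationMonoid.normalizedFactors_pow,
        UniqueFactorizationMonoid.normalizedFactors_irreducible c, a.normalize_eq_self,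
        Multiset.nsmul_singleton, ← hs, Multiset.le_count_iff_replicate_le]
    have hle : s.count g ≤ k := by
      have h1 := natDegree_le_of_dvd ((hcount _).2 le_rfl) hne
      rw [natDegree_pow, hk] at h1
      have := c.natDegree_pos
      nlinarith
    have : (Finset.Icc 1 k).filter (fun e => g ^ e ∣ h) = Finset.Icc 1 (s.count g) := by
      ext e; simp only [Finset.mem_filter, Finset.mem_Icc, hcount]; omega
    rw [this]; simp
  · intro g _ hg
    rw [Multiset.mem_toFinset] at hg
    rw [Multiset.count_eq_zero_of_notMem hg, zero_smul]

/-- the Newton-type recurrence -/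
theorem lfun_rec (ψ : L[X] →* ℂ) (S : ℕ → ℂ)
    (hS : ∀ K j, 1 ≤ j → j ≤ K → S j = ∑ g ∈ IrrLe L K, ∑ e ∈ Finset.Icc 1 K,
      if e * g.natDegree = j then (g.natDegree : ℂ) * ψ g ^ e else 0) (k : ℕ) :
    (k : ℂ) * ∑ h ∈ MP L k, ψ h =
      ∑ p ∈ Finset.HasAntidiagonal.antidiagonal (k:ℕ) with p.1 < k,
        (∑ h ∈ MP L p.1, ψ h) * S p.2 := by
  classical
  have h1 : (k : ℂ) * ∑ h ∈ MP L k, ψ h = ∑ g ∈ IrrLe L k, ∑ e ∈ Finset.Icc 1 k,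
      (g.natDegree : ℂ) * ∑ h ∈ (MP L k).filter (fun h => g ^ e ∣ h), ψ h := by
    have : ∀ h ∈ MP L k, (k : ℂ) * ψ h = ∑ g ∈ IrrLe L k, ∑ e ∈ Finset.Icc 1 k,
        (g.natDegree : ℂ) * (if g ^ e ∣ h then ψ h else 0) := by
      intro h hh
      have := natDegree_eq_sum_irr k h hh
      have h2 : (k : ℂ) = ∑ g ∈ IrrLe L k, (g.natDegree : ℂ) *
          (((Finset.Icc 1 k).filter (fun e => g ^ e ∣ h)).card : ℂ) := by
        conv_lhs => rw [this]
        push_cast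
        rfl
      rw [h2, Finset.sum_mul]
      refine Finset.sum_congr rfl fun g _ => ?_
      rw [← Finset.mul_sum, ← Finset.sum_filter, Finset.sum_const, nsmul_eq_mul, mul_assoc]
    rw [Finset.mul_sum, Finset.sum_congr rfl this, Finset.sum_comm]
    refine Finset.sum_congr rfl fun g _ => ?_
    rw [Finset.sum_comm]
    refine Finset.sum_congr rfl fun e _ => ?_
    rw [← Finset.mul_sum, Finset.sum_filter]
  have h3 : ∀ p ∈ (Finset.HasAntidiagonal.antidiagonal (k:ℕ)).filter (fun p => p.1 < k),
      (∑ h ∈ MP L p.1, ψ h) * S p.2 = ∑ g ∈ IrrLe L k, ∑ e ∈ Finset.Icc 1 k,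
        if e * g.natDegree = p.2 then (g.natDegree : ℂ) * ψ g ^ e * (∑ h ∈ MP L p.1, ψ h) else 0 := by
    intro p hp
    simp only [Finset.mem_filter, Finset.HasAntidiagonal.mem_antidiagonal] at hp
    rw [hS k p.2 (by omega) (by omega), Finset.mul_sum]
    refine Finset.sum_congr rfl fun g _ => ?_
    rw [Finset.mul_sum]
    refine Finset.sum_congr rfl fun e _ => ?_
    split_ifs
    · ring
    · ring
  refine h1.trans (Eq.trans ?_ ((Finset.sum_congr rfl h3).trans Finset.sum_comm).symm)
  refine Finset.sum_congr rfl fun g hg => ?_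
  rw [Finset.sum_comm]
  refine Finset.sum_congr rfl fun e he => ?_
  rw [mem_IrrLe] at hg
  rw [Finset.mem_Icc] at he
  have hpos := hg.2.2.natDegree_pos
  by_cases hle : e * g.natDegree ≤ k
  · rw [Finset.sum_eq_single (k - e * g.natDegree, e * g.natDegree)]
    · rw [if_pos rfl, sum_dvd_MP ψ (g ^ e) (hg.1.pow e) k (by rwa [natDegree_pow]), natDegree_pow,
        map_pow, mul_assoc]
    · rintro ⟨p, r⟩ hp hne
      simp only [Finset.mem_filter, Finset.HasAntidiagonal.mem_antidiagonal] at hp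
      rw [if_neg]
      rintro h4
      dsimp only at h4
      apply hne
      rw [h4, ← hp.1]; simp
    · intro h4
      exfalso; apply h4
      simp only [Finset.mem_filter, Finset.HasAntidiagonal.mem_antidiagonal]
      have : 0 < e * g.natDegree := by nlinarith
      omega
  · rw [Finset.sum_eq_zero, mul_zero, Finset.sum_eq_zero]
    · rintro ⟨p, r⟩ hp
      simp only [Finset.mem_filter, Finset.HasAntidiagonal.mem_antidiagonal] at hp
      rw [if_neg]; dsimp only; omega
    · intro h hh
      exfalso
      simp only [Finset.mem_filter, mem_MP] at hh
      have := natDegree_le_of_dvd hh.2 hh.1.1.ne_zero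
      rw [natDegree_pow] at this
      omega

/-- vanishing of the coefficients -/
theorem lfun_vanish (ψ : L[X] →* ℂ) (P u : L[X]) (hP : P.Monic) (hu : IsCoprime u P)
    (hψu : ψ u ≠ 1) (hcong : ∀ h h', P ∣ h - h' → ψ h = ψ h') (k : ℕ) (hk : P.natDegree ≤ k) :
    ∑ h ∈ MP L k, ψ h = 0 := by
  classical
  set σ : L[X] → L[X] := fun h => P * (h /ₘ P) + (u * h) %ₘ P with hσ
  have hcg : ∀ h, P ∣ σ h - u * h := by
    intro h
    have h1 := modByMonic_add_div (u * h) P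
    have : σ h - u * h = P * (h /ₘ P - (u * h) /ₘ P) := by
      rw [hσ]; dsimp only
      conv_lhs => rw [← h1]
      rw [h1]; linear_combination h1
    rw [this]; exact dvd_mul_right _ _
  have hdiv : ∀ h, σ h /ₘ P = h /ₘ P := by
    intro h
    have := div_modByMonic_unique (f := σ h) (g := P) (h /ₘ P) ((u * h) %ₘ P) hP
      ⟨by rw [hσ]; ring, degree_modByMonic_lt _ hP⟩
    exact this.1
  have hmem : ∀ h ∈ MP L k, σ h ∈ MP L k := by
    intro h hh
    rw [mem_MP] at hh ⊢
    have h1 : σ h = h + ((u * h) %ₘ P - h %ₘ P) := by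
      have := modByMonic_add_div h P
      rw [hσ]; dsimp only
      linear_combination this
    have h2 : ((u * h) %ₘ P - h %ₘ P).degree < h.degree := by
      refine (degree_sub_le _ _).trans_lt ?_
      have h3 : P.degree ≤ h.degree := by
        rw [degree_eq_natDegree hP.ne_zero, degree_eq_natDegree hh.1.ne_zero, hh.2]
        exact_mod_cast hk
      exact max_lt ((degree_modByMonic_lt _ hP).trans_le h3) ((degree_modByMonic_lt _ hP).trans_le h3)
    rw [h1]
    exact ⟨hh.1.add_of_left h2, by rw [natDegree_add_eq_left_of_degree_lt h2, hh.2]⟩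
  have hinj : Set.InjOn σ (MP L k) := by
    intro a _ b _ hab
    have h1 : a /ₘ P = b /ₘ P := by rw [← hdiv a, ← hdiv b, hab]
    have h2 : P ∣ u * (a - b) := by
      have := dvd_sub (hcg b) (hcg a)
      rw [hab] at this
      convert this using 1; ring
    have h3 : P ∣ a - b := hu.symm.dvd_of_dvd_mul_left h2
    have h4 : a - b = a %ₘ P - b %ₘ P := by
      have := modByMonic_add_div a P
      have h' := modByMonic_add_div b P
      rw [h1] at this
      linear_combination h' - this
    have h5 : (a - b) %ₘ P = 0 := (modByMonic_eq_zero_iff_dvd hP).2 h3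
    rw [sub_modByMonic] at h5
    rw [← sub_eq_zero, h4, h5]
  have hsurj : (MP L k).image σ = MP L k := by
    apply Finset.eq_of_subset_of_card_le
    · intro x hx; obtain ⟨y, hy, rfl⟩ := Finset.mem_image.1 hx; exact hmem y hy
    · rw [Finset.card_image_of_injOn hinj]
  have h6 : ∑ h ∈ MP L k, ψ h = ψ u * ∑ h ∈ MP L k, ψ h := by
    conv_lhs => rw [← hsurj, Finset.sum_image hinj]
    rw [Finset.mul_sum]
    refine Finset.sum_congr rfl fun h _ => ?_
    rw [hcong _ _ (hcg h), map_mul]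
  have h7 : (ψ u - 1) * ∑ h ∈ MP L k, ψ h = 0 := by linear_combination -h6
  exact (mul_eq_zero.1 h7).resolve_left (sub_ne_zero.2 hψu)
end lfun


section norms
variable {L : Type} [Field L]

theorem res_map (Ω : Type*) [Field Ω] [Algebra L Ω] [IsAlgClosed Ω] (G h : L[X]) (hG : G.Monic) :
    algebraMap L Ω (resultant G h) = ((G.aroots Ω).map (fun ρ => aeval ρ h)).prod := by
  rw [← resultant_map_map]
  have h1 : (G.map (algebraMap L Ω)).natDegree = G.natDegree := natDegree_map _
  rw [← h1, resultant_eq_prod_eval _ _ _ (natDegree_map_le) (IsAlgClosed.splits _),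
    (hG.map _).leadingCoeff, one_pow, one_mul]
  rw [aroots_def]
  congr 1
  refine Multiset.map_congr rfl fun ρ _ => ?_
  rw [eval_map_algebraMap]

theorem res_mul (G h h' : L[X]) (hG : G.Monic) :
    resultant G (h * h') = resultant G h * resultant G h' := by
  apply (algebraMap L (AlgebraicClosure L)).injective
  rw [map_mul, res_map _ _ _ hG, res_map _ _ _ hG, res_map _ _ _ hG, ← Multiset.prod_map_mul]
  simp

theorem res_mul_left (G G' h : L[X]) (hG : G.Monic) (hG' : G'.Monic) :
    resultant (G * G') h = resultant G h * resultant G' h := by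
  apply (algebraMap L (AlgebraicClosure L)).injective
  rw [map_mul, res_map _ _ _ hG, res_map _ _ _ hG', res_map _ _ _ (hG.mul hG'), aroots_mul
    (mul_ne_zero hG.ne_zero hG'.ne_zero), Multiset.map_add, Multiset.prod_add]

theorem res_pow_left (G h : L[X]) (hG : G.Monic) (v : ℕ) :
    resultant (G ^ v) h = resultant G h ^ v := by
  induction v with
  | zero => simp
  | succ v ih => rw [pow_succ, res_mul_left _ _ _ (hG.pow v) hG, ih, pow_succ]

theorem res_one (G : L[X]) (hG : G.Monic) : resultant G 1 = 1 := by
  apply (algebraMap L (AlgebraicClosure L)).injective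
  rw [res_map _ _ _ hG]; simp

theorem res_cong (G P h h' : L[X]) (hG : G.Monic) (N : ℕ) (hGP : G ∣ P ^ N) (hd : P ∣ h - h') :
    resultant G h = resultant G h' := by
  apply (algebraMap L (AlgebraicClosure L)).injective
  rw [res_map _ _ _ hG, res_map _ _ _ hG]
  congr 1
  refine Multiset.map_congr rfl fun ρ hρ => ?_
  rw [mem_aroots] at hρ
  have h1 : aeval ρ (P ^ N) = 0 := by
    obtain ⟨q, hq⟩ := hGP
    rw [hq, map_mul, hρ.2, zero_mul]
  have h2 : aeval ρ P = 0 := by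
    rw [map_pow] at h1; exact eq_zero_of_pow_eq_zero h1
  obtain ⟨q, hq⟩ := hd
  rw [← sub_eq_zero, ← map_sub, hq, map_mul, h2, zero_mul]

theorem res_symm [CharP L 2] (G h : L[X]) : resultant G h = resultant h G := by
  rw [resultant_comm]
  have : (-1 : L) = 1 := CharTwo.neg_eq 1
  rw [this, one_pow, one_mul]

noncomputable def psi (χ : MulChar L ℂ) (G : L[X]) (hG : G.Monic) : L[X] →* ℂ where
  toFun h := χ (resultant G h)
  map_one' := by rw [res_one G hG, map_one]
  map_mul' h h' := by rw [res_mul _ _ _ hG, map_mul]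

theorem psi_apply (χ : MulChar L ℂ) (G : L[X]) (hG : G.Monic) (h : L[X]) :
    psi χ G hG h = χ (resultant G h) := rfl

open IntermediateField in
theorem norm_aeval [Finite L] (E : Type) [Field E] [Finite E] [Algebra L E] (x : E) (F : L[X]) :
    Algebra.norm L (aeval x F) =
      resultant (minpoly L x) F ^ (Module.finrank L⟮x⟯ E) := by
  classical
  have hinteg : IsIntegral L x := IsIntegral.of_finite L x
  have e1 : aeval x F = algebraMap L⟮x⟯ E (aeval (AdjoinSimple.gen L x) F) := by
    rw [← aeval_algebraMap_apply, AdjoinSimple.algebraMap_gen]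
  rw [e1, ← Algebra.norm_norm (S := L⟮x⟯), Algebra.norm_algebraMap, map_pow]
  congr 1
  apply (algebraMap L (AlgebraicClosure L)).injective
  rw [res_map _ _ _ (minpoly.monic hinteg), Algebra.norm_eq_prod_embeddings L (AlgebraicClosure L)]
  have hsep : (minpoly L x).Separable := (Algebra.IsSeparable.isSeparable L x)
  have hnd : ((minpoly L x).aroots (AlgebraicClosure L)).Nodup := nodup_roots hsep.map
  let e := algHomAdjoinIntegralEquiv L (K := AlgebraicClosure L) hinteg
  rw [← e.symm.prod_comp]
  have : ∀ r : {y // y ∈ (minpoly L x).aroots (AlgebraicClosure L)},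
      (e.symm r) (aeval (AdjoinSimple.gen L x) F) = aeval (r : AlgebraicClosure L) F := by
    intro r
    rw [← aeval_algHom_apply, algHomAdjoinIntegralEquiv_symm_apply_gen L hinteg r]
  rw [Fintype.prod_congr _ _ this]
  exact (Finset.prod_subtype (⟨(minpoly L x).aroots (AlgebraicClosure L), hnd⟩ : Finset _)
    (p := fun y => y ∈ (minpoly L x).aroots (AlgebraicClosure L)) (fun y => Iff.rfl)
    (fun ρ => aeval ρ F)).symm

theorem S_eq [Fintype L] [CharP L 2] (χ : MulChar L ℂ) (G : L[X]) (hG : G.Monic)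
    (E : Type) [Field E] [Fintype E] [Algebra L E] (j : ℕ)
    (hE : Fintype.card E = Fintype.card L ^ j) (K : ℕ) (hj : 1 ≤ j) (hjK : j ≤ K) :
    ∑ x : E, χ (Algebra.norm L (aeval x G)) = ∑ g ∈ IrrLe L K, ∑ e ∈ Finset.Icc 1 K,
      if e * g.natDegree = j then (g.natDegree : ℂ) * psi χ G hG g ^ e else 0 := by
  classical
  have hfin : Module.finrank L E = j := by
    have h1 := Module.card_eq_pow_finrank (K := L) (V := E)
    rw [hE] at h1
    exact (Nat.pow_right_injective Fintype.one_lt_card h1).symm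
  have hdeg : ∀ x : E, Module.finrank (IntermediateField.adjoin L {x}) E * (minpoly L x).natDegree = j := by
    intro x
    rw [← IntermediateField.adjoin.finrank (IsIntegral.of_finite L x), mul_comm,
      Module.finrank_mul_finrank, hfin]
  have hmem : ∀ x ∈ (Finset.univ : Finset E), minpoly L x ∈ IrrLe L K := by
    intro x _
    rw [mem_IrrLe]
    refine ⟨minpoly.monic (IsIntegral.of_finite L x), ?_, minpoly.irreducible (IsIntegral.of_finite L x)⟩
    exact (Nat.le_of_dvd hj (Dvd.intro_left _ (hdeg x))).trans hjK
  rw [← Finset.sum_fiberwise_of_maps_to hmem]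
  refine Finset.sum_congr rfl fun g hg => ?_
  rw [mem_IrrLe] at hg
  obtain ⟨hmon, hle, hirr⟩ := hg
  have hpos := hirr.natDegree_pos
  by_cases hdvd : g.natDegree ∣ j
  · obtain ⟨e, he⟩ := hdvd
    have hepos : 1 ≤ e := by
      rcases Nat.eq_zero_or_pos e with h | h
      · rw [h] at he; omega
      · exact h
    have heK : e ≤ K := by nlinarith
    have hval : ∀ x ∈ (Finset.univ : Finset E).filter (fun x => minpoly L x = g),
        χ (Algebra.norm L (aeval x G)) = psi χ G hG g ^ e := by
      intro x hx
      simp only [Finset.mem_filter, Finset.mem_univ, true_and] at hx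
      have h1 := hdeg x
      rw [norm_aeval, hx, psi_apply, res_symm G g, map_pow]
      congr 1
      rw [hx, he, mul_comm] at h1
      exact Nat.eq_of_mul_eq_mul_left hpos h1
    rw [Finset.sum_congr rfl hval, Finset.sum_const, nsmul_eq_mul, Finset.sum_eq_single e]
    · rw [if_pos (by rw [he, mul_comm])]
      congr 2
      have hroot : (Finset.univ : Finset E).filter (fun x => minpoly L x = g) =
          (g.aroots E).toFinset := by
        ext x
        simp only [Finset.mem_filter, Finset.mem_univ, true_and, Multiset.mem_toFinset,
          mem_aroots]
        constructor
        · rintro rfl; exact ⟨hirr.ne_zero, minpoly.aeval _ _⟩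
        · rintro ⟨_, h2⟩; exact (minpoly.eq_of_irreducible_of_monic hirr h2 hmon).symm
      have hsep : g.Separable := PerfectField.separable_of_irreducible hirr
      have hsplit : (g.map (algebraMap L E)).Splits := by
        have h1 : g ∣ X ^ (Nat.card L) ^ j - X :=
          hirr.natDegree_dvd_iff_dvd_X_pow_card_pow_sub_X.1 ⟨e, he⟩
        rw [Nat.card_eq_fintype_card, ← hE] at h1
        have h2 := Polynomial.map_dvd (algebraMap L E) h1
        have h3 := (FiniteField.isSplittingField_sub E L).splits
        refine h3.of_dvd ?_ h2
        refine map_ne_zero (FiniteField.X_pow_card_sub_X_ne_zero _ Fintype.one_lt_card)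
      rw [hroot, Multiset.toFinset_card_of_nodup (nodup_roots hsep.map),
        ← hsplit.natDegree_eq_card_roots, natDegree_map]
    · intro e' _ hne
      rw [if_neg]
      intro h
      apply hne
      rw [he, mul_comm] at h
      exact Nat.eq_of_mul_eq_mul_left hpos h
    · intro h; exfalso; apply h; rw [Finset.mem_Icc]; exact ⟨hepos, heK⟩
  · rw [Finset.sum_eq_zero, Finset.sum_eq_zero]
    · intro e _; rw [if_neg]; rintro rfl; exact hdvd (Dvd.intro_left _ rfl)
    · intro x hx
      exfalso
      simp only [Finset.mem_filter, Finset.mem_univ, true_and] at hx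
      apply hdvd; rw [← hdeg x, hx]; exact Dvd.intro_left _ rfl
end norms


section weilprep
variable {L : Type} [Field L] [Fintype L]

theorem rootMult_pow {F : Type*} [Field F] (f : F[X]) (a : F) (n : ℕ) :
    rootMultiplicity a (f ^ n) = n * rootMultiplicity a f := by
  classical
  rw [← count_roots, ← count_roots, roots_pow, Multiset.count_nsmul]

theorem factor_out (G : L[X]) (hG : G.Monic) (r : AlgebraicClosure L) :
    ∃ G' : L[X], G'.Monic ∧ ¬ minpoly L r ∣ G' ∧
      G = minpoly L r ^ (rootMultiplicity r (G.map (algebraMap L (AlgebraicClosure L)))) * G' := by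
  have hinteg : IsIntegral L r := Algebra.IsIntegral.isIntegral r
  have hmon := minpoly.monic hinteg
  have hirr := minpoly.irreducible hinteg
  have hfin : FiniteMultiplicity (minpoly L r) G :=
    finiteMultiplicity_of_degree_pos_of_monic (degree_pos_of_irreducible hirr) hmon hG.ne_zero
  obtain ⟨G', h1, h2⟩ := hfin.exists_eq_pow_mul_and_not_dvd
  set v := multiplicity (minpoly L r) G
  have hG' : G'.Monic := (hmon.pow v).of_mul_monic_left (h1 ▸ hG)
  refine ⟨G', hG', h2, ?_⟩
  have hne : (G.map (algebraMap L (AlgebraicClosure L))) ≠ 0 := (hG.map _).ne_zero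
  have hv : rootMultiplicity r (G.map (algebraMap L (AlgebraicClosure L))) = v := by
    conv_lhs => rw [h1]
    rw [Polynomial.map_mul, Polynomial.map_pow, rootMultiplicity_mul (by
      rw [← Polynomial.map_pow, ← Polynomial.map_mul, ← h1]; exact hne), rootMult_pow]
    have h3 : rootMultiplicity r (G'.map (algebraMap L (AlgebraicClosure L))) = 0 := by
      apply rootMultiplicity_eq_zero
      rw [IsRoot.def, eval_map_algebraMap]
      intro h; exact h2 (minpoly.dvd _ _ h)
    have h4 : rootMultiplicity r ((minpoly L r).map (algebraMap L (AlgebraicClosure L))) = 1 := by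
      apply le_antisymm
      · have hsep : (minpoly L r).Separable := PerfectField.separable_of_irreducible hirr
        exact rootMultiplicity_le_one_of_separable hsep.map r
      · rw [Nat.succ_le_iff, rootMultiplicity_pos (hmon.map _).ne_zero, IsRoot.def,
          eval_map_algebraMap, minpoly.aeval]
    rw [h3, h4]; simp
  rw [hv]; exact h1

open IntermediateField in
theorem exists_unit (χ : MulChar L ℂ) (G P : L[X]) (hG : G.Monic) (hP : P.Monic) (N : ℕ)
    (hGP : G ∣ P ^ N) (r : AlgebraicClosure L)
    (hr : χ ^ (rootMultiplicity r (G.map (algebraMap L (AlgebraicClosure L)))) ≠ 1) :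
    ∃ u, IsCoprime u P ∧ psi χ G hG u ≠ 1 := by
  have hinteg : IsIntegral L r := Algebra.IsIntegral.isIntegral r
  obtain ⟨G', hG', hnG', hGe⟩ := factor_out G hG r
  obtain ⟨P', hP', hnP', hPe⟩ := factor_out P hP r
  set v := rootMultiplicity r (G.map (algebraMap L (AlgebraicClosure L)))
  set a := rootMultiplicity r (P.map (algebraMap L (AlgebraicClosure L)))
  have hmon := minpoly.monic hinteg
  have hirr := minpoly.irreducible hinteg
  set g := minpoly L r with hg
  obtain ⟨y, hy⟩ := MulChar.ne_one_iff.1 hr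
  have : Fact (Irreducible g) := ⟨hirr⟩
  have : Module.Finite L (AdjoinRoot g) := hmon.finite_adjoinRoot
  have : Finite (AdjoinRoot g) := Module.finite_of_finite L
  obtain ⟨w, hw⟩ := FiniteField.norm_surjective L (AdjoinRoot g) (y : L)
  obtain ⟨u0, rfl⟩ := AdjoinRoot.mk_surjective w
  have hres : resultant g u0 = y := by
    rw [← AdjoinRoot.aeval_eq, norm_aeval] at hw
    have hmp : minpoly L (AdjoinRoot.root g) = g := by
      rw [AdjoinRoot.minpoly_root hirr.ne_zero, hmon.leadingCoeff]; simp
    have hfr : Module.finrank L⟮AdjoinRoot.root g⟯ (AdjoinRoot g) = 1 := by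
      have h1 := Module.finrank_mul_finrank L L⟮AdjoinRoot.root g⟯ (AdjoinRoot g)
      rw [IntermediateField.adjoin.finrank (IsIntegral.of_finite L _), hmp,
        show Module.finrank L (AdjoinRoot g) = g.natDegree from
          finrank_quotient_span_eq_natDegree] at h1
      have := hirr.natDegree_pos
      exact Nat.eq_of_mul_eq_mul_left this (by rw [h1, mul_one])
    rw [hmp, hfr, pow_one] at hw
    exact hw
  have hu0 : ¬ g ∣ u0 := by
    intro h
    have : AdjoinRoot.mk g u0 = 0 := AdjoinRoot.mk_eq_zero.2 h
    rw [this, Algebra.norm_zero] at hw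
    exact y.ne_zero hw.symm
  obtain ⟨A, B, hAB⟩ : IsCoprime g P' := (hirr.coprime_iff_not_dvd).2 hnP'
  set u := u0 * B * P' + A * g with hu
  have hu1 : g ∣ u - u0 := ⟨A - A * u0, by rw [hu]; linear_combination u0 * hAB⟩
  have hu2 : P' ∣ u - 1 := ⟨u0 * B - B, by rw [hu]; linear_combination hAB⟩
  refine ⟨u, ?_, ?_⟩
  · have c1 : IsCoprime u g := by
      refine ((hirr.coprime_iff_not_dvd).2 fun h => hu0 ?_).symm
      have := dvd_sub h hu1
      rwa [sub_sub_cancel] at this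
    have c2 : IsCoprime u P' := by
      obtain ⟨t, ht⟩ := hu2
      exact ⟨1, -t, by linear_combination ht⟩
    rw [hPe]; exact (c1.pow_right).mul_right c2
  · have hGP' : G' ∣ P' ^ N := by
      have h1 : G' ∣ g ^ (a * N) * P' ^ N := by
        refine (Dvd.intro_left _ hGe.symm).trans (hGP.trans ?_)
        rw [hPe, mul_pow, ← pow_mul]
      have h2 : IsCoprime G' (g ^ (a * N)) := (((hirr.coprime_iff_not_dvd).2 hnG').symm).pow_right
      exact h2.dvd_of_dvd_mul_left h1
    have e2 : resultant G' u = 1 := by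
      rw [res_cong G' P' u 1 hG' N hGP' hu2, res_one G' hG']
    have e1 : resultant g u = y := by
      rw [res_cong g g u u0 hmon 1 (by rw [pow_one]) hu1, hres]
    have e0 : resultant G u = (y : L) ^ v := by
      rw [hGe, res_mul_left _ _ _ (hmon.pow v) hG', res_pow_left _ _ hmon, e1, e2, mul_one]
    rw [psi_apply, e0, map_pow]
    rw [MulChar.pow_apply_coe] at hy
    exact hy

theorem char_one_pow (χ : MulChar L ℂ) (b : L) (hb : χ b = 1) :
    b ^ ((Fintype.card L - 1) / orderOf χ) = 1 := by
  obtain ⟨γ, hγ⟩ := IsCyclic.exists_generator (α := Lˣ)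
  have hb0 : b ≠ 0 := by
    rintro rfl
    rw [MulChar.map_zero] at hb; exact zero_ne_one hb
  obtain ⟨k, hk⟩ := (Submonoid.mem_powers_iff _ _).1 ((mem_powers_iff_mem_zpowers).2 (hγ (Units.mk0 b hb0)))
  have hbk : b = (γ : L) ^ k := by
    have := congrArg Units.val hk
    simpa using this.symm
  have h1 : χ ^ k = 1 := by
    rw [MulChar.eq_one_iff]
    intro z
    obtain ⟨j, hj⟩ := (Submonoid.mem_powers_iff _ _).1 ((mem_powers_iff_mem_zpowers).2 (hγ z))
    rw [MulChar.pow_apply_coe, ← hj]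
    push_cast
    rw [map_pow, ← pow_mul, mul_comm, pow_mul, ← map_pow, ← hbk, hb, one_pow]
  obtain ⟨j, hj⟩ := orderOf_dvd_of_pow_eq_one h1
  have h2 : orderOf χ ∣ Fintype.card L - 1 := MulChar.orderOf_dvd_card_sub_one _ χ
  obtain ⟨i, hi⟩ := h2
  rw [hi]
  have hpos : 0 < orderOf χ := by
    rcases Nat.eq_zero_or_pos (orderOf χ) with h | h
    · rw [h, zero_mul] at hi
      have := Fintype.one_lt_card (α := L); omega
    · exact h
  rw [Nat.mul_div_cancel_left _ hpos, hbk, ← pow_mul, hj,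
    show orderOf χ * j * i = (Fintype.card L - 1) * j by rw [hi]; ring, pow_mul,
    FiniteField.pow_card_sub_one_eq_one _ γ.ne_zero, one_pow]
end weilprep


section weil
variable {L : Type} [Field L] [Fintype L] [CharP L 2]

theorem not_pow_ext (G : L[X]) (E : Type) [Field E] [Fintype E] [Algebra L E]
    (p : ℕ) (hr : ∃ r : AlgebraicClosure L,
      ¬ p ∣ rootMultiplicity r (G.map (algebraMap L (AlgebraicClosure L))))
    (v : E) (b : E[X]) : G.map (algebraMap L E) ≠ C v * b ^ p := by
  intro h
  obtain ⟨r, hr⟩ := hr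
  have hfin : Module.Finite L E := Module.Finite.of_finite
  let φ : E →ₐ[L] AlgebraicClosure L := IsAlgClosed.lift
  apply hr
  have h1 : G.map (algebraMap L (AlgebraicClosure L)) = C (φ v) * (b.map φ.toRingHom) ^ p := by
    have := congrArg (Polynomial.map φ.toRingHom) h
    rw [Polynomial.map_map, Polynomial.map_mul, Polynomial.map_pow, map_C] at this
    have e : φ.toRingHom.comp (algebraMap L E) = algebraMap L (AlgebraicClosure L) := by
      ext x; simp
    rw [e] at this
    exact this
  rw [h1]
  by_cases h0 : C (φ v) * (b.map φ.toRingHom) ^ p = 0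
  · rw [h0]; simp
  rw [rootMultiplicity_mul h0, rootMultiplicity_C, zero_add, rootMult_pow]
  exact dvd_mul_right _ _

theorem class_bound (n : ℕ) (hQ : Fintype.card L = 2 ^ n) (χ : MulChar L ℂ) (hχ : χ ≠ 1)
    (G : L[X]) (hG0 : G ≠ 0)
    (hr : ∀ p, p.Prime → p ∣ orderOf χ → ∃ r : AlgebraicClosure L,
      ¬ p ∣ rootMultiplicity r (G.map (algebraMap L (AlgebraicClosure L)))) :
    ∃ C₁ : ℝ, ∀ (N : ℕ) (E : Type) [Field E] [Fintype E] [Algebra L E]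
      (_ : Fintype.card E = Fintype.card L ^ (2 * N)),
      ‖∑ x : E, χ (Algebra.norm L (aeval x G))‖ ≤ C₁ * 2 ^ (n * N) := by
  classical
  set d := orderOf χ with hd
  have hddvd : d ∣ 2 ^ n - 1 := hQ ▸ MulChar.orderOf_dvd_card_sub_one _ χ
  have hn : n ≠ 0 := by
    rintro rfl
    have := Fintype.one_lt_card (α := L); rw [hQ] at this; simp at this
  have hodd : Odd d := by
    refine Odd.of_dvd_nat ?_ hddvd
    have : Even (2 ^ n) := (Nat.even_pow' hn).2 even_two
    have h1 : 1 ≤ 2 ^ n := Nat.one_le_two_pow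
    obtain ⟨t, ht⟩ := this
    exact ⟨t - 1, by omega⟩
  have hdpos : 0 < d := hodd.pos
  have hd1 : 1 < d := by
    by_contra h
    have : d = 1 := by omega
    exact hχ (orderOf_eq_one_iff.1 this)
  obtain ⟨C₀, hC₀⟩ := stepanov G.natDegree d hodd
  refine ⟨C₀ + G.natDegree, ?_⟩
  intro N E _ _ _ hE
  set t := n * N with ht
  have hE2 : Fintype.card E = 2 ^ t * 2 ^ t := by
    rw [hE, hQ, ← pow_mul, ← pow_add]; congr 1; rw [ht]; ring
  have hcE : CharP E 2 := charP_of_injective_algebraMap (algebraMap L E).injective 2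
  have hdE : d ∣ 2 ^ t * 2 ^ t - 1 := by
    rw [← hE2, hE, hQ]
    refine hddvd.trans ?_
    simpa using Nat.sub_dvd_pow_sub_pow (2 ^ n) 1 (2 * N)
  -- the value map
  set val : E → ℂ := fun x => χ (Algebra.norm L (aeval x G)) with hval
  obtain ⟨ω, hω⟩ : ∃ ω : ℂ, IsPrimitiveRoot ω d := ⟨_, Complex.isPrimitiveRoot_exp d hdpos.ne'⟩
  have hNbound : ∀ z : ℂ, z ≠ 0 → d * ((Finset.univ : Finset E).filter (fun x => val x = z)).card
      ≤ 2 ^ t * 2 ^ t + C₀ * 2 ^ t := by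
    intro z hz
    rcases Finset.eq_empty_or_nonempty ((Finset.univ : Finset E).filter (fun x => val x = z)) with
      he | ⟨x0, hx0⟩
    · rw [he]; simp
    simp only [Finset.mem_filter, Finset.mem_univ, true_and] at hx0
    set y0 := aeval x0 G with hy0
    have hy0ne : y0 ≠ 0 := by
      intro h
      apply hz
      rw [← hx0, hval]; dsimp only
      rw [← hy0, h, Algebra.norm_zero, MulChar.map_zero]
    set f : E[X] := C y0⁻¹ * (G.map (algebraMap L E)).comp (X + C x0) with hf
    have hfeval : ∀ x, f.eval x = y0⁻¹ * aeval (x + x0) G := by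
      intro x; rw [hf]; simp [eval_comp, eval_map_algebraMap]
    have := hC₀ t E hE2 hdE f (by
        rw [hf]
        refine (natDegree_C_mul_le _ _).trans ?_
        rw [natDegree_comp, natDegree_X_add_C, mul_one, natDegree_map])
      (by rw [hfeval, zero_add, ← hy0, inv_mul_cancel₀ hy0ne]; exact one_ne_zero)
      (by
        intro p hp hpd v b hfb
        refine not_pow_ext G E p (hr p hp hpd) (y0 * v) (b.comp (X - C x0)) ?_
        have h2 : (G.map (algebraMap L E)).comp (X + C x0) = C (y0 * v) * b ^ p := by
          rw [C_mul, mul_assoc, ← hfb, hf, ← mul_assoc, ← C_mul, mul_inv_cancel₀ hy0ne, C_1, one_mul]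
        have h3 := congrArg (fun q => q.comp (X - C x0)) h2
        simp only [comp_assoc, mul_comp, pow_comp, C_comp, add_comp, X_comp, sub_add_cancel,
          comp_X] at h3
        exact h3)
      (((Finset.univ : Finset E).filter (fun x => val x = z)).image (fun x => x - x0))
      (by
        intro x hx
        obtain ⟨w, hw, rfl⟩ := Finset.mem_image.1 hx
        simp only [Finset.mem_filter, Finset.mem_univ, true_and] at hw
        rw [hfeval, sub_add_cancel]
        have h1 : χ (Algebra.norm L (y0⁻¹ * aeval w G)) = 1 := by
          rw [map_mul, map_mul]
          have h4 : χ (Algebra.norm L y0⁻¹) * z = 1 := by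
            rw [← hx0, hval]; dsimp only
            rw [← hy0, ← map_mul, ← map_mul, inv_mul_cancel₀ hy0ne, map_one, map_one]
          rw [← h4]; congr 1
        have h2 := char_one_pow χ _ h1
        have h3 := congrArg (algebraMap L E) h2
        rw [map_pow, FiniteField.algebraMap_norm_eq_pow, ← pow_mul, map_one,
          Nat.card_eq_fintype_card, Nat.card_eq_fintype_card, hE2] at h3
        rw [← h3]
        congr 1
        have a1 : Fintype.card L - 1 ∣ 2 ^ t * 2 ^ t - 1 := by
          rw [← hE2, hE]
          simpa using Nat.sub_dvd_pow_sub_pow (Fintype.card L) 1 (2 * N)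
        have a2 : d ∣ Fintype.card L - 1 := hQ ▸ hddvd
        exact (Nat.div_mul_div_comm a1 a2).trans (by
          rw [mul_comm (Fintype.card L - 1), Nat.mul_div_mul_right]
          have := Fintype.one_lt_card (α := L); omega) |>.symm)
    rwa [Finset.card_image_of_injective _ (sub_left_injective)] at this
  set Nz : ℕ → ℕ := fun a => ((Finset.univ : Finset E).filter (fun x => val x = ω ^ a)).card with hNz
  have hone : ∀ x : E, aeval x G ≠ 0 → ∃ a < d, val x = ω ^ a := by
    intro x hx
    have h1 : val x ^ d = 1 := by
      rw [hval]; dsimp only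
      have hu : IsUnit (Algebra.norm L (aeval x G)) := (IsUnit.mk0 _ hx).map _
      obtain ⟨u, hu⟩ := hu
      rw [← hu, ← MulChar.pow_apply_coe, hd, pow_orderOf_eq_one, MulChar.one_apply_coe]
    have : NeZero d := ⟨by have := orderOf_pos χ; omega⟩
    obtain ⟨a, ha, h⟩ := hω.eq_pow_of_pow_eq_one h1
    exact ⟨a, ha, h.symm⟩
  have hind : ∀ x : E, ∑ a ∈ Finset.range d, (if val x = ω ^ a then ω ^ a else 0) = val x := by
    intro x
    by_cases hx : aeval x G = 0
    · have h0 : val x = 0 := by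
        rw [hval]; dsimp only; rw [hx, Algebra.norm_zero, MulChar.map_zero]
      rw [h0]
      refine Finset.sum_eq_zero fun a _ => ?_
      split_ifs with h
      · exact h.symm
      · rfl
    · obtain ⟨a, ha, h⟩ := hone x hx
      rw [Finset.sum_eq_single a]
      · rw [if_pos h, h]
      · intro b hb hne
        rw [if_neg]
        intro h'
        exact hne (hω.pow_inj (Finset.mem_range.1 hb) ha (h'.symm.trans h))
      · intro h'; exact absurd (Finset.mem_range.2 ha) h'
  have hS : ∑ x : E, val x = ∑ a ∈ Finset.range d, ω ^ a * (Nz a : ℂ) := by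
    rw [← Finset.sum_congr rfl (fun x _ => hind x), Finset.sum_comm]
    refine Finset.sum_congr rfl fun a _ => ?_
    rw [← Finset.sum_filter, Finset.sum_const, nsmul_eq_mul, mul_comm]
  have hcount : 2 ^ t * 2 ^ t ≤ ∑ a ∈ Finset.range d, Nz a + G.natDegree := by
    rw [← hE2, ← Finset.card_univ, ← Finset.card_filter_add_card_filter_not (s := (Finset.univ : Finset E)) (fun x => aeval x G ≠ 0)]
    refine add_le_add ?_ ?_
    · refine (Finset.card_le_card (t := (Finset.range d).biUnion fun a =>
        (Finset.univ : Finset E).filter (fun x => val x = ω ^ a)) ?_).trans Finset.card_biUnion_le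
      intro x hx
      simp only [Finset.mem_filter, Finset.mem_univ, true_and] at hx
      obtain ⟨a, ha, h⟩ := hone x hx
      simp only [Finset.mem_biUnion, Finset.mem_range, Finset.mem_filter, Finset.mem_univ, true_and]
      exact ⟨a, ha, h⟩
    · have hmne : G.map (algebraMap L E) ≠ 0 := (Polynomial.map_ne_zero_iff (algebraMap L E).injective).2 hG0
      refine (Finset.card_le_card (t := (G.map (algebraMap L E)).roots.toFinset) fun x hx => ?_).trans
        ((Multiset.toFinset_card_le _).trans ((card_roots' _).trans natDegree_map_le))
      simp only [Finset.mem_filter, Finset.mem_univ, true_and, not_not] at hx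
      rw [Multiset.mem_toFinset, mem_roots hmne, IsRoot.def, eval_map_algebraMap, hx]
  set B : ℝ := (2 ^ t * 2 ^ t + C₀ * 2 ^ t) / d with hB
  have hdR : (0 : ℝ) < d := by exact_mod_cast hdpos
  have hNB : ∀ a, (Nz a : ℝ) ≤ B := by
    intro a
    rw [hB, le_div_iff₀ hdR, mul_comm]
    exact_mod_cast hNbound (ω ^ a) (pow_ne_zero _ (hω.ne_zero hdpos.ne'))
  have hS2 : ∑ x : E, val x = ∑ a ∈ Finset.range d, ω ^ a * ((Nz a : ℂ) - (B : ℂ)) := by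
    rw [hS]
    simp_rw [mul_sub]
    rw [Finset.sum_sub_distrib, ← Finset.sum_mul, hω.geom_sum_eq_zero hd1, zero_mul, sub_zero]
  show ‖∑ x : E, val x‖ ≤ _
  rw [hS2]
  calc ‖∑ a ∈ Finset.range d, ω ^ a * ((Nz a : ℂ) - (B : ℂ))‖
      ≤ ∑ a ∈ Finset.range d, (B - Nz a) := by
        refine (norm_sum_le _ _).trans (Finset.sum_le_sum fun a _ => ?_)
        rw [norm_mul, norm_pow, hω.norm'_eq_one hdpos.ne', one_pow, one_mul]
        have : (Nz a : ℂ) - (B : ℂ) = (((Nz a : ℝ) - B : ℝ) : ℂ) := by push_cast; rfl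
        rw [this, Complex.norm_real, Real.norm_eq_abs, abs_sub_comm, abs_of_nonneg]
        linarith [hNB a]
    _ = 2 ^ t * 2 ^ t + C₀ * 2 ^ t - ∑ a ∈ Finset.range d, (Nz a : ℝ) := by
        rw [Finset.sum_sub_distrib, Finset.sum_const, Finset.card_range, nsmul_eq_mul, hB,
          mul_div_cancel₀ _ hdR.ne']
    _ ≤ C₀ * 2 ^ t + G.natDegree := by
        have : ((2 ^ t * 2 ^ t : ℕ) : ℝ) ≤ ((∑ a ∈ Finset.range d, Nz a + G.natDegree : ℕ) : ℝ) := by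
          exact_mod_cast hcount
        push_cast at this
        linarith
    _ ≤ (C₀ + G.natDegree) * 2 ^ t := by
        have h1 : (1 : ℝ) ≤ 2 ^ t := one_le_pow₀ (by norm_num)
        have h2 : (0 : ℝ) ≤ G.natDegree := by positivity
        nlinarith

theorem weil_monic (n : ℕ) (hQ : Fintype.card L = 2 ^ n) (χ : MulChar L ℂ) (hχ : χ ≠ 1)
    (G P : L[X]) (hG : G.Monic) (hP : P.Monic) (N : ℕ) (hGP : G ∣ P ^ N)
    (hr : ∀ p, p.Prime → p ∣ orderOf χ → ∃ r : AlgebraicClosure L,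
      ¬ p ∣ rootMultiplicity r (G.map (algebraMap L (AlgebraicClosure L)))) :
    ‖∑ x : L, χ (G.eval x)‖ ≤ (P.natDegree - 1 : ℕ) * Real.sqrt (2 ^ n) := by
  classical
  set ψ := psi χ G hG with hψ
  set S : ℕ → ℂ := fun j => ∑ g ∈ IrrLe L j, ∑ e ∈ Finset.Icc 1 j,
      if e * g.natDegree = j then (g.natDegree : ℂ) * ψ g ^ e else 0 with hS
  have hSE : ∀ (j : ℕ) (hj : 1 ≤ j) (E : Type) [Field E] [Fintype E] [Algebra L E]
      (_ : Fintype.card E = Fintype.card L ^ j),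
      S j = ∑ x : E, χ (Algebra.norm L (aeval x G)) := by
    intro j hj E _ _ _ hE
    exact (S_eq χ G hG E j hE j hj le_rfl).symm
  have hext : ∀ j, 1 ≤ j → ∃ (E : Type) (_ : Field E) (_ : Fintype E) (_ : Algebra L E),
      Fintype.card E = Fintype.card L ^ j := by
    intro j hj
    have : NeZero j := ⟨by omega⟩
    have : Fact (Nat.Prime 2) := ⟨Nat.prime_two⟩
    letI := Fintype.ofFinite (FiniteField.Extension L 2 j)
    refine ⟨FiniteField.Extension L 2 j, inferInstance, inferInstance, inferInstance, ?_⟩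
    have := FiniteField.natCard_extension L 2 j
    rw [Nat.card_eq_fintype_card, Nat.card_eq_fintype_card] at this
    convert this
  have hSK : ∀ K j, 1 ≤ j → j ≤ K → S j = ∑ g ∈ IrrLe L K, ∑ e ∈ Finset.Icc 1 K,
      if e * g.natDegree = j then (g.natDegree : ℂ) * ψ g ^ e else 0 := by
    intro K j hj hjK
    obtain ⟨E, _, _, _, hE⟩ := hext j hj
    rw [hSE j hj E hE]
    exact S_eq χ G hG E j hE K hj hjK
  have hd1 : orderOf χ ≠ 1 := fun h => hχ (orderOf_eq_one_iff.1 h)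
  obtain ⟨p, hp, hpd⟩ := Nat.exists_prime_and_dvd hd1
  obtain ⟨r, hrp⟩ := hr p hp hpd
  obtain ⟨u, hu, hψu⟩ := exists_unit χ G P hG hP N hGP r (fun h =>
    hrp (hpd.trans (orderOf_dvd_of_pow_eq_one h)))
  have hvan := lfun_vanish ψ P u hP hu hψu (fun h h' hd => by
    rw [hψ, psi_apply, psi_apply, res_cong G P h h' hG N hGP hd])
  obtain ⟨ω, hω⟩ := newton_exists (fun k => ∑ h ∈ MP L k, ψ h) S (P.natDegree - 1)
    (by simp [MP_zero]) (fun k hk => hvan k (by omega)) (fun k _ => lfun_rec ψ S hSK k)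
  obtain ⟨C₁, hC₁⟩ := class_bound n hQ χ hχ G hG.ne_zero hr
  have hQpos : (0 : ℝ) < 2 ^ n := by positivity
  have hωb : ∀ i, ‖ω i‖ ≤ Real.sqrt (2 ^ n) := by
    intro i
    have := powersum_bound (fun i => ω i ^ 2 / (2 ^ n : ℂ)) C₁ 1 (by
      intro N hN
      obtain ⟨E, _, _, _, hE⟩ := hext (2 * N) (by omega)
      have h1 := hC₁ N E hE
      rw [← hSE (2 * N) (by omega) E hE, hω (2 * N) (by omega), norm_neg] at h1
      have h2 : ∑ i, (ω i ^ 2 / (2 ^ n : ℂ)) ^ N = (∑ i, ω i ^ (2 * N)) / (2 ^ (n * N) : ℂ) := by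
        rw [Finset.sum_div]
        refine Finset.sum_congr rfl fun i _ => ?_
        rw [div_pow, ← pow_mul, ← pow_mul]
      rw [h2, norm_div, div_le_iff₀ (by simp)]
      simpa using h1) i
    rw [norm_div, norm_pow, norm_pow, div_le_one (by simp)] at this
    apply Real.le_sqrt_of_sq_le
    simpa using this
  have hS1 : ∑ x : L, χ (G.eval x) = S 1 := by
    rw [hSE 1 le_rfl L (by rw [pow_one])]
    refine Finset.sum_congr rfl fun x _ => ?_
    rw [Algebra.norm_self, MonoidHom.id_apply, coe_aeval_eq_eval]
  rw [hS1, hω 1 le_rfl, norm_neg]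
  refine (norm_sum_le _ _).trans ?_
  refine (Finset.sum_le_card_nsmul _ _ (Real.sqrt (2 ^ n)) fun i _ => by
    rw [pow_one]; exact hωb i).trans ?_
  simp

theorem weil (n : ℕ) (hQ : Fintype.card L = 2 ^ n) (χ : MulChar L ℂ) (hχ : χ ≠ 1)
    (G P : L[X]) (hG : G ≠ 0) (hP : P ≠ 0) (N : ℕ) (hGP : G ∣ P ^ N)
    (hr : ∀ p, p.Prime → p ∣ orderOf χ → ∃ r : AlgebraicClosure L,
      ¬ p ∣ rootMultiplicity r (G.map (algebraMap L (AlgebraicClosure L)))) :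
    ‖∑ x : L, χ (G.eval x)‖ ≤ (P.natDegree - 1 : ℕ) * Real.sqrt (2 ^ n) := by
  have hl : G.leadingCoeff ≠ 0 := leadingCoeff_ne_zero.2 hG
  have hlP : P.leadingCoeff ≠ 0 := leadingCoeff_ne_zero.2 hP
  set c := G.leadingCoeff with hc
  have hGe : G = C c * (C c⁻¹ * G) := by
    rw [← mul_assoc, ← C_mul, mul_inv_cancel₀ hl, C_1, one_mul]
  have hm : (C c⁻¹ * G).Monic := by
    rw [Monic, leadingCoeff_mul, leadingCoeff_C, inv_mul_cancel₀ hl]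
  have hmP : (C P.leadingCoeff⁻¹ * P).Monic := by
    rw [Monic, leadingCoeff_mul, leadingCoeff_C, inv_mul_cancel₀ hlP]
  have := weil_monic n hQ χ hχ (C c⁻¹ * G) (C P.leadingCoeff⁻¹ * P) hm hmP N (by
      rw [mul_pow]
      refine (Dvd.intro_left (C c) hGe.symm).trans (hGP.trans (dvd_mul_left _ _)))
    (by
      intro p hp hpd
      obtain ⟨r, hr⟩ := hr p hp hpd
      refine ⟨r, ?_⟩
      rw [Polynomial.map_mul, map_C, rootMultiplicity_mul, rootMultiplicity_C, zero_add]
      · exact hr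
      · rw [← map_C, ← Polynomial.map_mul]; exact (hm.map _).ne_zero)
  rw [natDegree_C_mul (inv_ne_zero hlP)] at this
  refine le_trans (le_of_eq ?_) this
  have h1 : ∀ x, χ (G.eval x) = χ c * χ ((C c⁻¹ * G).eval x) := by
    intro x
    conv_lhs => rw [hGe]
    rw [eval_mul, eval_C, map_mul]
  rw [Finset.sum_congr rfl (fun x _ => h1 x), ← Finset.mul_sum, norm_mul]
  have h2 : ‖χ c‖ = 1 := by
    have : χ c ^ (orderOf χ) = 1 := by
      rw [← MulChar.pow_apply' _ χ.orderOf_pos.ne', pow_orderOf_eq_one, MulChar.one_apply (IsUnit.mk0 _ hl)]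
    exact Complex.norm_eq_one_of_pow_eq_one this χ.orderOf_pos.ne'
  rw [h2, one_mul]
end weil


section P7
variable {K L : Type} [Field K] [Field L] [Fintype K] [Fintype L] [Algebra K L]

theorem charP_two_of_card (hK : Fintype.card K = 2) : CharP L 2 := by
  have h1 : (2 : K) = 0 := by
    have := FiniteField.cast_card_eq_zero K
    rw [hK] at this; exact_mod_cast this
  have h2 : (2 : L) = 0 := by
    have := congrArg (algebraMap K L) h1
    rwa [map_ofNat, map_zero] at this
  exact CharTwo.of_one_ne_zero_of_two_eq_zero one_ne_zero h2

/-- The map `y ↦ g (y² + y)`, as a linear map. -/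
noncomputable def asMap (K : Type) {L : Type} [Field K] [Field L] [Fintype K]
    [Algebra K L] (g : L) : L →ₗ[K] L :=
  (LinearMap.mulLeft K g).comp ((FiniteField.frobeniusAlgHom K L).toLinearMap + LinearMap.id)

theorem asMap_apply (hK : Fintype.card K = 2) (g y : L) : asMap K g y = g * (y ^ 2 + y) := by
  simp [asMap, hK]

theorem hyper_image (hK : Fintype.card K = 2) (l : L →ₗ[K] K) (hl : l ≠ 0) :
    ∃ γ : L, γ ≠ 0 ∧ LinearMap.range (asMap K γ) = LinearMap.ker l := by
  classical
  have : CharP L 2 := charP_two_of_card hK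
  have : Module.Finite K L := Module.Finite.of_finite
  obtain ⟨g, hg⟩ := (LinearMap.BilinForm.toDual (Algebra.traceForm K L)
    (traceForm_nondegenerate K L)).surjective l
  have hg0 : g ≠ 0 := by
    rintro rfl; apply hl; rw [← hg, map_zero]
  have hgx : ∀ x, l x = Algebra.trace K L (g * x) := by
    intro x; rw [← hg]; rfl
  refine ⟨g⁻¹, inv_ne_zero hg0, ?_⟩
  apply Submodule.eq_of_le_of_finrank_eq
  · rintro _ ⟨y, rfl⟩
    rw [LinearMap.mem_ker, hgx, asMap_apply hK, mul_inv_cancel_left₀ hg0, map_add]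
    have h := Algebra.trace_eq_of_algEquiv (FiniteField.frobeniusAlgEquivOfAlgebraic K L) y
    have h2 : FiniteField.frobeniusAlgEquivOfAlgebraic K L y = y ^ 2 := by
      rw [← hK]; rfl
    rw [h2] at h
    rw [h, ← two_mul]
    have h1 : (2 : K) = 0 := by
      have := FiniteField.cast_card_eq_zero K
      rw [hK] at this; exact_mod_cast this
    rw [h1, zero_mul]
  · have h1 := LinearMap.finrank_range_add_finrank_ker (asMap K g⁻¹ : L →ₗ[K] L)
    have h2 := LinearMap.finrank_range_add_finrank_ker l
    have h3 : LinearMap.range l = ⊤ := LinearMap.range_eq_top.2 (LinearMap.surjective hl)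
    have h4 : LinearMap.ker (asMap K g⁻¹ : L →ₗ[K] L) = K ∙ (1 : L) := by
      ext y
      rw [LinearMap.mem_ker, asMap_apply hK, Submodule.mem_span_singleton]
      constructor
      · intro h
        have h' : y * (y + 1) = 0 := by
          rcases mul_eq_zero.1 h with h | h
          · exact absurd h (inv_ne_zero hg0)
          · rw [← h]; ring
        rcases mul_eq_zero.1 h' with h | h
        · exact ⟨0, by simp [h]⟩
        · refine ⟨1, ?_⟩
          rw [one_smul]; exact (CharTwo.add_eq_zero.1 h).symm
      · rintro ⟨a, rfl⟩
        have ha : a ^ 2 = a := by rw [← hK]; exact FiniteField.pow_card a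
        rw [_root_.smul_pow, ha, one_pow, CharTwo.add_self_eq_zero, mul_zero]
    rw [h3, finrank_top, Module.finrank_self] at h2
    rw [h4, finrank_span_singleton one_ne_zero] at h1
    omega

theorem exists_T (hK : Fintype.card K = 2) (V : Submodule K L) :
    ∃ (w : ℕ) (T : L[X]), (∃ b : L, b ≠ 0 ∧ derivative T = C b) ∧ T.natDegree = 2 ^ w ∧
      ∃ φ : L →ₗ[K] L, (∀ x, φ x = T.eval x) ∧ LinearMap.range φ = V ∧
      Nat.card (LinearMap.ker φ) = 2 ^ w := by
  classical
  have : CharP L 2 := charP_two_of_card hK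
  have : Module.Finite K L := Module.Finite.of_finite
  induction V using WellFoundedGT.induction with
  | ind V ih =>
  by_cases hV : V = ⊤
  · subst hV
    refine ⟨0, X, ⟨1, one_ne_zero, by simp⟩, by simp, LinearMap.id, by simp, by simp, ?_⟩
    simp
  obtain ⟨x, hx⟩ : ∃ x, x ∉ V := by
    by_contra h; push Not at h; exact hV (Submodule.eq_top_iff'.2 h)
  obtain ⟨l, hlx, hl⟩ := Submodule.exists_le_ker_of_notMem hx
  have hlt : V < V ⊔ K ∙ x := by
    rw [left_lt_sup]
    intro h
    exact hx (h (Submodule.mem_span_singleton_self x))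
  obtain ⟨w, T, ⟨b, hb, hT⟩, hdeg, φ, hφ, hrange, hker⟩ := ih _ hlt
  have hx' : x ∈ LinearMap.range φ := by
    rw [hrange]; exact Submodule.mem_sup_right (Submodule.mem_span_singleton_self x)
  obtain ⟨y, hy⟩ := hx'
  obtain ⟨γ, hγ, himg⟩ := hyper_image hK (l.comp φ) (by
    intro h
    have := LinearMap.congr_fun h y
    rw [LinearMap.comp_apply, hy] at this
    exact hlx this)
  have hrV : LinearMap.range (φ.comp (asMap K γ)) = V := by
    rw [LinearMap.range_comp, himg]
    ext z
    rw [Submodule.mem_map]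
    constructor
    · rintro ⟨u, hu, rfl⟩
      have h1 : φ u ∈ V ⊔ K ∙ x := by rw [← hrange]; exact ⟨u, rfl⟩
      obtain ⟨v, hv, z, hz, hvz⟩ := Submodule.mem_sup.1 h1
      obtain ⟨a, rfl⟩ := Submodule.mem_span_singleton.1 hz
      rw [LinearMap.mem_ker, LinearMap.comp_apply, ← hvz, map_add, map_smul,
        show l v = 0 from hl hv, zero_add, smul_eq_mul] at hu
      rcases mul_eq_zero.1 hu with h | h
      · rw [← hvz, h, zero_smul, add_zero]; exact hv
      · exact absurd h hlx
    · intro hz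
      have h1 : z ∈ LinearMap.range φ := by rw [hrange]; exact Submodule.mem_sup_left hz
      obtain ⟨u, rfl⟩ := h1
      exact ⟨u, hl hz, rfl⟩
  have hS : (C γ * (X ^ 2 + X) : L[X]).natDegree = 2 := by
    rw [natDegree_C_mul hγ]; compute_degree!
  refine ⟨w + 1, T.comp (C γ * (X ^ 2 + X)), ⟨γ * b, mul_ne_zero hγ hb, ?_⟩, ?_,
    φ.comp (asMap K γ), ?_, hrV, ?_⟩
  · rw [derivative_comp, hT]
    have h2 : (1 + 1 : L[X]) = 0 := by
      rw [← C_1, ← C_add, CharTwo.add_self_eq_zero, C_0]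
    simp [h2]
  · rw [natDegree_comp, hdeg, hS, pow_succ]
  · intro z
    rw [LinearMap.comp_apply, asMap_apply hK, hφ, eval_comp]
    simp
  · have c1 : ∀ ψ : L →ₗ[K] L, Nat.card L = Nat.card (LinearMap.ker ψ) * Nat.card (LinearMap.range ψ) := by
      intro ψ
      rw [Submodule.card_eq_card_quotient_mul_card (LinearMap.ker ψ),
        Nat.card_congr (LinearMap.quotKerEquivRange ψ).toEquiv]
    have a1 := c1 φ
    have a2 := c1 (φ.comp (asMap K γ))
    have a3 : Nat.card (V ⊔ K ∙ x : Submodule K L) = 2 * Nat.card V := by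
      rw [Module.natCard_eq_pow_finrank (K := K), Module.natCard_eq_pow_finrank (K := K) (V := V),
        Nat.card_eq_fintype_card, hK]
      have h1 := Submodule.finrank_sup_add_finrank_inf_eq V (K ∙ x)
      have h2 : V ⊓ K ∙ x = ⊥ := by
        rw [eq_bot_iff]
        rintro z ⟨hz1, hz2⟩
        obtain ⟨a, rfl⟩ := Submodule.mem_span_singleton.1 hz2
        by_cases ha : a = 0
        · simp [ha]
        · exact absurd ((Submodule.smul_mem_iff _ ha).1 hz1) hx
      rw [h2, finrank_bot, finrank_span_singleton (fun h : x = 0 => hx (by rw [h]; exact V.zero_mem)), add_zero] at h1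
      rw [h1, pow_succ, mul_comm]
    rw [hrV] at a2
    rw [hrange, a3, hker] at a1
    rw [a1] at a2
    have : 0 < Nat.card V := Nat.card_pos
    rw [pow_succ]
    exact (Nat.eq_of_mul_eq_mul_right this (by linarith)).symm
end P7


section P8

theorem rootMult_comp {E : Type*} [Field E] (F T : E[X]) (hF : F ≠ 0) (r b : E) (hb : b ≠ 0)
    (hT : derivative T = C b) :
    rootMultiplicity r (F.comp T) = rootMultiplicity (T.eval r) F := by
  set ρ := T.eval r with hρ
  have hTC : ∀ c, T ≠ C c := by
    intro c h
    rw [h, derivative_C] at hT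
    exact hb (C_eq_zero.1 hT.symm)
  obtain ⟨H, hH, hHr⟩ := exists_eq_pow_rootMultiplicity_mul_and_not_dvd F hF ρ
  have hTρ : T - C ρ ≠ 0 := sub_ne_zero.2 (hTC ρ)
  have hHe : (H.comp T).eval r ≠ 0 := by
    rw [eval_comp, ← hρ]
    exact fun h => hHr (dvd_iff_isRoot.2 h)
  have h1 : rootMultiplicity r (T - C ρ) = 1 := by
    have hr : (T - C ρ).IsRoot r := by simp [hρ]
    have h2 := (rootMultiplicity_pos hTρ).2 hr
    have h3 : ¬ 1 < rootMultiplicity r (T - C ρ) := by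
      rw [one_lt_rootMultiplicity_iff_isRoot hTρ]
      rintro ⟨_, h⟩
      simp [hT, hb] at h
    omega
  have hne : H.comp T ≠ 0 := fun h => hHe (by rw [h, eval_zero])
  conv_lhs => rw [hH, mul_comp, pow_comp, sub_comp, X_comp, C_comp]
  rw [rootMultiplicity_mul (mul_ne_zero (pow_ne_zero _ hTρ) hne), rootMult_pow, h1, mul_one,
    rootMultiplicity_eq_zero hHe, add_zero]

theorem exists_preimage {E : Type*} [Field E] [IsAlgClosed E] (T : E[X]) (b : E) (hb : b ≠ 0)
    (hT : derivative T = C b) (ρ : E) : ∃ r, T.eval r = ρ := by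
  have h : (T - C ρ).degree ≠ 0 := by
    intro h
    have := eq_C_of_degree_eq_zero h
    have h2 := congrArg derivative this
    rw [derivative_sub, derivative_C, derivative_C, sub_zero, hT] at h2
    exact hb (C_eq_zero.1 h2)
  obtain ⟨r, hr⟩ := IsAlgClosed.exists_root _ h
  refine ⟨r, ?_⟩
  simpa [sub_eq_zero] using hr

theorem comp_ne_zero_of_deriv {E : Type*} [Field E] (F T : E[X]) (hF : F ≠ 0) (b : E) (hb : b ≠ 0)
    (hT : derivative T = C b) : F.comp T ≠ 0 := by
  intro h
  rcases comp_eq_zero_iff.1 h with h | ⟨_, h⟩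
  · exact hF h
  · rw [h, derivative_C] at hT
    exact hb (C_eq_zero.1 hT.symm)

variable {L : Type} [Field L] [Fintype L] [CharP L 2]

theorem mulChar_pair (χ₁ χ₂ : MulChar L ℂ) (h : ¬ (χ₁ = 1 ∧ χ₂ = 1)) :
    ∃ (χ : MulChar L ℂ) (i j : ℕ), 0 < i ∧ 0 < j ∧ χ₁ = χ ^ i ∧ χ₂ = χ ^ j ∧ χ ≠ 1 ∧
      ∀ p : ℕ, p.Prime → p ∣ orderOf χ → ¬ (p ∣ i ∧ p ∣ j) := by
  classical
  have hN : Fintype.card L - 1 ≠ 0 := by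
    have := Fintype.one_lt_card (α := L); omega
  obtain ⟨χ₀, hχ₀⟩ := MulChar.exists_mulChar_orderOf L (R := ℂ) (dvd_refl (Fintype.card L - 1))
    (Complex.isPrimitiveRoot_exp _ hN)
  set N := Fintype.card L - 1
  have hcard : Nat.card (MulChar L ℂ) = N := by
    rw [MulChar.card_eq_card_units_of_hasEnoughRootsOfUnity, Nat.card_eq_fintype_card,
      Fintype.card_units]
  have hgen : ∀ χ : MulChar L ℂ, ∃ i, 0 < i ∧ χ = χ₀ ^ i := by
    intro χ
    have h1 : Subgroup.zpowers χ₀ = ⊤ := by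
      apply Subgroup.eq_top_of_card_eq
      rw [Nat.card_zpowers, hχ₀, hcard]
    have h2 : χ ∈ Subgroup.zpowers χ₀ := by rw [h1]; trivial
    obtain ⟨i, hi⟩ := (mem_powers_iff_mem_zpowers.2 h2 : χ ∈ Submonoid.powers χ₀)
    refine ⟨i + N, by omega, ?_⟩
    rw [pow_add, ← hχ₀, pow_orderOf_eq_one, mul_one]
    exact hi.symm
  obtain ⟨i, hi, rfl⟩ := hgen χ₁
  obtain ⟨j, hj, rfl⟩ := hgen χ₂
  set g := Nat.gcd (Nat.gcd i j) N with hg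
  have hgpos : 0 < g := Nat.gcd_pos_of_pos_right _ (by omega)
  have hgN : g ∣ N := Nat.gcd_dvd_right _ _
  obtain ⟨i', hi'⟩ : g ∣ i := (Nat.gcd_dvd_left _ _).trans (Nat.gcd_dvd_left _ _)
  obtain ⟨j', hj'⟩ : g ∣ j := (Nat.gcd_dvd_left _ _).trans (Nat.gcd_dvd_right _ _)
  refine ⟨χ₀ ^ g, i', j', ?_, ?_, by rw [← pow_mul, hi'], by rw [← pow_mul, hj'], ?_, ?_⟩
  · rcases Nat.eq_zero_or_pos i' with h | h
    · rw [h, mul_zero] at hi'; omega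
    · exact h
  · rcases Nat.eq_zero_or_pos j' with h | h
    · rw [h, mul_zero] at hj'; omega
    · exact h
  · intro h1
    exact h ⟨by rw [hi', pow_mul, h1, one_pow], by rw [hj', pow_mul, h1, one_pow]⟩
  · intro p hp hpd ⟨h1, h2⟩
    rw [orderOf_pow_of_dvd hgpos.ne' (hχ₀.symm ▸ hgN), hχ₀] at hpd
    have h3 : g * p ∣ g := by
      rw [hg]
      refine Nat.dvd_gcd (Nat.dvd_gcd ?_ ?_) ?_
      · rw [← hg, hi']; exact mul_dvd_mul_left _ h1
      · rw [← hg, hj']; exact mul_dvd_mul_left _ h2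
      · rw [← hg]; exact (mul_dvd_mul_left g hpd).trans (by rw [Nat.mul_div_cancel' hgN])
    have h4 := Nat.le_of_dvd hgpos h3
    have := hp.two_le
    nlinarith

/-- The data extracted from membership in `Upsilon`. -/
structure GoodPair (f₁ f₂ : L[X]) : Prop where
  ne1 : f₁ ≠ 0
  ne2 : f₂ ≠ 0
  deg1 : f₁.natDegree ≤ 3
  deg2 : f₂.natDegree ≤ 2
  root : ∃ (ρ : AlgebraicClosure L) (k : ℕ), ρ ≠ 0 ∧ Nat.gcd k (Fintype.card L - 1) = 1 ∧
    ((rootMultiplicity ρ (f₁.map (algebraMap L (AlgebraicClosure L))) = k ∧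
      rootMultiplicity ρ (f₂.map (algebraMap L (AlgebraicClosure L))) = 0) ∨
     (rootMultiplicity ρ (f₁.map (algebraMap L (AlgebraicClosure L))) = 0 ∧
      rootMultiplicity ρ (f₂.map (algebraMap L (AlgebraicClosure L))) = k))

theorem char_bound (n : ℕ) (hQ : Fintype.card L = 2 ^ n) (f₁ f₂ : L[X]) (hf : GoodPair f₁ f₂)
    (T : L[X]) (b : L) (hb : b ≠ 0) (hT : derivative T = C b)
    (χ₁ χ₂ : MulChar L ℂ) (h : ¬ (χ₁ = 1 ∧ χ₂ = 1)) :
    ‖∑ x : L, χ₁ (T.eval x) * (χ₂ (f₁.eval (T.eval x)) * χ₂⁻¹ (f₂.eval (T.eval x)))‖ ≤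
      6 * T.natDegree * Real.sqrt (2 ^ n) := by
  classical
  obtain ⟨χ, i, j, hi, hj, rfl, rfl, hχ, hp⟩ := mulChar_pair χ₁ χ₂ h
  set d := orderOf χ with hd
  have hd2 : 2 ≤ d := by
    have h1 : 0 < d := orderOf_pos χ
    have h2 : d ≠ 1 := fun h => hχ (orderOf_eq_one_iff.1 h)
    omega
  have hinv : (χ ^ j)⁻¹ = χ ^ ((d - 1) * j) := by
    rw [inv_eq_iff_mul_eq_one, ← pow_add]
    have : j + (d - 1) * j = d * j := by
      obtain ⟨e, he⟩ : ∃ e, d = e + 1 := ⟨d - 1, by omega⟩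
      rw [he]; simp; ring
    rw [this, pow_mul, hd, pow_orderOf_eq_one, one_pow]
  have hj' : (d - 1) * j ≠ 0 := Nat.mul_ne_zero (by omega) (by omega)
  set F₁ := f₁.comp T
  set F₂ := f₂.comp T
  have hF₁ : F₁ ≠ 0 := comp_ne_zero_of_deriv _ _ hf.ne1 b hb hT
  have hF₂ : F₂ ≠ 0 := comp_ne_zero_of_deriv _ _ hf.ne2 b hb hT
  have hT0 : T ≠ 0 := by
    rintro rfl; rw [derivative_zero] at hT; exact hb (C_eq_zero.1 hT.symm)
  set A := AlgebraicClosure L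
  set m := algebraMap L A
  obtain ⟨ρ, k, hρ, hk, hrk⟩ := hf.root
  have hm : Function.Injective m := m.injective
  have hT' : derivative (T.map m) = C (m b) := by rw [derivative_map, hT, map_C]
  have hb' : m b ≠ 0 := by rwa [Ne, map_eq_zero]
  have hmul : ∀ r : A, rootMultiplicity r ((T ^ i * (F₁ ^ j * F₂ ^ ((d - 1) * j))).map m) =
      i * rootMultiplicity ((T.map m).eval r) X +
      (j * rootMultiplicity ((T.map m).eval r) (f₁.map m) +
        (d - 1) * j * rootMultiplicity ((T.map m).eval r) (f₂.map m)) := by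
    intro r
    have e0 : T.map m = X.comp (T.map m) := by rw [X_comp]
    have z0 : T.map m ≠ 0 := (Polynomial.map_ne_zero_iff hm).2 hT0
    have z1 : F₁.map m ≠ 0 := (Polynomial.map_ne_zero_iff hm).2 hF₁
    have z2 : F₂.map m ≠ 0 := (Polynomial.map_ne_zero_iff hm).2 hF₂
    rw [Polynomial.map_mul, Polynomial.map_mul, Polynomial.map_pow, Polynomial.map_pow,
      Polynomial.map_pow, rootMultiplicity_mul (mul_ne_zero (pow_ne_zero _ z0)
        (mul_ne_zero (pow_ne_zero _ z1) (pow_ne_zero _ z2))),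
      rootMultiplicity_mul (mul_ne_zero (pow_ne_zero _ z1) (pow_ne_zero _ z2)),
      rootMult_pow, rootMult_pow, rootMult_pow]
    have e1 : rootMultiplicity r (F₁.map m) = rootMultiplicity ((T.map m).eval r) (f₁.map m) := by
      rw [Polynomial.map_comp, rootMult_comp _ _ ((Polynomial.map_ne_zero_iff hm).2 hf.ne1) r _ hb' hT']
    have e2 : rootMultiplicity r (F₂.map m) = rootMultiplicity ((T.map m).eval r) (f₂.map m) := by
      rw [Polynomial.map_comp, rootMult_comp _ _ ((Polynomial.map_ne_zero_iff hm).2 hf.ne2) r _ hb' hT']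
    have e3 : rootMultiplicity r (T.map m) = rootMultiplicity ((T.map m).eval r) X := by
      conv_lhs => rw [e0]
      rw [rootMult_comp _ _ X_ne_zero r _ hb' hT']
    rw [e1, e2, e3]
  have hw := weil n hQ χ hχ (T ^ i * (F₁ ^ j * F₂ ^ ((d - 1) * j))) (T * (F₁ * F₂))
    (mul_ne_zero (pow_ne_zero _ hT0) (mul_ne_zero (pow_ne_zero _ hF₁) (pow_ne_zero _ hF₂)))
    (mul_ne_zero hT0 (mul_ne_zero hF₁ hF₂)) (i + j + (d - 1) * j) (by
      rw [mul_pow, mul_pow]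
      refine mul_dvd_mul (pow_dvd_pow _ (by omega)) (mul_dvd_mul (pow_dvd_pow _ (by omega))
        (pow_dvd_pow _ (by omega)))) (by
      intro p hpp hpd
      by_cases hpj : p ∣ j
      · have hpi : ¬ p ∣ i := fun h => hp p hpp hpd ⟨h, hpj⟩
        obtain ⟨r, hr⟩ := exists_preimage (T.map m) _ hb' hT' 0
        refine ⟨r, ?_⟩
        rw [hmul, hr]
        have : rootMultiplicity (0 : A) X = 1 := by
          simpa using rootMultiplicity_X_sub_C_self (x := (0 : A))
        rw [this, mul_one]
        intro h
        refine hpi ((Nat.dvd_add_left ?_).1 h)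
        exact dvd_add (hpj.mul_right _) ((hpj.mul_left _).mul_right _)
      · obtain ⟨r, hr⟩ := exists_preimage (T.map m) _ hb' hT' ρ
        refine ⟨r, ?_⟩
        rw [hmul, hr]
        have : rootMultiplicity ρ (X : A[X]) = 0 := by
          apply rootMultiplicity_eq_zero
          simpa using hρ
        rw [this, mul_zero, zero_add]
        have hpN : p ∣ Fintype.card L - 1 := hpd.trans (MulChar.orderOf_dvd_card_sub_one _ χ)
        have hpk : ¬ p ∣ k := by
          intro h
          have := Nat.dvd_gcd h hpN
          rw [hk] at this
          exact hpp.one_lt.ne' (Nat.dvd_one.1 this)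
        have hpd1 : ¬ p ∣ d - 1 := by
          intro h
          have h5 := (Nat.dvd_sub hpd h)
          rw [show d - (d - 1) = 1 by omega] at h5
          exact hpp.one_lt.ne' (Nat.dvd_one.1 h5)
        rcases hrk with ⟨h1, h2⟩ | ⟨h1, h2⟩
        · rw [h1, h2, mul_zero, add_zero, hpp.dvd_mul]
          tauto
        · rw [h1, h2, mul_zero, zero_add, hpp.dvd_mul, hpp.dvd_mul]
          tauto)
  have hsum : ∑ x : L, (χ ^ i) (T.eval x) * ((χ ^ j) (f₁.eval (T.eval x)) * (χ ^ j)⁻¹ (f₂.eval (T.eval x)))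
      = ∑ x : L, χ ((T ^ i * (F₁ ^ j * F₂ ^ ((d - 1) * j))).eval x) := by
    refine Finset.sum_congr rfl fun x _ => ?_
    rw [hinv, MulChar.pow_apply' _ hi.ne', MulChar.pow_apply' _ hj.ne', MulChar.pow_apply' _ hj']
    simp only [eval_mul, eval_pow, map_mul, map_pow, F₁, F₂, eval_comp]
  rw [hsum]
  refine hw.trans (mul_le_mul_of_nonneg_right ?_ (Real.sqrt_nonneg _))
  have hdeg : (T * (F₁ * F₂)).natDegree ≤ 6 * T.natDegree := by
    refine natDegree_mul_le.trans ?_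
    have := natDegree_mul_le (p := F₁) (q := F₂)
    have e1 : F₁.natDegree ≤ 3 * T.natDegree := by
      rw [natDegree_comp]; exact Nat.mul_le_mul_right _ hf.deg1
    have e2 : F₂.natDegree ≤ 2 * T.natDegree := by
      rw [natDegree_comp]; exact Nat.mul_le_mul_right _ hf.deg2
    omega
  exact_mod_cast (Nat.sub_le _ _).trans hdeg

end P8


section P9
variable {K L : Type} [Field K] [Field L] [Fintype K] [Fintype L] [Algebra K L] [CharP L 2]

theorem goodPair_of (f₁ f₂ : L[X]) (h2 : f₂ ≠ 0) (hd1 : f₁.natDegree ≤ 3) (hd2 : f₂.natDegree ≤ 2)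
    (hc : IsCoprime f₁ f₂) (k : ℕ) (g : L[X]) (hg : g.Monic) (hi : Irreducible g)
    (hX : g ≠ X) (hk : Nat.gcd k (Fintype.card L - 1) = 1) (hdvd : g ^ k ∣ f₁ * f₂)
    (hnd : ¬ g ^ (k + 1) ∣ f₁ * f₂) : GoodPair f₁ f₂ := by
  have h1 : f₁ ≠ 0 := by
    rintro rfl; apply hnd; simp
  set m := algebraMap L (AlgebraicClosure L) with hm
  have hminj : Function.Injective m := m.injective
  obtain ⟨ρ, hρ⟩ := IsAlgClosed.exists_root (g.map m) (by
    rw [degree_map]; exact (degree_pos_of_irreducible hi).ne')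
  have hρ' : aeval ρ g = 0 := by rw [aeval_def, ← eval_map]; exact hρ
  have hmin : minpoly L ρ = g := (minpoly.eq_of_irreducible_of_monic hi hρ' hg).symm
  have hone : rootMultiplicity ρ (g.map m) = 1 := by
    have hs : (g.map m).Separable := (PerfectField.separable_of_irreducible hi).map
    have h3 := rootMultiplicity_le_one_of_separable hs ρ
    have h4 := (rootMultiplicity_pos (hg.map m).ne_zero).2 hρ
    omega
  obtain ⟨h, hh⟩ := hdvd
  have hgh : ¬ g ∣ h := by
    rintro ⟨u, rfl⟩
    exact hnd ⟨u, by rw [hh]; ring⟩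
  have hhr : ¬ (h.map m).IsRoot ρ := by
    intro hr
    apply hgh
    rw [← hmin]
    apply minpoly.dvd
    rw [aeval_def, ← eval_map]; exact hr
  have z1 : f₁.map m ≠ 0 := (Polynomial.map_ne_zero_iff hminj).2 h1
  have z2 : f₂.map m ≠ 0 := (Polynomial.map_ne_zero_iff hminj).2 h2
  have hsum : rootMultiplicity ρ (f₁.map m) + rootMultiplicity ρ (f₂.map m) = k := by
    rw [← rootMultiplicity_mul (mul_ne_zero z1 z2), ← Polynomial.map_mul, hh, Polynomial.map_mul,
      rootMultiplicity_mul, Polynomial.map_pow, rootMult_pow, hone, rootMultiplicity_eq_zero hhr]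
    · simp
    · rw [← Polynomial.map_mul, ← hh, Polynomial.map_mul]; exact mul_ne_zero z1 z2
  have hnot : ¬ (0 < rootMultiplicity ρ (f₁.map m) ∧ 0 < rootMultiplicity ρ (f₂.map m)) := by
    rintro ⟨a1, a2⟩
    rw [rootMultiplicity_pos z1] at a1
    rw [rootMultiplicity_pos z2] at a2
    obtain ⟨u, v, huv⟩ := hc
    have := congrArg (fun p => (p.map m).eval ρ) huv
    simp only [Polynomial.map_add, Polynomial.map_mul, eval_add, eval_mul] at this
    rw [IsRoot.def.1 a1, IsRoot.def.1 a2] at this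
    simp at this
  refine ⟨h1, h2, hd1, hd2, ρ, k, ?_, hk, ?_⟩
  · rintro rfl
    rw [minpoly.zero] at hmin
    exact hX hmin.symm
  · change (rootMultiplicity ρ (f₁.map m) = k ∧ rootMultiplicity ρ (f₂.map m) = 0) ∨
      (rootMultiplicity ρ (f₁.map m) = 0 ∧ rootMultiplicity ρ (f₂.map m) = k)
    clear_value m
    omega

theorem affine_bound (hK : Fintype.card K = 2) (n : ℕ) (hQ : Fintype.card L = 2 ^ n)
    (f₁ f₂ : L[X]) (hf : GoodPair f₁ f₂) (V : Submodule K L) (c : L) (A : Finset L)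
    (hA : ∀ α, α ∈ A ↔ α - c ∈ V)
    (χ₁ χ₂ : MulChar L ℂ) (h : ¬ (χ₁ = 1 ∧ χ₂ = 1)) :
    ‖∑ α ∈ A, χ₁ α * (χ₂ (f₁.eval α) * χ₂⁻¹ (f₂.eval α))‖ ≤ 6 * Real.sqrt (2 ^ n) := by
  classical
  obtain ⟨w, T, ⟨b, hb, hT⟩, hdeg, φ, hφ, hrange, hker⟩ := exists_T hK V
  have hcb := char_bound n hQ f₁ f₂ hf (T + C c) b hb (by simp [hT]) χ₁ χ₂ h
  set F : L → ℂ := fun α => χ₁ α * (χ₂ (f₁.eval α) * χ₂⁻¹ (f₂.eval α)) with hF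
  have hsum : ∑ x : L, F ((T + C c).eval x) = 2 ^ w * ∑ α ∈ A, F α := by
    have hmaps : ∀ x ∈ (Finset.univ : Finset L), (T + C c).eval x ∈ A := by
      intro x _
      rw [hA, eval_add, eval_C, add_sub_cancel_right, ← hφ, ← hrange]
      exact ⟨x, rfl⟩
    rw [← Finset.sum_fiberwise_of_maps_to hmaps, Finset.mul_sum]
    refine Finset.sum_congr rfl fun α hα => ?_
    rw [Finset.sum_congr rfl (g := fun _ => F α) (by
      intro x hx
      rw [(Finset.mem_filter.1 hx).2]), Finset.sum_const, nsmul_eq_mul]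
    congr 1
    rw [hA, ← hrange] at hα
    obtain ⟨x₀, hx₀⟩ := hα
    have : (Finset.univ.filter (fun x => (T + C c).eval x = α)).card = 2 ^ w := by
      have e1 : Nat.card (LinearMap.ker φ) = (LinearMap.ker φ : Set L).toFinset.card :=
        Nat.card_eq_card_toFinset (LinearMap.ker φ : Set L)
      rw [← hker, e1]
      refine Finset.card_bij (fun x _ => x - x₀) ?_ ?_ ?_
      · intro x hx
        have := (Finset.mem_filter.1 hx).2
        rw [eval_add, eval_C, ← hφ] at this
        rw [Set.mem_toFinset, SetLike.mem_coe, LinearMap.mem_ker, map_sub, hx₀, ← this]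
        ring
      · intro x _ y _ h
        exact sub_left_injective h
      · intro y hy
        rw [Set.mem_toFinset, SetLike.mem_coe, LinearMap.mem_ker] at hy
        refine ⟨y + x₀, ?_, by ring⟩
        rw [Finset.mem_filter]
        refine ⟨Finset.mem_univ _, ?_⟩
        rw [eval_add, eval_C, ← hφ, map_add, hy, hx₀]; ring
    rw [this]; push_cast; rfl
  rw [hsum, natDegree_add_C, hdeg, norm_mul] at hcb
  have h2 : ‖(2 : ℂ) ^ w‖ = 2 ^ w := by simp
  rw [h2] at hcb
  push_cast at hcb
  have hpos : (0 : ℝ) < 2 ^ w := by positivity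
  refine le_of_mul_le_mul_left ?_ hpos
  linarith
end P9


section P10
variable {L : Type} [Field L] [Fintype L]

/-- `F` is `m` plus a combination of nontrivial characters of exponent `e` with total weight `r`. -/
def CRep (e : ℕ) (F : L → ℝ) (m r : ℝ) : Prop :=
  ∃ (ι : Type) (_ : Fintype ι) (a : ι → ℂ) (χ : ι → MulChar L ℂ),
    (∀ i, χ i ≠ 1) ∧ (∀ i, χ i ^ e = 1) ∧ (∑ i, ‖a i‖ ≤ r) ∧
    ∀ x : L, x ≠ 0 → (F x : ℂ) = m + ∑ i, a i * χ i x

theorem CRep.mono {e : ℕ} {F : L → ℝ} {m r r' : ℝ} (h : CRep e F m r) (hr : r ≤ r') :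
    CRep e F m r' := by
  obtain ⟨ι, _, a, χ, h1, h2, h3, h4⟩ := h
  exact ⟨ι, _, a, χ, h1, h2, h3.trans hr, h4⟩

theorem CRep.one : CRep (L := L) 1 (fun _ => 1) 1 0 :=
  ⟨Empty, inferInstance, fun i => i.elim, fun i => i.elim, fun i => i.elim, fun i => i.elim,
    by simp, by simp⟩

theorem CRep.mul {e e' : ℕ} {F F' : L → ℝ} {m r m' r' : ℝ} (h : CRep e F m r) (h' : CRep e' F' m' r')
    (he : Nat.Coprime e e') (hm : 0 ≤ m) (hm' : 0 ≤ m') :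
    CRep (e * e') (fun x => F x * F' x) (m * m') (m * r' + m' * r + r * r') := by
  obtain ⟨ι, _, a, χ, h1, h2, h3, h4⟩ := h
  obtain ⟨ι', _, a', χ', h1', h2', h3', h4'⟩ := h'
  refine ⟨(ι' ⊕ ι) ⊕ (ι × ι'), inferInstance,
    Sum.elim (Sum.elim (fun i => m * a' i) (fun i => m' * a i)) (fun i => a i.1 * a' i.2),
    Sum.elim (Sum.elim χ' χ) (fun i => χ i.1 * χ' i.2), ?_, ?_, ?_, ?_⟩
  · rintro ((i | i) | i)
    · exact h1' i
    · exact h1 i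
    · intro h
      simp only [Sum.elim_inr] at h
      apply h1 i.1
      have hd : orderOf (χ i.1) ∣ Nat.gcd e e' := by
        refine Nat.dvd_gcd (orderOf_dvd_of_pow_eq_one (h2 _)) (orderOf_dvd_of_pow_eq_one ?_)
        rw [eq_inv_of_mul_eq_one_left h, inv_pow, h2', inv_one]
      rw [he] at hd
      exact orderOf_eq_one_iff.1 (Nat.dvd_one.1 hd)
  · rintro ((i | i) | i)
    · simp only [Sum.elim_inl]; rw [mul_comm, pow_mul, h2', one_pow]
    · simp only [Sum.elim_inl, Sum.elim_inr]; rw [pow_mul, h2, one_pow]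
    · simp only [Sum.elim_inr]
      rw [mul_pow, pow_mul, h2, one_pow, mul_comm e, pow_mul, h2', one_pow, one_mul]
  · rw [Fintype.sum_sum_type, Fintype.sum_sum_type, Fintype.sum_prod_type]
    simp only [Sum.elim_inl, Sum.elim_inr, norm_mul, ← Finset.mul_sum, Complex.norm_real,
      Real.norm_of_nonneg hm, Real.norm_of_nonneg hm', ← Finset.sum_mul]
    have : 0 ≤ ∑ i, ‖a i‖ := Finset.sum_nonneg fun _ _ => norm_nonneg _
    have : 0 ≤ ∑ i, ‖a' i‖ := Finset.sum_nonneg fun _ _ => norm_nonneg _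
    gcongr
    linarith
  · intro x hx
    push_cast
    rw [h4 x hx, h4' x hx, Fintype.sum_sum_type, Fintype.sum_sum_type, Fintype.sum_prod_type]
    simp only [Sum.elim_inl, Sum.elim_inr, MulChar.coeToFun_mul, Pi.mul_apply]
    have e1 : ∑ i, ∑ j, a i * a' j * (χ i x * χ' j x) = (∑ i, a i * χ i x) * ∑ j, a' j * χ' j x := by
      rw [Finset.sum_mul_sum]
      refine Finset.sum_congr rfl fun i _ => Finset.sum_congr rfl fun j _ => ?_
      ring
    have e2 : ∑ i, m * a' i * χ' i x = m * ∑ j, a' j * χ' j x := by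
      rw [Finset.mul_sum]
      refine Finset.sum_congr rfl fun i _ => ?_
      ring
    have e3 : ∑ i, m' * a i * χ i x = m' * ∑ j, a j * χ j x := by
      rw [Finset.mul_sum]
      refine Finset.sum_congr rfl fun i _ => ?_
      ring
    rw [e1, e2, e3]; ring

/-- A character of order `p` detects `p`-th powers. -/
noncomputable def Jf (χ : MulChar L ℂ) (x : L) : ℝ := open Classical in if χ x = 1 then 1 else 0

theorem CRep_J {p : ℕ} (hp : p.Prime) (χ : MulChar L ℂ) (hχ : orderOf χ = p) :
    CRep p (Jf χ) (1 / p) ((p - 1) / p) := by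
  have hp0 : (p : ℂ) ≠ 0 := by exact_mod_cast hp.ne_zero
  have hp1 := hp.one_lt
  refine ⟨Fin (p - 1), inferInstance, fun _ => 1 / p, fun i => χ ^ ((i : ℕ) + 1), ?_, ?_, ?_, ?_⟩
  · intro i h
    have := orderOf_dvd_of_pow_eq_one h
    rw [hχ] at this
    have := Nat.le_of_dvd (by omega) this
    have := i.2
    omega
  · intro i
    rw [← pow_mul, mul_comm, pow_mul]
    have : χ ^ p = 1 := by rw [← hχ]; exact pow_orderOf_eq_one χ
    rw [this, one_pow]
  · have : ((p - 1 : ℕ) : ℝ) = p - 1 := by rw [Nat.cast_sub hp1.le]; simp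
    simp [this]
    rw [div_eq_mul_inv]
  · intro x hx
    have hx1 : (χ x) ^ p = 1 := by
      rw [← MulChar.pow_apply' _ hp.ne_zero, ← hχ, pow_orderOf_eq_one, MulChar.one_apply (IsUnit.mk0 _ hx)]
    have hs : ((1 / p : ℝ) : ℂ) + ∑ i : Fin (p - 1), 1 / (p : ℂ) * (χ ^ ((i : ℕ) + 1)) x
        = 1 / p * ∑ i ∈ Finset.range p, (χ x) ^ i := by
      obtain ⟨q, rfl⟩ : ∃ q, p = q + 1 := ⟨p - 1, by omega⟩
      rw [Finset.sum_range_succ', ← Finset.mul_sum, pow_zero]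
      change ((1 / (q + 1 : ℕ) : ℝ) : ℂ) + 1 / ((q + 1 : ℕ) : ℂ) * ∑ i : Fin q, (χ ^ ((i : ℕ) + 1)) x = _
      rw [Fin.sum_univ_eq_sum_range (fun i => (χ ^ (i + 1)) x) q]
      rw [Finset.sum_congr rfl (g := fun i => χ x ^ (i + 1)) (fun i _ =>
        MulChar.pow_apply' _ (by omega) x)]
      push_cast
      ring
    rw [hs, Jf]
    split_ifs with h
    · simp [h, hp0]
    · have := mul_neg_geom_sum (χ x) p
      rw [hx1, sub_self, mul_eq_zero] at this
      rcases this with h2 | h2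
      · exact absurd (sub_eq_zero.1 h2).symm h
      · simp [h2]

theorem CRep_I {p : ℕ} (hp : p.Prime) (χ : MulChar L ℂ) (hχ : orderOf χ = p) :
    CRep p (fun x => 1 - Jf χ x) (1 - 1 / p) (1 - 1 / p) := by
  have hp0 : (p : ℝ) ≠ 0 := by exact_mod_cast hp.ne_zero
  obtain ⟨ι, _, a, ψ, h1, h2, h3, h4⟩ := CRep_J hp χ hχ
  refine ⟨ι, inferInstance, fun i => - a i, ψ, h1, h2, ?_, ?_⟩
  · simp only [norm_neg]
    refine h3.trans (le_of_eq ?_)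
    field_simp
  · intro x hx
    have := h4 x hx
    push_cast
    rw [this]
    simp only [neg_mul, Finset.sum_neg_distrib]
    push_cast
    ring

theorem CRep_core (X : ℕ → MulChar L ℂ) (S : Finset ℕ) (hS : ∀ p ∈ S, p.Prime ∧ orderOf (X p) = p) :
    CRep (∏ p ∈ S, p) (fun x => ∏ p ∈ S, (1 - Jf (X p) x)) (∏ p ∈ S, (1 - 1 / (p : ℝ)))
      ((2 ^ S.card - 1) * ∏ p ∈ S, (1 - 1 / (p : ℝ))) ∧ 0 < ∏ p ∈ S, (1 - 1 / (p : ℝ)) := by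
  classical
  induction S using Finset.induction_on with
  | empty =>
    refine ⟨?_, by simp⟩
    simpa using CRep.one (L := L)
  | insert p S hpS ih =>
    obtain ⟨ih, hpos⟩ := ih (fun q hq => hS q (Finset.mem_insert_of_mem hq))
    obtain ⟨hp, hχ⟩ := hS p (Finset.mem_insert_self _ _)
    have h1 : (0 : ℝ) < 1 - 1 / (p : ℝ) := by
      have : (1 : ℝ) < p := by exact_mod_cast hp.one_lt
      rw [sub_pos, div_lt_one (by linarith)]; exact this
    have := CRep.mul (CRep_I hp (X p) hχ) ih (by
      apply Nat.Coprime.prod_right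
      intro q hq
      refine (Nat.coprime_primes hp (hS q (Finset.mem_insert_of_mem hq)).1).2 ?_
      rintro rfl; exact hpS hq) h1.le hpos.le
    simp only [Finset.prod_insert hpS, Finset.card_insert_of_notMem hpS]
    refine ⟨?_, mul_pos h1 hpos⟩
    convert this using 1
    rw [pow_succ]; ring

end P10


section P11
variable {L : Type} [Field L] [Fintype L]

theorem pair_sum (f₁ f₂ : L[X]) (A A' : Finset L)
    (hA' : ∀ α, α ∈ A' ↔ α ∈ A ∧ α ≠ 0 ∧ f₁.eval α ≠ 0 ∧ f₂.eval α ≠ 0) (B : ℝ) (hB0 : 0 ≤ B)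
    (hB : ∀ χ₁ χ₂ : MulChar L ℂ, ¬ (χ₁ = 1 ∧ χ₂ = 1) →
      ‖∑ α ∈ A, χ₁ α * (χ₂ (f₁.eval α) * χ₂⁻¹ (f₂.eval α))‖ ≤ B)
    {e₁ e₂ : ℕ} {F₁ F₂ : L → ℝ} {m₁ r₁ m₂ r₂ : ℝ} (h₁ : CRep e₁ F₁ m₁ r₁) (h₂ : CRep e₂ F₂ m₂ r₂)
    (hm₁ : 0 ≤ m₁) (hm₂ : 0 ≤ m₂) :
    |∑ α ∈ A', F₁ α * F₂ (f₁.eval α / f₂.eval α) - m₁ * m₂ * A'.card| ≤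
      (m₁ * r₂ + m₂ * r₁ + r₁ * r₂) * B := by
  classical
  obtain ⟨ι, _, a, χ, x1, x2, x3, x4⟩ := h₁
  obtain ⟨ι', _, b, ψ, y1, y2, y3, y4⟩ := h₂
  set D : MulChar L ℂ → MulChar L ℂ → L → ℂ :=
    fun χ₁ χ₂ α => χ₁ α * (χ₂ (f₁.eval α) * χ₂⁻¹ (f₂.eval α)) with hD
  have hB' : ∀ χ₁ χ₂ : MulChar L ℂ, ¬ (χ₁ = 1 ∧ χ₂ = 1) → ‖∑ α ∈ A', D χ₁ χ₂ α‖ ≤ B := by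
    intro χ₁ χ₂ h
    have : ∑ α ∈ A', D χ₁ χ₂ α = ∑ α ∈ A, D χ₁ χ₂ α := by
      refine Finset.sum_subset (fun α hα => ((hA' α).1 hα).1) ?_
      intro α hα hα'
      rw [hA'] at hα'
      have : α = 0 ∨ f₁.eval α = 0 ∨ f₂.eval α = 0 := by tauto
      rw [hD]; dsimp only
      rcases this with h | h | h <;> simp [h, MulChar.map_zero]
    rw [this]; exact hB χ₁ χ₂ h
  have hterm : ∀ α ∈ A', ((F₁ α * F₂ (f₁.eval α / f₂.eval α) : ℝ) : ℂ) = m₁ * m₂ +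
      (∑ j, m₁ * b j * D 1 (ψ j) α + ∑ i, m₂ * a i * D (χ i) 1 α +
        ∑ i, ∑ j, a i * b j * D (χ i) (ψ j) α) := by
    intro α hα
    obtain ⟨-, h0, h1, h2⟩ := (hA' α).1 hα
    have hdiv : ∀ ξ : MulChar L ℂ, ξ (f₁.eval α / f₂.eval α) = ξ (f₁.eval α) * ξ⁻¹ (f₂.eval α) := by
      intro ξ
      rw [div_eq_mul_inv, map_mul, MulChar.inv_apply']
    have o1 : (1 : MulChar L ℂ) α = 1 := MulChar.one_apply (IsUnit.mk0 _ h0)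
    have o2 : (1 : MulChar L ℂ) (f₁.eval α) = 1 := MulChar.one_apply (IsUnit.mk0 _ h1)
    have o3 : (1 : MulChar L ℂ) (f₂.eval α) = 1 := MulChar.one_apply (IsUnit.mk0 _ h2)
    push_cast
    rw [x4 α h0, y4 _ (div_ne_zero h1 h2)]
    simp only [hD, inv_one, o1, o2, o3, mul_one, one_mul, hdiv]
    have e1 : ∑ i, ∑ j, a i * b j * (χ i α * (ψ j (f₁.eval α) * (ψ j)⁻¹ (f₂.eval α)))
        = (∑ i, a i * χ i α) * ∑ j, b j * (ψ j (f₁.eval α) * (ψ j)⁻¹ (f₂.eval α)) := by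
      rw [Finset.sum_mul_sum]
      refine Finset.sum_congr rfl fun i _ => Finset.sum_congr rfl fun j _ => ?_
      ring
    have e2 : ∑ j, m₁ * b j * (ψ j (f₁.eval α) * (ψ j)⁻¹ (f₂.eval α))
        = m₁ * ∑ j, b j * (ψ j (f₁.eval α) * (ψ j)⁻¹ (f₂.eval α)) := by
      rw [Finset.mul_sum]
      refine Finset.sum_congr rfl fun i _ => ?_
      ring
    have e3 : ∑ i, m₂ * a i * χ i α = m₂ * ∑ i, a i * χ i α := by
      rw [Finset.mul_sum]
      refine Finset.sum_congr rfl fun i _ => ?_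
      ring
    rw [e1, e2, e3]
    ring
  have hsum : ((∑ α ∈ A', F₁ α * F₂ (f₁.eval α / f₂.eval α) - m₁ * m₂ * A'.card : ℝ) : ℂ) =
      ∑ j, m₁ * b j * ∑ α ∈ A', D 1 (ψ j) α + ∑ i, m₂ * a i * ∑ α ∈ A', D (χ i) 1 α +
        ∑ i, ∑ j, a i * b j * ∑ α ∈ A', D (χ i) (ψ j) α := by
    rw [Complex.ofReal_sub, Complex.ofReal_sum, Finset.sum_congr rfl hterm, Finset.sum_add_distrib,
      Finset.sum_const, nsmul_eq_mul]
    push_cast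
    rw [Finset.sum_add_distrib, Finset.sum_add_distrib, Finset.sum_comm (s := A'),
      Finset.sum_comm (s := A'), Finset.sum_comm (s := A') (t := Finset.univ)]
    simp only [Finset.sum_comm (s := A'), ← Finset.mul_sum]
    ring
  have hnorm : |∑ α ∈ A', F₁ α * F₂ (f₁.eval α / f₂.eval α) - m₁ * m₂ * A'.card| ≤
      (m₁ * ∑ j, ‖b j‖ + m₂ * ∑ i, ‖a i‖ + (∑ i, ‖a i‖) * ∑ j, ‖b j‖) * B := by
    rw [← Real.norm_eq_abs, ← Complex.norm_real, hsum]
    refine (norm_add_le _ _).trans ?_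
    rw [add_mul, add_mul]
    refine add_le_add ((norm_add_le _ _).trans (add_le_add ?_ ?_)) ?_
    · rw [Finset.mul_sum, Finset.sum_mul]
      refine (norm_sum_le _ _).trans (Finset.sum_le_sum fun j _ => ?_)
      rw [norm_mul, norm_mul, Complex.norm_real, Real.norm_of_nonneg hm₁]
      exact mul_le_mul_of_nonneg_left (hB' _ _ (fun h => y1 j h.2)) (by positivity)
    · rw [Finset.mul_sum, Finset.sum_mul]
      refine (norm_sum_le _ _).trans (Finset.sum_le_sum fun j _ => ?_)
      rw [norm_mul, norm_mul, Complex.norm_real, Real.norm_of_nonneg hm₂]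
      exact mul_le_mul_of_nonneg_left (hB' _ _ (fun h => x1 j h.1)) (by positivity)
    · rw [Finset.sum_mul_sum, Finset.sum_mul]
      refine (norm_sum_le _ _).trans (Finset.sum_le_sum fun i _ => ?_)
      rw [Finset.sum_mul]
      refine (norm_sum_le _ _).trans (Finset.sum_le_sum fun j _ => ?_)
      rw [norm_mul, norm_mul]
      exact mul_le_mul_of_nonneg_left (hB' _ _ (fun h => y1 j h.2)) (by positivity)
  refine hnorm.trans ?_
  have p1 : 0 ≤ ∑ i, ‖a i‖ := Finset.sum_nonneg fun _ _ => norm_nonneg _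
  have p2 : 0 ≤ ∑ i, ‖b i‖ := Finset.sum_nonneg fun _ _ => norm_nonneg _
  refine mul_le_mul_of_nonneg_right ?_ hB0
  gcongr
  linarith


theorem Jf_nonneg (χ : MulChar L ℂ) (x : L) : 0 ≤ Jf χ x := by
  unfold Jf; split_ifs <;> norm_num

theorem Jf_le_one (χ : MulChar L ℂ) (x : L) : Jf χ x ≤ 1 := by
  unfold Jf; split_ifs <;> norm_num

theorem Jf_of_ne (χ : MulChar L ℂ) (x : L) (h : χ x ≠ 1) : Jf χ x = 0 := by
  unfold Jf; rw [if_neg h]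

theorem Jf_of_eq (χ : MulChar L ℂ) (x : L) (h : χ x = 1) : Jf χ x = 1 := by
  unfold Jf; rw [if_pos h]

variable {K : Type} [Field K] [Fintype K] [Algebra K L] [CharP L 2]

set_option maxHeartbeats 2000000 in
theorem sieve (hK : Fintype.card K = 2) (n : ℕ) (hQ : Fintype.card L = 2 ^ n)
    (f₁ f₂ : L[X]) (hf : GoodPair f₁ f₂) (X : ℕ → MulChar L ℂ) (P S : Finset ℕ)
    (hdisj : Disjoint P S) (hP : ∀ p ∈ P, p.Prime ∧ orderOf (X p) = p)
    (hS : ∀ p ∈ S, p.Prime ∧ orderOf (X p) = p)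
    (V : Submodule K L) (c : L) (A : Finset L) (hA : ∀ α, α ∈ A ↔ α - c ∈ V)
    {ι : Type} (H : Finset ι) (U : ι → Submodule K L) (ε : ι → ℝ)
    (hε : ∀ h ∈ H, ∀ B : Finset L, (∀ α, α ∈ B ↔ α ∈ A ∧ α ∈ U h) → (B.card : ℝ) ≤ ε h * A.card)
    (hmain : 6 * Real.sqrt (2 ^ n) * (4 ^ P.card * (1 + 2 * S.card) + (4 ^ P.card - 1) * H.card) <
      A.card * (1 - 2 * ∑ p ∈ S, (1 / p : ℝ) - ∑ h ∈ H, ε h)) :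
    ∃ α ∈ A, α ≠ 0 ∧ f₁.eval α ≠ 0 ∧ f₂.eval α ≠ 0 ∧ (∀ h ∈ H, α ∉ U h) ∧
      ∀ p ∈ P ∪ S, X p α ≠ 1 ∧ X p (f₁.eval α / f₂.eval α) ≠ 1 := by
  classical
  by_contra hcon
  push Not at hcon
  set B := 6 * Real.sqrt (2 ^ n) with hBdef
  have hB0 : 0 ≤ B := by positivity
  have hB6 : 6 ≤ B := by
    have : 1 ≤ Real.sqrt (2 ^ n) := by
      rw [Real.one_le_sqrt]; exact one_le_pow₀ (by norm_num)
    rw [hBdef]; linarith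
  set ok : L → Prop := fun α => α ≠ 0 ∧ f₁.eval α ≠ 0 ∧ f₂.eval α ≠ 0 with hok
  set A' := A.filter ok with hA'
  have hmA' : ∀ α, α ∈ A' ↔ α ∈ A ∧ α ≠ 0 ∧ f₁.eval α ≠ 0 ∧ f₂.eval α ≠ 0 := by
    intro α; rw [hA', Finset.mem_filter]
  have hA'le : A'.card ≤ A.card := Finset.card_filter_le _ _
  have hA'ge : (A.card : ℝ) ≤ A'.card + 6 := by
    have h1 : A ⊆ A' ∪ (Polynomial.X * (f₁ * f₂)).roots.toFinset := by
      intro α hα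
      rw [Finset.mem_union, hmA', Multiset.mem_toFinset, mem_roots
        (mul_ne_zero X_ne_zero (mul_ne_zero hf.ne1 hf.ne2)), IsRoot.def]
      simp only [eval_mul, eval_X, mul_eq_zero]
      tauto
    have h2 := (Finset.card_le_card h1).trans (Finset.card_union_le _ _)
    have h3 := (Multiset.toFinset_card_le (Polynomial.X * (f₁ * f₂)).roots).trans (card_roots' _)
    have h4 : (Polynomial.X * (f₁ * f₂)).natDegree ≤ 6 := by
      refine natDegree_mul_le.trans ?_
      have := natDegree_mul_le (p := f₁) (q := f₂)
      have := hf.deg1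
      have := hf.deg2
      rw [natDegree_X]
      omega
    exact_mod_cast (by omega : A.card ≤ A'.card + 6)
  have hBA := affine_bound hK n hQ f₁ f₂ hf V c A hA
  set I : L → ℝ := fun x => ∏ p ∈ P, (1 - Jf (X p) x) with hI
  have hI0 : ∀ x, 0 ≤ I x := fun x => Finset.prod_nonneg fun p _ => by
    have := Jf_le_one (X p) x; linarith
  set θ := ∏ p ∈ P, (1 - 1 / (p : ℝ)) with hθ
  obtain ⟨hcore, hθpos⟩ := CRep_core X P hP
  set κ : ℝ := 2 ^ P.card with hκ
  have hκ1 : 1 ≤ κ := one_le_pow₀ (by norm_num)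
  have h4 : (4 : ℝ) ^ P.card = κ ^ 2 := by
    rw [hκ, ← pow_mul, mul_comm, pow_mul]; norm_num
  set fα : L → L := fun α => f₁.eval α / f₂.eval α with hfα
  have hmainsum := (abs_le.1 (pair_sum f₁ f₂ A A' hmA' B hB0 hBA hcore hcore hθpos.le hθpos.le)).1
  have hp1 : ∀ p ∈ S, ∑ α ∈ A', I α * Jf (X p) α * I (fα α) ≤ θ ^ 2 * (1 / p * A.card + κ ^ 2 * B) ∧
      ∑ α ∈ A', I α * (I (fα α) * Jf (X p) (fα α)) ≤ θ ^ 2 * (1 / p * A.card + κ ^ 2 * B) := by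
    intro p hp
    obtain ⟨hpp, hχ⟩ := hS p hp
    have hcop : Nat.Coprime (∏ p ∈ P, p) p := by
      apply Nat.Coprime.prod_left
      intro q hq
      refine (Nat.coprime_primes (hP q hq).1 hpp).2 ?_
      rintro rfl
      exact Finset.disjoint_left.1 hdisj hq hp
    have hp0 : (0 : ℝ) < p := by exact_mod_cast hpp.pos
    have hr := CRep.mul hcore (CRep_J hpp (X p) hχ) hcop hθpos.le (by positivity)
    have hr' := hr.mono (r' := κ * θ - θ * (1 / p)) (le_of_eq (by
      field_simp; ring))
    have hm0 : 0 ≤ θ * (1 / (p : ℝ)) := by positivity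
    have a1 := (abs_le.1 (pair_sum f₁ f₂ A A' hmA' B hB0 hBA hr' hcore hm0 hθpos.le)).2
    have a2 := (abs_le.1 (pair_sum f₁ f₂ A A' hmA' B hB0 hBA hcore hr' hθpos.le hm0)).2
    have hAA : θ ^ 2 * (1 / p) * (A'.card : ℝ) ≤ θ ^ 2 * (1 / p) * (A.card : ℝ) :=
      mul_le_mul_of_nonneg_left (by exact_mod_cast hA'le) (by positivity)
    have hpB : 0 ≤ θ ^ 2 * (1 / p) * B := by positivity
    constructor
    · have : (∑ α ∈ A', I α * Jf (X p) α * I (fα α)) - θ * (1 / p) * θ * A'.card ≤ _ := a1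
      nlinarith
    · have : (∑ α ∈ A', I α * (I (fα α) * Jf (X p) (fα α))) - θ * (θ * (1 / p)) * A'.card ≤ _ := a2
      nlinarith
  have hh1 : ∀ h ∈ H, ∑ α ∈ A', (if α ∈ U h then I α * I (fα α) else 0) ≤
      θ ^ 2 * (ε h * A.card + (κ ^ 2 - 1) * B) := by
    intro h hh
    rw [← Finset.sum_filter]
    set D := A.filter (fun α => α ∈ U h) with hD
    have hDm : ∀ α, α ∈ D ↔ α ∈ A ∧ α ∈ U h := by intro α; rw [hD, Finset.mem_filter]
    have hDc := hε h hh D hDm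
    have hBD : ∀ χ₁ χ₂ : MulChar L ℂ, ¬ (χ₁ = 1 ∧ χ₂ = 1) →
        ‖∑ α ∈ D, χ₁ α * (χ₂ (f₁.eval α) * χ₂⁻¹ (f₂.eval α))‖ ≤ B := by
      rcases D.eq_empty_or_nonempty with h0 | ⟨a, ha⟩
      · intro _ _ _; rw [h0]; simpa using hB0
      · refine affine_bound hK n hQ f₁ f₂ hf (V ⊓ U h) a D ?_
        intro α
        obtain ⟨ha1, ha2⟩ := (hDm a).1 ha
        rw [hA] at ha1
        rw [hDm, hA, Submodule.mem_inf]
        constructor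
        · rintro ⟨b1, b2⟩
          refine ⟨?_, Submodule.sub_mem _ b2 ha2⟩
          have := Submodule.sub_mem _ b1 ha1
          simpa using this
        · rintro ⟨b1, b2⟩
          refine ⟨?_, ?_⟩
          · have := Submodule.add_mem _ b1 ha1
            simpa using this
          · have := Submodule.add_mem _ b2 ha2
            simpa using this
    have a1 := (abs_le.1 (pair_sum f₁ f₂ D (A'.filter (fun α => α ∈ U h)) (by
      intro α; rw [Finset.mem_filter, hmA', hDm]; tauto) B hB0 hBD hcore hcore hθpos.le hθpos.le)).2
    have a2 : ((A'.filter (fun α => α ∈ U h)).card : ℝ) ≤ ε h * A.card := by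
      refine le_trans ?_ hDc
      have : A'.filter (fun α => α ∈ U h) ⊆ D := by
        intro α hα
        rw [Finset.mem_filter, hmA'] at hα
        exact (hDm α).2 ⟨hα.1.1, hα.2⟩
      exact_mod_cast Finset.card_le_card this
    have a3 := mul_le_mul_of_nonneg_left a2 (sq_nonneg θ)
    have : (∑ α ∈ A' with α ∈ U h, I α * I (fα α)) - θ * θ * _ ≤ _ := a1
    nlinarith
  have hpt : ∀ α ∈ A', I α * I (fα α) ≤
      ∑ p ∈ S, (I α * Jf (X p) α * I (fα α) + I α * (I (fα α) * Jf (X p) (fα α))) +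
      ∑ h ∈ H, (if α ∈ U h then I α * I (fα α) else 0) := by
    intro α hα
    obtain ⟨z0, z1, z2, z3⟩ := (hmA' α).1 hα
    have hII : 0 ≤ I α * I (fα α) := mul_nonneg (hI0 _) (hI0 _)
    have n1 : ∀ p ∈ S, 0 ≤ I α * Jf (X p) α * I (fα α) + I α * (I (fα α) * Jf (X p) (fα α)) := by
      intro p _
      have := hI0 α
      have := hI0 (fα α)
      have := Jf_nonneg (X p) α
      have := Jf_nonneg (X p) (fα α)
      positivity
    have n2 : ∀ h ∈ H, 0 ≤ (if α ∈ U h then I α * I (fα α) else 0) := by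
      intro h _; split_ifs
      · exact hII
      · exact le_rfl
    have s1 := Finset.sum_nonneg n1
    have s2 := Finset.sum_nonneg n2
    by_cases hU : ∀ h ∈ H, α ∉ U h
    · obtain ⟨p, hp, hp2⟩ := hcon α z0 z1 z2 z3 hU
      rcases Finset.mem_union.1 hp with hpP | hpS
      · have : I α * I (fα α) = 0 := by
          by_cases hx : X p α = 1
          · have : I α = 0 := Finset.prod_eq_zero hpP (by rw [Jf_of_eq _ _ hx, sub_self])
            rw [this, zero_mul]
          · have : I (fα α) = 0 := Finset.prod_eq_zero hpP (by rw [Jf_of_eq _ _ (hp2 hx), sub_self])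
            rw [this, mul_zero]
        exact this.le.trans (add_nonneg s1 s2)
      · have h5 := Finset.single_le_sum n1 hpS
        have : I α * I (fα α) ≤ I α * Jf (X p) α * I (fα α) + I α * (I (fα α) * Jf (X p) (fα α)) := by
          by_cases hx : X p α = 1
          · rw [Jf_of_eq _ _ hx]
            have := mul_nonneg (mul_nonneg (hI0 α) (hI0 (fα α))) (Jf_nonneg (X p) (fα α))
            nlinarith
          · rw [Jf_of_eq _ _ (hp2 hx)]
            have := mul_nonneg (mul_nonneg (hI0 α) (hI0 (fα α))) (Jf_nonneg (X p) α)
            nlinarith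
        linarith
    · push Not at hU
      obtain ⟨h, hh, hαh⟩ := hU
      have h5 := Finset.single_le_sum n2 hh
      rw [if_pos hαh] at h5
      linarith
  have htot := Finset.sum_le_sum hpt
  rw [Finset.sum_add_distrib, Finset.sum_comm (s := A'), Finset.sum_comm (s := A')] at htot
  have hS1 : ∑ p ∈ S, ∑ α ∈ A', (I α * Jf (X p) α * I (fα α) + I α * (I (fα α) * Jf (X p) (fα α))) ≤
      ∑ p ∈ S, θ ^ 2 * (2 * (1 / p * A.card + κ ^ 2 * B)) := by
    refine Finset.sum_le_sum fun p hp => ?_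
    rw [Finset.sum_add_distrib]
    have := hp1 p hp
    linarith [this.1, this.2]
  have hH1 := Finset.sum_le_sum hh1
  have e1 : ∑ p ∈ S, θ ^ 2 * (2 * (1 / p * A.card + κ ^ 2 * B)) =
      θ ^ 2 * (2 * (∑ p ∈ S, (1 / p : ℝ)) * A.card + S.card * (2 * κ ^ 2 * B)) := by
    rw [← Finset.mul_sum, ← Finset.mul_sum, Finset.sum_add_distrib, ← Finset.sum_mul,
      Finset.sum_const, nsmul_eq_mul]
    ring
  have e2 : ∑ h ∈ H, θ ^ 2 * (ε h * A.card + (κ ^ 2 - 1) * B) =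
      θ ^ 2 * ((∑ h ∈ H, ε h) * A.card + H.card * ((κ ^ 2 - 1) * B)) := by
    rw [← Finset.mul_sum, Finset.sum_add_distrib, ← Finset.sum_mul,
      Finset.sum_const, nsmul_eq_mul]
  rw [e1] at hS1
  rw [e2] at hH1
  rw [h4] at hmain
  have hmain2 : θ ^ 2 * ((A'.card : ℝ) - (κ ^ 2 - 1) * B) ≤ ∑ α ∈ A', I α * I (fα α) := by
    have : _ ≤ (∑ α ∈ A', I α * I (fα α)) - θ * θ * A'.card := hmainsum
    nlinarith
  have hfin : θ ^ 2 * ((A'.card : ℝ) - (κ ^ 2 - 1) * B) ≤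
      θ ^ 2 * ((2 * (∑ p ∈ S, (1 / p : ℝ)) * A.card + S.card * (2 * κ ^ 2 * B)) +
        ((∑ h ∈ H, ε h) * A.card + H.card * ((κ ^ 2 - 1) * B))) := by
    rw [mul_add]
    linarith
  have hθ2 : 0 < θ ^ 2 := by positivity
  have := le_of_mul_le_mul_left hfin hθ2
  nlinarith

end P11


section P12
variable (K L : Type) [Field K] [Fintype K] [Field L] [Fintype L] [Algebra K L]

/-- polynomial in the Frobenius endomorphism -/
noncomputable def frobE (p : K[X]) : Module.End K L := aeval (FiniteField.frobeniusAlgHom K L).toLinearMap p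

theorem frobE_mul (p q : K[X]) (x : L) : frobE K L (p * q) x = frobE K L p (frobE K L q x) := by
  simp [frobE]

theorem frobE_add (p q : K[X]) (x : L) : frobE K L (p + q) x = frobE K L p x + frobE K L q x := by
  simp [frobE]

theorem frobE_sub (p q : K[X]) (x : L) : frobE K L (p - q) x = frobE K L p x - frobE K L q x := by
  simp [frobE]

theorem frobE_one (x : L) : frobE K L 1 x = x := by
  simp [frobE]

theorem frobE_M (n : ℕ) (hn : Module.finrank K L = n) (x : L) : frobE K L (X ^ n - 1) x = 0 := by
  have := minpoly.aeval K (FiniteField.frobeniusAlgHom K L).toLinearMap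
  rw [FiniteField.minpoly_frobeniusAlgHom, hn] at this
  rw [frobE, this]; rfl

theorem frobE_dvd (n : ℕ) (hn : Module.finrank K L = n) (p : K[X]) (h : X ^ n - 1 ∣ p) (x : L) :
    frobE K L p x = 0 := by
  obtain ⟨r, rfl⟩ := h
  rw [frobE_mul, frobE_M K L n hn]

theorem frobE_eq_sum (n : ℕ) (p : K[X]) (hp : p.natDegree < n) (x : L) :
    frobE K L p x = ∑ i : Fin n, p.coeff i • x ^ Fintype.card K ^ (i : ℕ) := by
  rw [frobE, aeval_eq_sum_range' hp, LinearMap.sum_apply, Fin.sum_univ_eq_sum_range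
    (fun i => p.coeff i • x ^ Fintype.card K ^ i)]
  refine Finset.sum_congr rfl fun i _ => ?_
  rw [LinearMap.smul_apply, Module.End.coe_pow]
  congr 1
  have : ⇑(FiniteField.frobeniusAlgHom K L).toLinearMap = (· ^ Fintype.card K) := rfl
  rw [this, pow_iterate]

theorem exists_c0 (n : ℕ) (hn : Module.finrank K L = n) (hn0 : 0 < n) :
    ∃ c : L, ∀ p : K[X], frobE K L p c = 0 → X ^ n - 1 ∣ p := by
  obtain ⟨c, hc⟩ := exists_linearIndependent_algEquiv_apply K L
  have h1 := hc.comp _ (FiniteField.bijective_frobeniusAlgEquivOfAlgebraic_pow K L).1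
  subst hn
  have hlow : ∀ p : K[X], p.natDegree < Module.finrank K L → frobE K L p c = 0 → p = 0 := by
    intro p hp h
    rw [frobE_eq_sum K L _ p hp] at h
    have h2 := Fintype.linearIndependent_iff.1 h1 (fun i => p.coeff i) (by
      rw [← h]
      refine Finset.sum_congr rfl fun i _ => ?_
      congr 1
      simp only [Function.comp]
      rw [AlgEquiv.coe_pow, FiniteField.coe_frobeniusAlgEquivOfAlgebraic_iterate])
    ext i
    by_cases hi : i < Module.finrank K L
    · simpa using h2 ⟨i, hi⟩
    · rw [coeff_eq_zero_of_natDegree_lt (by omega)]; simp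
  refine ⟨c, fun p hp => ?_⟩
  have hmon : (X ^ Module.finrank K L - 1 : K[X]).Monic := by
    simpa using monic_X_pow_sub_C (1:K) hn0.ne'
  have hdeg : (X ^ Module.finrank K L - 1 : K[X]).natDegree = Module.finrank K L := by
    simpa using natDegree_X_pow_sub_C (n := Module.finrank K L) (r := (1:K))
  rw [← modByMonic_eq_zero_iff_dvd hmon]
  refine hlow _ ?_ ?_
  · have := natDegree_modByMonic_lt p hmon (by
      intro h; rw [h] at hdeg; simp at hdeg; omega)
    omega
  · rw [modByMonic_eq_sub_mul_div, frobE_sub, hp, frobE_dvd K L _ rfl _ (dvd_mul_right _ _), sub_zero]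

variable {K L} in
theorem Mmonic (n : ℕ) (hn0 : 0 < n) : (X ^ n - 1 : K[X]).Monic := by
  simpa using monic_X_pow_sub_C (1:K) hn0.ne'

variable {K L} in
theorem Mdeg (n : ℕ) : (X ^ n - 1 : K[X]).natDegree = n := by
  simpa using natDegree_X_pow_sub_C (n := n) (r := (1:K))

open UniqueFactorizationMonoid in
/-- distinct monic irreducible factors of `X^n-1` -/
noncomputable def facts [DecidableEq K] (n : ℕ) : Finset K[X] := (normalizedFactors (X ^ n - 1 : K[X])).toFinset

variable [DecidableEq K]

open UniqueFactorizationMonoid in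
theorem mem_facts (n : ℕ) (hn0 : 0 < n) (h : K[X]) : h ∈ facts K n ↔ Irreducible h ∧ h.Monic ∧ h ∣ X ^ n - 1 := by
  have hne : (X ^ n - 1 : K[X]) ≠ 0 := (Mmonic n hn0).ne_zero
  rw [facts, Multiset.mem_toFinset, mem_normalizedFactors_iff' hne]
  constructor
  · rintro ⟨a, b, c⟩
    refine ⟨a, ?_, c⟩
    rw [← b]; exact Polynomial.monic_normalize a.ne_zero
  · rintro ⟨a, b, c⟩
    exact ⟨a, b.normalize_eq_self, c⟩

theorem facts_factor (n : ℕ) (hn0 : 0 < n) (T : K[X]) (hT : ¬ IsUnit T) (hd : T ∣ X ^ n - 1) :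
    ∃ h ∈ facts K n, h ∣ T := by
  have hne : (X ^ n - 1 : K[X]) ≠ 0 := (Mmonic n hn0).ne_zero
  obtain ⟨g, hg, hgT⟩ := WfDvdMonoid.exists_irreducible_factor hT (fun h => hne (by rw [h] at hd; exact zero_dvd_iff.1 hd))
  have hn : normalize g ∣ T := (normalize_dvd_iff).2 hgT
  exact ⟨normalize g, (mem_facts K n hn0 _).2 ⟨(normalize_associated g).symm.irreducible hg,
    Polynomial.monic_normalize hg.ne_zero, hn.trans hd⟩, hn⟩

/-- if no `M/h` kills `x` then `x` has no annihilator of small degree -/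
theorem normal_of (n : ℕ) (hn : Module.finrank K L = n) (hn0 : 0 < n) (x : L)
    (hx : ∀ h ∈ facts K n, frobE K L ((X ^ n - 1) / h) x ≠ 0) :
    LinearIndependent K (fun i : Fin n => x ^ Fintype.card K ^ (i : ℕ)) ∧
      Submodule.span K (Set.range (fun i : Fin n => x ^ Fintype.card K ^ (i : ℕ))) = ⊤ := by
  have hne : (X ^ n - 1 : K[X]) ≠ 0 := (Mmonic n hn0).ne_zero
  have key : ∀ p : K[X], p.natDegree < n → frobE K L p x = 0 → p = 0 := by
    intro p hp h
    by_contra hp0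
    have hD : frobE K L (EuclideanDomain.gcd p (X ^ n - 1)) x = 0 := by
      rw [EuclideanDomain.gcd_eq_gcd_ab, mul_comm p, mul_comm (X ^ n - 1), frobE_add, frobE_mul, frobE_mul, h,
        frobE_M K L n hn]; simp
    obtain ⟨T, hT⟩ := EuclideanDomain.gcd_dvd_right p (X ^ n - 1)
    have hDdeg : (EuclideanDomain.gcd p (X ^ n - 1)).natDegree < n :=
      (natDegree_le_of_dvd (EuclideanDomain.gcd_dvd_left p (X ^ n - 1)) hp0).trans_lt hp
    have hTu : ¬ IsUnit T := by
      intro hu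
      have := natDegree_eq_zero_of_isUnit hu
      have h3 := congrArg natDegree hT
      rw [Mdeg, natDegree_mul (by rintro h0; rw [h0, zero_mul] at hT; exact hne hT)
        hu.ne_zero] at h3
      omega
    obtain ⟨g, hg, hgT⟩ := facts_factor K n hn0 T hTu ⟨_, by rw [mul_comm]; exact hT⟩
    refine hx g hg ?_
    obtain ⟨T', rfl⟩ := hgT
    have hg0 : g ≠ 0 := ((mem_facts K n hn0 g).1 hg).1.ne_zero
    have : (X ^ n - 1) / g = T' * EuclideanDomain.gcd p (X ^ n - 1) := by
      rw [EuclideanDomain.div_eq_iff_eq_mul_of_dvd _ _ _ hg0 ((mem_facts K n hn0 g).1 hg).2.2]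
      conv_lhs => rw [hT]
      ring
    rw [this, frobE_mul, hD]; simp
  have hli : LinearIndependent K (fun i : Fin n => x ^ Fintype.card K ^ (i : ℕ)) := by
    rw [Fintype.linearIndependent_iff]
    intro g hg i
    have hco : ∀ i : Fin n, (∑ j : Fin n, C (g j) * X ^ (j:ℕ)).coeff i = g i := by
      intro i
      rw [finsetSum_coeff, Finset.sum_eq_single i]
      · simp
      · intro b _ hb
        rw [coeff_C_mul_X_pow, if_neg]
        intro h; exact hb (Fin.ext h.symm)
      · simp
    have h0 := key (∑ j : Fin n, C (g j) * X ^ (j:ℕ)) (by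
      rw [Nat.lt_iff_le_pred hn0]
      refine natDegree_sum_le_of_forall_le _ _ fun j _ => ?_
      refine (natDegree_C_mul_X_pow_le _ _).trans ?_
      have := j.2
      omega) (by
      rw [frobE_eq_sum K L n _ (by
        rw [Nat.lt_iff_le_pred hn0]
        refine natDegree_sum_le_of_forall_le _ _ fun j _ => ?_
        refine (natDegree_C_mul_X_pow_le _ _).trans ?_
        have := j.2
        omega)]
      simp_rw [hco]; exact hg)
    rw [← hco i, h0]; simp
  refine ⟨hli, ?_⟩
  have : Nonempty (Fin n) := ⟨⟨0, hn0⟩⟩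
  exact hli.span_eq_top_of_card_eq_finrank (by simp [hn])

/-- the affine space and the non-core estimates -/
theorem core_space (hK : Fintype.card K = 2) (n : ℕ) (hn : Module.finrank K L = n) (hn0 : 0 < n) (Co : Finset K[X]) (hCo : Co ⊆ facts K n) :
    ∃ (V : Submodule K L) (c : L),
      (∀ h ∈ Co, ∀ α, α - c ∈ V → frobE K L ((X ^ n - 1) / h) α ≠ 0) ∧
      2 ^ n ≤ Nat.card V * 2 ^ Co.card ∧
      ∀ h ∈ facts K n, h ∉ Co → ∀ A B : Finset L, (∀ α, α ∈ A ↔ α - c ∈ V) →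
        (∀ α, α ∈ B ↔ α ∈ A ∧ frobE K L ((X ^ n - 1) / h) α = 0) → B.card * 2 ^ h.natDegree ≤ A.card := by
  classical
  have hne : (X ^ n - 1 : K[X]) ≠ 0 := (Mmonic n hn0).ne_zero
  obtain ⟨c, hc⟩ := exists_c0 K L n hn hn0
  have hmul : ∀ h ∈ facts K n, h * ((X ^ n - 1) / h) = X ^ n - 1 := fun h hh =>
    EuclideanDomain.mul_div_cancel' ((mem_facts K n hn0 h).1 hh).1.ne_zero ((mem_facts K n hn0 h).1 hh).2.2
  have hpc : ∀ h ∈ facts K n, ∀ r : K[X], frobE K L ((X ^ n - 1) / h * r) c = 0 → h ∣ r := by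
    intro h hh r h0
    have h1 := hc _ h0
    nth_rw 1 [← hmul h hh] at h1
    rw [mul_comm h] at h1
    exact (mul_dvd_mul_iff_left (by intro h2; have := hmul h hh; rw [h2, mul_zero] at this; exact hne this.symm)).1 h1
  have hfun : ∀ h ∈ facts K n, ∃ l : L →ₗ[K] K, l (frobE K L ((X ^ n - 1) / h) c) ≠ 0 := by
    intro h hh
    have h1 : frobE K L ((X ^ n - 1) / h) c ≠ 0 := by
      intro h0
      have := hpc h hh 1 (by rwa [mul_one])
      exact ((mem_facts K n hn0 h).1 hh).1.not_isUnit (isUnit_of_dvd_one this)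
    obtain ⟨l, hl, -⟩ := Submodule.exists_le_ker_of_notMem (p := (⊥ : Submodule K L)) (v := frobE K L ((X ^ n - 1) / h) c) (by simpa using h1)
    exact ⟨l, hl⟩
  choose! l hl using hfun
  let Φ : L →ₗ[K] (Co → K) := LinearMap.pi fun h => (l h.1).comp (frobE K L ((X ^ n - 1) / h.1))
  have hV : ∀ x, x ∈ LinearMap.ker Φ ↔ ∀ h ∈ Co, l h (frobE K L ((X ^ n - 1) / h) x) = 0 := by
    intro x
    rw [LinearMap.mem_ker, funext_iff]
    simp [Φ]
  refine ⟨LinearMap.ker Φ, c, ?_, ?_, ?_⟩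
  · intro h hh α hα h0
    have h1 := (hV _).1 hα h hh
    rw [map_sub, h0, zero_sub, map_neg, neg_eq_zero] at h1
    exact hl h (hCo hh) h1
  · have h1 := Submodule.card_eq_card_quotient_mul_card (LinearMap.ker Φ)
    have h2 : Nat.card (L ⧸ LinearMap.ker Φ) ≤ Nat.card (Co → K) :=
      Nat.card_le_card_of_injective _ (LinearMap.ker_eq_bot.1 (Submodule.ker_liftQ_eq_bot _ Φ le_rfl le_rfl))
    rw [Nat.card_eq_fintype_card (α := Co → K), Fintype.card_fun, hK, Fintype.card_coe] at h2
    have h3 : Nat.card L = 2 ^ n := by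
      rw [Module.natCard_eq_pow_finrank (K := K), hn, Nat.card_eq_fintype_card, hK]
    rw [← h3, h1]
    first
    | exact Nat.mul_le_mul_left _ h2
    | (rw [mul_comm]; exact Nat.mul_le_mul_left _ h2)
  · intro h hh hhC A B hA hB
    obtain ⟨hirr, hmon, hdvd⟩ := (mem_facts K n hn0 h).1 hh
    obtain ⟨e, R, hR, hMR⟩ : ∃ e R, ¬ h ∣ R ∧ X ^ n - 1 = h ^ e * R := by
      obtain ⟨e, R, h1, h2⟩ := WfDvdMonoid.max_power_factor hne hirr
      exact ⟨e, R, h1, h2⟩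
    have hcop : IsCoprime (h ^ e) R := ((hirr.coprime_iff_not_dvd).2 hR).pow_left
    obtain ⟨u, v, huv⟩ := hcop
    have hVr : ∀ r : K[X], frobE K L (v * R * r) c ∈ LinearMap.ker Φ := by
      intro r
      rw [hV]
      intro h' hh'
      rw [← frobE_mul, frobE_dvd K L n hn, map_zero]
      obtain ⟨hirr', hmon', hdvd'⟩ := (mem_facts K n hn0 h').1 (hCo hh')
      have hne' : h' ≠ h := by rintro rfl; exact hhC hh'
      have : h ^ e ∣ (X ^ n - 1) / h' := by
        have h1 : h ^ e ∣ h' * ((X ^ n - 1) / h') := by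
          rw [hmul h' (hCo hh'), hMR]; exact dvd_mul_right _ _
        refine IsCoprime.dvd_of_dvd_mul_left ?_ h1
        refine IsCoprime.pow_left ((hirr.coprime_iff_not_dvd).2 ?_)
        intro hd
        exact hne' (eq_of_monic_of_associated hmon' hmon (hirr.associated_of_dvd hirr' hd).symm)
      obtain ⟨w, hw⟩ := this
      rw [hw, hMR]
      exact ⟨w * v * r, by ring⟩
    have hπr : ∀ r : K[X], frobE K L ((X ^ n - 1) / h) (frobE K L (v * R * r) c) =
        frobE K L ((X ^ n - 1) / h * r) c := by
      intro r
      rw [← frobE_mul, ← sub_eq_zero, ← frobE_sub, frobE_dvd K L n hn]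
      have hvR : v * R = 1 - u * h ^ e := by rw [← huv]; ring
      have he : e ≠ 0 := by
        rintro rfl
        rw [pow_zero, one_mul] at hMR; exact hR (hMR ▸ hdvd)
      obtain ⟨e', rfl⟩ := Nat.exists_eq_succ_of_ne_zero he
      rw [hvR]
      refine ⟨-(u * h ^ e' * r), ?_⟩
      have h5 := hmul h hh
      set Mh := (X ^ n - 1) / h
      rw [← h5, Nat.succ_eq_add_one]; ring
    let G := Polynomial.degreeLT K h.natDegree
    have hcardG : Nat.card G = 2 ^ h.natDegree := by
      rw [Nat.card_congr (Polynomial.degreeLTEquiv K h.natDegree).toEquiv, Nat.card_eq_fintype_card]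
      simp [hK]
    have hA' : Nat.card A = A.card := by simp
    have hB' : Nat.card B = B.card := by simp
    rw [← hcardG, ← hA', ← hB', ← Nat.card_prod]
    refine Nat.card_le_card_of_injective (fun z : B × G => (⟨z.1.1 + frobE K L (v * R * z.2.1) c, ?_⟩ : A)) ?_
    · rw [hA]
      have h1 := (hA _).1 ((hB _).1 z.1.2).1
      have h2 := (LinearMap.ker Φ).add_mem h1 (hVr z.2.1)
      convert h2 using 1; ring
    · rintro ⟨b, r⟩ ⟨b', r'⟩ hz
      have hz' : b.1 + frobE K L (v * R * r.1) c = b'.1 + frobE K L (v * R * r'.1) c := congrArg Subtype.val hz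
      have h1 := congrArg (frobE K L ((X ^ n - 1) / h)) hz'
      rw [map_add, map_add, ((hB _).1 b.2).2, ((hB _).1 b'.2).2, zero_add, zero_add, hπr, hπr, ← sub_eq_zero,
        ← frobE_sub, ← mul_sub] at h1
      have h2 := hpc h hh _ h1
      have h3 : (r.1 - r'.1).degree < h.degree := by
        rw [degree_eq_natDegree hirr.ne_zero]
        exact mem_degreeLT.1 (G.sub_mem r.2 r'.2)
      have h4 := eq_zero_of_dvd_of_degree_lt h2 h3
      have h5 : r = r' := Subtype.ext (sub_eq_zero.1 h4)
      subst h5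
      have h6 : b = b' := Subtype.ext (add_right_cancel hz')
      rw [h6]

end P12


section P12b
variable (K : Type) [Field K] [Fintype K] [DecidableEq K]

theorem facts_prod_dvd (n : ℕ) (hn0 : 0 < n) (T : Finset K[X]) (hT : T ⊆ facts K n) (m : ℕ) (hm : 0 < m)
    (hd : ∀ h ∈ T, h ∣ X ^ m - 1) : ∑ h ∈ T, h.natDegree ≤ m := by
  have h1 : ∏ h ∈ T, h ∣ (X ^ m - 1 : K[X]) := by
    refine Finset.prod_dvd_of_coprime ?_ hd
    intro a ha b hb hab
    obtain ⟨ia, ma, -⟩ := (mem_facts K n hn0 a).1 (hT ha)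
    obtain ⟨ib, mb, -⟩ := (mem_facts K n hn0 b).1 (hT hb)
    exact (ia.coprime_iff_not_dvd).2 fun hdv => hab
      (eq_of_monic_of_associated ma mb (ia.associated_of_dvd ib hdv))
  have h2 := natDegree_le_of_dvd h1 (Mmonic m hm).ne_zero
  rw [Mdeg, natDegree_prod _ _ (fun h hh => ((mem_facts K n hn0 h).1 (hT hh)).1.ne_zero)] at h2
  exact h2

theorem facts_sum (n : ℕ) (hn0 : 0 < n) : ∑ h ∈ facts K n, h.natDegree ≤ n :=
  facts_prod_dvd K n hn0 _ subset_rfl n hn0 fun h hh => ((mem_facts K n hn0 h).1 hh).2.2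

theorem facts_count (hK : Fintype.card K = 2) (n : ℕ) (hn0 : 0 < n) (D : ℕ) (hD : 0 < D) :
    ((facts K n).filter (fun h => h.natDegree = D)).card ≤ Nat.gcd n (2 ^ D - 1) / D := by
  rw [Nat.le_div_iff_mul_le hD]
  have h0 : ∑ h ∈ (facts K n).filter (fun h => h.natDegree = D), h.natDegree ≤ Nat.gcd n (2 ^ D - 1) := by
    refine facts_prod_dvd K n hn0 _ (Finset.filter_subset _ _) _ (Nat.gcd_pos_of_pos_left _ hn0) ?_
    intro h hh
    rw [Finset.mem_filter] at hh
    obtain ⟨ih, mh, dh⟩ := (mem_facts K n hn0 h).1 hh.1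
    have h2 := (ih.natDegree_dvd_iff_dvd_X_pow_card_pow_sub_X (n := D)).1 (by rw [hh.2])
    rw [Nat.card_eq_fintype_card, hK] at h2
    have : Fact (Irreducible h) := ⟨ih⟩
    have hr : ∀ p : K[X], h ∣ p ↔ aeval (AdjoinRoot.root h) p = 0 := by
      intro p
      rw [AdjoinRoot.aeval_eq, AdjoinRoot.mk_eq_zero]
    rw [hr] at h2 dh ⊢
    simp only [map_sub, map_pow, aeval_X, map_one] at h2 dh ⊢
    have hne : AdjoinRoot.root h ≠ 0 := by
      intro h3; rw [h3, zero_pow hn0.ne'] at dh; simp at dh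
    rw [sub_eq_zero] at dh ⊢
    refine pow_gcd_eq_one.2 ⟨dh, ?_⟩
    have h4 : 2 ^ D = (2 ^ D - 1) + 1 := by have := Nat.one_le_two_pow (n := D); omega
    rw [h4, pow_succ, ← sub_one_mul] at h2
    exact sub_eq_zero.1 ((mul_eq_zero.1 h2).resolve_right hne)
  rw [Finset.sum_congr rfl (fun h hh => (Finset.mem_filter.1 hh).2)] at h0
  simpa using h0

/-- weighted counting of factors with degrees in a finite range -/
theorem facts_weight (hK : Fintype.card K = 2) (n : ℕ) (hn0 : 0 < n) (g : ℕ → ℝ) (hg : ∀ D, 0 ≤ g D)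
    (I : Finset ℕ) (hI : ∀ D ∈ I, 0 < D) (T : Finset K[X]) (hT : T ⊆ facts K n) (hTI : ∀ h ∈ T, h.natDegree ∈ I) :
    ∑ h ∈ T, g h.natDegree ≤ ∑ D ∈ I, ((Nat.gcd n (2 ^ D - 1) / D : ℕ) : ℝ) * g D := by
  rw [← Finset.sum_fiberwise_of_maps_to hTI]
  refine Finset.sum_le_sum fun D hD => ?_
  rw [Finset.sum_congr rfl (fun h hh => by rw [(Finset.mem_filter.1 hh).2] : ∀ h ∈ T.filter (fun h => h.natDegree = D), g h.natDegree = g D),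
    Finset.sum_const, nsmul_eq_mul]
  refine mul_le_mul_of_nonneg_right ?_ (hg D)
  refine Nat.cast_le.2 (le_trans (Finset.card_le_card ?_) (facts_count K hK n hn0 D (hI D hD)))
  exact Finset.filter_subset_filter _ hT

theorem facts_big (n : ℕ) (hn0 : 0 < n) (b : ℕ) (hb : 0 < b) (T : Finset K[X]) (hT : T ⊆ facts K n)
    (hTb : ∀ h ∈ T, b ≤ h.natDegree) : T.card ≤ n / b := by
  rw [Nat.le_div_iff_mul_le hb]
  calc T.card * b = ∑ h ∈ T, b := by simp
    _ ≤ ∑ h ∈ T, h.natDegree := Finset.sum_le_sum hTb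
    _ ≤ ∑ h ∈ facts K n, h.natDegree := Finset.sum_le_sum_of_subset hT
    _ ≤ n := facts_sum K n hn0

theorem facts_pos (n : ℕ) (hn0 : 0 < n) (h : K[X]) (hh : h ∈ facts K n) : 0 < h.natDegree :=
  ((mem_facts K n hn0 h).1 hh).1.natDegree_pos

theorem facts_card (hK : Fintype.card K = 2) (n : ℕ) (hn0 : 0 < n) : 5 * (facts K n).card ≤ n + 14 := by
  have h1 : ∑ h ∈ facts K n, (5 - h.natDegree) ≤ 14 := by
    have hsub : ∑ h ∈ facts K n, (5 - h.natDegree) = ∑ h ∈ (facts K n).filter (fun h => h.natDegree ∈ Finset.Ioo 0 5), (5 - h.natDegree) := by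
      refine (Finset.sum_subset (Finset.filter_subset _ _) ?_).symm
      intro h hh hh'
      have := facts_pos K n hn0 h hh
      rw [Finset.mem_filter, Finset.mem_Ioo] at hh'
      have : ¬ h.natDegree < 5 := fun h5 => hh' ⟨hh, this, h5⟩
      omega
    have h2 := facts_weight K hK n hn0 (fun D => ((5 - D : ℕ) : ℝ)) (fun D => Nat.cast_nonneg _) (Finset.Ioo 0 5)
      (fun D hD => (Finset.mem_Ioo.1 hD).1) ((facts K n).filter (fun h => h.natDegree ∈ Finset.Ioo 0 5)) (Finset.filter_subset _ _)
      (fun h hh => (Finset.mem_filter.1 hh).2)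
    rw [hsub]
    have h3 : ∑ D ∈ Finset.Ioo 0 5, (Nat.gcd n (2 ^ D - 1) / D) * (5 - D) ≤ 14 := by
      have e : Finset.Ioo 0 5 = ({1,2,3,4} : Finset ℕ) := by decide
      rw [e]
      have a1 : Nat.gcd n (2 ^ 1 - 1) ≤ 1 := Nat.gcd_le_right _ (by norm_num)
      have a2 : Nat.gcd n (2 ^ 2 - 1) ≤ 3 := Nat.gcd_le_right _ (by norm_num)
      have a3 : Nat.gcd n (2 ^ 3 - 1) ≤ 7 := Nat.gcd_le_right _ (by norm_num)
      have a4 : Nat.gcd n (2 ^ 4 - 1) ≤ 15 := Nat.gcd_le_right _ (by norm_num)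
      simp only [Finset.mem_insert, Finset.mem_singleton, Finset.sum_insert, Finset.sum_singleton,
        show ¬ ((1:ℕ) = 2 ∨ 1 = 3 ∨ 1 = 4) by decide, show ¬ ((2:ℕ) = 3 ∨ 2 = 4) by decide, show ¬ ((3:ℕ) = 4) by decide, not_false_eq_true]
      omega
    have h4 : (((∑ h ∈ (facts K n).filter (fun h => h.natDegree ∈ Finset.Ioo 0 5), (5 - h.natDegree) : ℕ) : ℝ)) ≤
        ((∑ D ∈ Finset.Ioo 0 5, (Nat.gcd n (2 ^ D - 1) / D) * (5 - D) : ℕ) : ℝ) := by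
      rw [Nat.cast_sum, Nat.cast_sum]
      simpa only [Nat.cast_mul] using h2
    exact (Nat.cast_le.1 h4).trans h3
  have h2 : ∑ h ∈ facts K n, 5 ≤ ∑ h ∈ facts K n, (h.natDegree + (5 - h.natDegree)) :=
    Finset.sum_le_sum fun h _ => by omega
  rw [Finset.sum_add_distrib] at h2
  have := facts_sum K n hn0
  simp at h2
  omega

end P12b


section P13

theorem order_of_chars {L : Type} [Field L] [Fintype L] (X : ℕ → MulChar L ℂ)
    (hX : ∀ p ∈ (Fintype.card L - 1).primeFactors, orderOf (X p) = p) (α : L) (hα : α ≠ 0)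
    (h : ∀ p ∈ (Fintype.card L - 1).primeFactors, X p α ≠ 1) : orderOf α = Fintype.card L - 1 := by
  have hN : 0 < Fintype.card L - 1 := by have := Fintype.one_lt_card (α := L); omega
  refine orderOf_eq_of_pow_and_pow_div_prime hN (FiniteField.pow_card_sub_one_eq_one α hα) ?_
  intro p hp hpN h1
  have hmem : p ∈ (Fintype.card L - 1).primeFactors := Nat.mem_primeFactors.2 ⟨hp, hpN, hN.ne'⟩
  apply h p hmem
  obtain ⟨g, hg⟩ := IsCyclic.exists_generator (α := Lˣ)
  have hog : orderOf g = Fintype.card L - 1 := by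
    rw [orderOf_eq_card_of_forall_mem_zpowers hg, Nat.card_units, Nat.card_eq_fintype_card]
  have h2 := hg (Units.mk0 α hα)
  rw [← mem_powers_iff_mem_zpowers] at h2
  obtain ⟨k, hk⟩ := h2
  have hk' : g ^ k = Units.mk0 α hα := hk
  have h3 : g ^ (k * ((Fintype.card L - 1) / p)) = 1 := by
    rw [pow_mul, hk']; ext; simpa using h1
  have h4 := orderOf_dvd_of_pow_eq_one h3
  rw [hog] at h4
  obtain ⟨m, hm⟩ := hpN
  have hm0 : 0 < m := by
    rcases Nat.eq_zero_or_pos m with h0 | h0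
    · rw [h0, mul_zero] at hm; omega
    · exact h0
  rw [hm, Nat.mul_div_cancel_left _ hp.pos] at h4
  obtain ⟨j, rfl⟩ := Nat.dvd_of_mul_dvd_mul_right hm0 h4
  have hα' : α = ((g ^ j : Lˣ) : L) ^ p := by
    have := congrArg Units.val hk'
    rw [Units.val_mk0] at this
    rw [← this, mul_comm, pow_mul]; simp
  rw [hα', map_pow, ← MulChar.pow_apply_coe]
  have h5 := pow_orderOf_eq_one (X p)
  rw [hX p hmem] at h5
  rw [h5, MulChar.one_apply_coe]

theorem exists_chars (L : Type) [Field L] [Fintype L] :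
    ∃ X : ℕ → MulChar L ℂ, ∀ p ∈ (Fintype.card L - 1).primeFactors, orderOf (X p) = p := by
  classical
  have : ∀ p : ℕ, ∃ χ : MulChar L ℂ, p ∈ (Fintype.card L - 1).primeFactors → orderOf χ = p := by
    intro p
    by_cases hp : p ∈ (Fintype.card L - 1).primeFactors
    · obtain ⟨χ, hχ⟩ := MulChar.exists_mulChar_orderOf L (Nat.dvd_of_mem_primeFactors hp)
        (Complex.isPrimitiveRoot_exp p (Nat.prime_of_mem_primeFactors hp).ne_zero)
      exact ⟨χ, fun _ => hχ⟩
    · exact ⟨1, fun h => absurd h hp⟩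
  choose X hX using this
  exact ⟨X, fun p hp => hX p hp⟩

theorem criterion {K L : Type} [Field K] [Fintype K] [Field L] [Fintype L] [Algebra K L] [CharP L 2] [DecidableEq K]
    (hK : Fintype.card K = 2) (n : ℕ) (hn0 : 0 < n) (hQ : Fintype.card L = 2 ^ n)
    (f₁ f₂ : L[X]) (hf : GoodPair f₁ f₂) (P S : Finset ℕ) (hdisj : Disjoint P S)
    (hPS : P ∪ S = (2 ^ n - 1).primeFactors) (Co : Finset K[X]) (hCo : Co ⊆ facts K n)
    (hmain : 6 * √(2 ^ n) * (4 ^ P.card * (1 + 2 * S.card) + (4 ^ P.card - 1) * (facts K n \ Co).card) <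
      (2 ^ n / 2 ^ Co.card : ℝ) * (1 - 2 * ∑ p ∈ S, (1 / p : ℝ) - ∑ h ∈ facts K n \ Co, 1 / 2 ^ h.natDegree)) :
    ∃ α : L, f₂.eval α ≠ 0 ∧ orderOf α = Fintype.card L - 1 ∧
      orderOf (f₁.eval α / f₂.eval α) = Fintype.card L - 1 ∧
      LinearIndependent K (fun i : Fin n => α ^ Fintype.card K ^ (i : ℕ)) ∧
      Submodule.span K (Set.range (fun i : Fin n => α ^ Fintype.card K ^ (i : ℕ))) = ⊤ := by
  classical
  have hn : Module.finrank K L = n := by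
    have h1 := Module.card_eq_pow_finrank (K := K) (V := L)
    rw [hQ, hK] at h1
    exact (Nat.pow_right_injective le_rfl h1).symm
  obtain ⟨V, c, hV1, hV2, hV3⟩ := core_space K L hK n hn hn0 Co hCo
  obtain ⟨X, hX⟩ := exists_chars L
  have hmem : ∀ p ∈ P ∪ S, p.Prime ∧ orderOf (X p) = p := by
    intro p hp
    rw [hPS, ← hQ] at hp
    exact ⟨Nat.prime_of_mem_primeFactors hp, hX p hp⟩
  let A : Finset L := Finset.univ.filter (fun α => α - c ∈ V)
  have hA : ∀ α, α ∈ A ↔ α - c ∈ V := by intro α; simp [A]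
  have hcard : A.card = Nat.card V := by
    have e : A ≃ V :=
      { toFun := fun a => ⟨a.1 - c, (hA _).1 a.2⟩
        invFun := fun v => ⟨v.1 + c, (hA _).2 (by simp)⟩
        left_inv := fun a => by simp
        right_inv := fun v => by simp }
    rw [← Nat.card_congr e]; simp
  have hAc : (2 ^ n / 2 ^ Co.card : ℝ) ≤ A.card := by
    rw [div_le_iff₀ (by positivity), hcard]
    exact_mod_cast hV2
  have hLpos : 0 ≤ 6 * √(2 ^ n) * ((4:ℝ) ^ P.card * (1 + 2 * S.card) + (4 ^ P.card - 1) * (facts K n \ Co).card) := by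
    have : (1:ℝ) ≤ 4 ^ P.card := one_le_pow₀ (by norm_num)
    have h2 : (0:ℝ) ≤ 4 ^ P.card - 1 := by linarith
    positivity
  have hδ : 0 < 1 - 2 * ∑ p ∈ S, (1 / p : ℝ) - ∑ h ∈ facts K n \ Co, (1 / 2 ^ h.natDegree : ℝ) := by
    by_contra hneg
    push Not at hneg
    have : (2 ^ n / 2 ^ Co.card : ℝ) * (1 - 2 * ∑ p ∈ S, (1 / p : ℝ) - ∑ h ∈ facts K n \ Co, 1 / 2 ^ h.natDegree) ≤ 0 :=
      mul_nonpos_of_nonneg_of_nonpos (by positivity) hneg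
    linarith
  obtain ⟨α, hαA, hα0, hf1, hf2, hH, hch⟩ := sieve hK n hQ f₁ f₂ hf X P S hdisj
    (fun p hp => hmem p (Finset.mem_union_left _ hp)) (fun p hp => hmem p (Finset.mem_union_right _ hp))
    V c A hA (facts K n \ Co) (fun h => LinearMap.ker (frobE K L ((Polynomial.X ^ n - 1) / h)))
    (fun h => 1 / 2 ^ h.natDegree) (by
      intro h hh B hB
      rw [Finset.mem_sdiff] at hh
      have := hV3 h hh.1 hh.2 A B hA (by simpa [LinearMap.mem_ker] using hB)
      rw [one_div, ← div_eq_inv_mul, le_div_iff₀ (by positivity)]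
      exact_mod_cast this)
    (hmain.trans_le (mul_le_mul_of_nonneg_right hAc hδ.le))
  rw [hPS, ← hQ] at hch
  refine ⟨α, hf2, order_of_chars X hX α hα0 fun p hp => (hch p hp).1,
    order_of_chars X hX _ (div_ne_zero hf1 hf2) fun p hp => (hch p hp).2, ?_⟩
  refine normal_of K L n hn hn0 α ?_
  intro h hh
  by_cases hhC : h ∈ Co
  · exact hV1 h hhC α ((hA α).1 hαA)
  · intro h0
    exact hH h (Finset.mem_sdiff.2 ⟨hh, hhC⟩) (LinearMap.mem_ker.2 h0)

end P13


section P14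

/-- the odd primes below 512 -/
def smallP : List ℕ := [3, 5, 7, 11, 13, 17, 19, 23, 29, 31, 37, 41, 43, 47, 53, 59, 61, 67, 71, 73, 79, 83, 89, 97, 101, 103, 107, 109, 113, 127, 131, 137, 139, 149, 151, 157, 163, 167, 173, 179, 181, 191, 193, 197, 199, 211, 223, 227, 229, 233, 239, 241, 251, 257, 263, 269, 271, 277, 281, 283, 293, 307, 311, 313, 317, 331, 337, 347, 349, 353, 359, 367, 373, 379, 383, 389, 397, 401, 409, 419, 421, 431, 433, 439, 443, 449, 457, 461, 463, 467, 479, 487, 491, 499, 503, 509]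

def pl (n : ℕ) : List ℕ := smallP.filter (fun p => Nat.beq ((2 ^ n - 1) % p) 0)

def cD (n D : ℕ) : ℕ := Nat.gcd n (2 ^ D - 1) / D

def cw (n : ℕ) (g : ℕ → ℕ) : ℕ :=
  cD n 1 * g 1 + cD n 2 * g 2 + cD n 3 * g 3 + cD n 4 * g 4 + cD n 5 * g 5 + cD n 6 * g 6 + cD n 7 * g 7 +
    cD n 8 * g 8 + cD n 9 * g 9

def cr (n : ℕ) : ℕ := (n - 1 - Nat.log2 (pl n).prod) / 9
def cs (n k : ℕ) : ℕ := ((pl n).drop k).length + cr n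
def cE (n D0 k : ℕ) : ℕ := 2 * (((pl n).drop k).map (fun p => 2 ^ 20 / p + 1)).sum + cr n * 2 ^ 12 +
  (cw n (fun D => bif Nat.ble D D0 then 0 else 2 ^ (20 - D)) + n / 10 * 2 ^ 10)
def cH (n D0 : ℕ) : ℕ := cw n (fun D => bif Nat.ble D D0 then 0 else 1) + n / 10
def cW (n D0 : ℕ) : ℕ := cw n (fun D => bif Nat.ble D D0 then 1 else 0)
def cT (n D0 k : ℕ) : ℕ := 4 ^ k * (1 + 2 * cs n k) + (4 ^ k - 1) * cH n D0
def chk (n D0 k : ℕ) : Bool :=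
  Nat.blt (36 * 4 ^ cW n D0 * cT n D0 k ^ 2 * 2 ^ 40) (2 ^ n * (2 ^ 20 - cE n D0 k) ^ 2)

def chkRange (a D0 k : ℕ) : ℕ → Bool
  | 0 => true
  | m + 1 => chk (a + m) D0 k && chkRange a D0 k m

theorem chkRange_spec (a D0 k m : ℕ) (h : chkRange a D0 k m = true) : ∀ n, a ≤ n → n < a + m → chk n D0 k = true := by
  induction m with
  | zero => intro n h1 h2; omega
  | succ m ih =>
    rw [chkRange, Bool.and_eq_true] at h
    intro n h1 h2
    by_cases hn : n = a + m
    · rw [hn]; exact h.1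
    · exact ih h.2 n h1 (by omega)

theorem chk_a : chk 13 1 0 = true ∧ chk 17 1 0 = true ∧ chk 19 1 0 = true ∧ chk 21 1 0 = true := by
  decide +kernel

theorem chk_b1 : chkRange 22 2 2 2 = true := by decide +kernel
theorem chk_b2 : chkRange 25 2 2 18 = true := by decide +kernel
theorem chk_c : chkRange 43 2 6 498 = true := by decide +kernel

theorem smallP_complete : ∀ p < 512, p ∈ smallP ∨ p < 3 ∨ ∃ d < 23, 2 ≤ d ∧ d < p ∧ p % d = 0 := by
  decide +kernel
theorem smallP_prime : ∀ p ∈ smallP, 3 ≤ p ∧ p < 512 ∧ ∀ d < 23, 2 ≤ d → d < p → p % d ≠ 0 := by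
  decide +kernel
theorem smallP_nodup : smallP.Nodup := by decide +kernel
theorem smallP_prod : 512 ^ 96 < 2 ^ 163 * smallP.prod := by decide +kernel
theorem mem_smallP (p : ℕ) : p ∈ smallP ↔ p.Prime ∧ p ≠ 2 ∧ p < 512 := by
  constructor
  · intro hp
    obtain ⟨h3, h512, hd⟩ := smallP_prime p hp
    refine ⟨?_, by omega, h512⟩
    by_contra hnp
    have h1 := Nat.minFac_sq_le_self (by omega) hnp
    have h2 := (Nat.minFac_prime (n := p) (by omega)).two_le
    have h4 : p.minFac < 23 := by nlinarith
    exact hd _ h4 h2 (by nlinarith) (Nat.mod_eq_zero_of_dvd (Nat.minFac_dvd p))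
  · rintro ⟨hp, h2, h512⟩
    rcases smallP_complete p h512 with h | h | ⟨d, -, hd2, hdp, hd⟩
    · exact h
    · have := hp.two_le; omega
    · have := (Nat.dvd_prime hp).1 (Nat.dvd_of_mod_eq_zero hd)
      omega

theorem mem_pl (n : ℕ) (hn : 0 < n) (p : ℕ) : p ∈ pl n ↔ p ∈ (2 ^ n - 1).primeFactors ∧ p < 512 := by
  have hN : 2 ^ n - 1 ≠ 0 := by
    have := Nat.one_lt_two_pow hn.ne'; omega
  rw [pl, List.mem_filter, mem_smallP, Nat.mem_primeFactors, Nat.beq_eq, ← Nat.dvd_iff_mod_eq_zero]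
  constructor
  · rintro ⟨⟨a, b, c⟩, d⟩; exact ⟨⟨a, d, hN⟩, c⟩
  · rintro ⟨⟨a, d, -⟩, c⟩
    refine ⟨⟨a, ?_, c⟩, d⟩
    rintro rfl
    have h2 : 2 ∣ 2 ^ n := dvd_pow_self 2 hn.ne'
    have := Nat.one_lt_two_pow hn.ne'
    omega

theorem pl_nodup (n : ℕ) : (pl n).Nodup := smallP_nodup.filter _

/-- large prime factors -/
def bigR (n : ℕ) : Finset ℕ := (2 ^ n - 1).primeFactors.filter (fun p => 512 ≤ p)

theorem bigR_bound (n : ℕ) (hn : 0 < n) : 512 ^ (bigR n).card * (pl n).prod < 2 ^ n := by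
  have hN : 2 ^ n - 1 ≠ 0 := by
    have := Nat.one_lt_two_pow hn.ne'; omega
  have h1 : 512 ^ (bigR n).card ≤ ∏ p ∈ bigR n, p :=
    Finset.pow_card_le_prod _ _ _ (fun p hp => (Finset.mem_filter.1 hp).2)
  have h2 : (pl n).prod = ∏ p ∈ (pl n).toFinset, p := by
    rw [List.prod_toFinset _ (pl_nodup n)]; simp
  have h3 : Disjoint (bigR n) (pl n).toFinset := by
    rw [Finset.disjoint_left]
    intro p hp hp'
    rw [List.mem_toFinset, mem_pl n hn] at hp'
    have := (Finset.mem_filter.1 hp).2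
    omega
  have h4 : bigR n ∪ (pl n).toFinset = (2 ^ n - 1).primeFactors := by
    ext p
    rw [Finset.mem_union, List.mem_toFinset, mem_pl n hn, bigR, Finset.mem_filter]
    by_cases hp : p < 512
    · simp [hp]
    · push Not at hp; simp [hp]
  have h5 : (∏ p ∈ bigR n, p) * ∏ p ∈ (pl n).toFinset, p ≤ 2 ^ n - 1 := by
    rw [← Finset.prod_union h3, h4]
    exact Nat.le_of_dvd (Nat.pos_of_ne_zero hN) (Nat.prod_primeFactors_dvd _)
  rw [h2]
  have h6 := Nat.mul_le_mul_right (∏ p ∈ (pl n).toFinset, p) h1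
  omega

theorem bigR_card (n : ℕ) (hn : 0 < n) : (bigR n).card ≤ cr n := by
  have h1 := bigR_bound n hn
  have h0 : (pl n).prod ≠ 0 := by
    refine List.prod_ne_zero ?_
    intro h
    exact absurd ((mem_pl n hn 0).1 h).1 (by simp)
  have h2 : 2 ^ Nat.log2 (pl n).prod ≤ (pl n).prod := Nat.log2_self_le h0
  have h3 : 2 ^ (9 * (bigR n).card + Nat.log2 (pl n).prod) < 2 ^ n := by
    refine lt_of_le_of_lt ?_ h1
    rw [pow_add, pow_mul]
    exact Nat.mul_le_mul_left _ h2
  have h4 := (Nat.pow_lt_pow_iff_right (by norm_num)).1 h3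
  rw [cr, Nat.le_div_iff_mul_le (by norm_num)]
  omega

theorem omega_bound (n : ℕ) (hn : 0 < n) : 9 * (2 ^ n - 1).primeFactors.card ≤ n + 163 := by
  have h1 := bigR_bound n hn
  have hsplit : (2 ^ n - 1).primeFactors.card = (bigR n).card + (pl n).length := by
    have h3 : Disjoint (bigR n) (pl n).toFinset := by
      rw [Finset.disjoint_left]
      intro p hp hp'
      rw [List.mem_toFinset, mem_pl n hn] at hp'
      have := (Finset.mem_filter.1 hp).2
      omega
    have h4 : bigR n ∪ (pl n).toFinset = (2 ^ n - 1).primeFactors := by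
      ext p
      rw [Finset.mem_union, List.mem_toFinset, mem_pl n hn, bigR, Finset.mem_filter]
      by_cases hp : p < 512
      · simp [hp]
      · push Not at hp; simp [hp]
    rw [← h4, Finset.card_union_of_disjoint h3, List.toFinset_card_of_nodup (pl_nodup n)]
  have key : ∀ (l : List ℕ) (q : ℕ → Bool), (∀ p ∈ l, p ≤ 512) →
      512 ^ (l.filter q).length * l.prod ≤ (l.filter q).prod * 512 ^ l.length := by
    intro l q
    induction l with
    | nil => intro _; simp
    | cons a t ih =>
      intro hl
      have ih' := ih (fun p hp => hl p (List.mem_cons_of_mem _ hp))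
      have ha := hl a List.mem_cons_self
      by_cases hq : q a = true
      · rw [List.filter_cons_of_pos hq, List.length_cons, List.prod_cons, List.prod_cons, List.length_cons, pow_succ, pow_succ]
        calc _ = (512 * a) * (512 ^ (t.filter q).length * t.prod) := by ring
          _ ≤ (512 * a) * ((t.filter q).prod * 512 ^ t.length) := Nat.mul_le_mul_left _ ih'
          _ = _ := by ring
      · rw [List.filter_cons_of_neg hq, List.prod_cons, List.length_cons, pow_succ]
        calc _ = a * (512 ^ (t.filter q).length * t.prod) := by ring
          _ ≤ 512 * ((t.filter q).prod * 512 ^ t.length) := Nat.mul_le_mul ha ih'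
          _ = _ := by ring
  have h2 := key smallP (fun p => Nat.beq ((2 ^ n - 1) % p) 0) (fun p hp => ((mem_smallP p).1 hp).2.2.le)
  have h3 : smallP.length = 96 := by decide
  rw [h3] at h2
  change 512 ^ (pl n).length * smallP.prod ≤ (pl n).prod * 512 ^ 96 at h2
  have h4 := smallP_prod
  have hpos : 0 < smallP.prod := by
    rcases Nat.eq_zero_or_pos smallP.prod with h | h
    · rw [h] at h4; simp at h4
    · exact h
  have h5 : 2 ^ (9 * (2 ^ n - 1).primeFactors.card) * smallP.prod < 2 ^ (n + 163) * smallP.prod := by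
    rw [hsplit, pow_mul, pow_add, pow_add]
    calc (2 ^ 9) ^ (bigR n).card * (2 ^ 9) ^ (pl n).length * smallP.prod
        = 512 ^ (bigR n).card * (512 ^ (pl n).length * smallP.prod) := by norm_num; ring
      _ ≤ 512 ^ (bigR n).card * ((pl n).prod * 512 ^ 96) := Nat.mul_le_mul_left _ h2
      _ = (512 ^ (bigR n).card * (pl n).prod) * 512 ^ 96 := by ring
      _ ≤ 2 ^ n * 512 ^ 96 := Nat.mul_le_mul_right _ h1.le
      _ < 2 ^ n * (2 ^ 163 * smallP.prod) := Nat.mul_lt_mul_of_pos_left h4 (by positivity)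
      _ = _ := by ring
  have h6 := Nat.lt_of_mul_lt_mul_right h5
  have h7 := (Nat.pow_lt_pow_iff_right (by norm_num)).1 h6
  omega

end P14


section P15
variable {K L : Type} [Field K] [Fintype K] [Field L] [Fintype L] [Algebra K L] [CharP L 2] [DecidableEq K]

theorem big_case (hK : Fintype.card K = 2) (n : ℕ) (hn : 541 ≤ n) (hQ : Fintype.card L = 2 ^ n)
    (f₁ f₂ : L[X]) (hf : GoodPair f₁ f₂) :
    ∃ α : L, f₂.eval α ≠ 0 ∧ orderOf α = Fintype.card L - 1 ∧
      orderOf (f₁.eval α / f₂.eval α) = Fintype.card L - 1 ∧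
      LinearIndependent K (fun i : Fin n => α ^ Fintype.card K ^ (i : ℕ)) ∧
      Submodule.span K (Set.range (fun i : Fin n => α ^ Fintype.card K ^ (i : ℕ))) = ⊤ := by
  have hn0 : 0 < n := by omega
  refine criterion hK n hn0 hQ f₁ f₂ hf (2 ^ n - 1).primeFactors ∅ (Finset.disjoint_empty_right _) (by simp)
    (facts K n) subset_rfl ?_
  have h1 := omega_bound n hn0
  have h2 := facts_card K hK n hn0
  set w := (facts K n).card
  set o := (2 ^ n - 1).primeFactors.card
  simp only [Finset.card_empty, Nat.cast_zero, mul_zero, add_zero, mul_one, Finset.sdiff_self, Finset.sum_empty, sub_zero]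
  rw [lt_div_iff₀ (by positivity)]
  have hX : √((2:ℝ) ^ n) * √(2 ^ n) = 2 ^ n := Real.mul_self_sqrt (by positivity)
  have hX0 : 0 < √((2:ℝ) ^ n) := Real.sqrt_pos.2 (by positivity)
  have h3 : (6 * 4 ^ o * 2 ^ w : ℝ) < √(2 ^ n) := by
    apply Real.lt_sqrt_of_sq_lt
    calc ((6 * 4 ^ o * 2 ^ w : ℝ)) ^ 2 = 36 * (2 ^ (4 * o + 2 * w)) := by
          rw [pow_add, pow_mul, pow_mul, mul_pow, mul_pow, ← pow_mul, ← pow_mul, mul_comm o, mul_comm w, pow_mul, pow_mul]; norm_num; ring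
      _ < 2 ^ 6 * 2 ^ (4 * o + 2 * w) := by
          have : (0:ℝ) < 2 ^ (4 * o + 2 * w) := by positivity
          nlinarith
      _ = 2 ^ (6 + (4 * o + 2 * w)) := by rw [pow_add _ 6]
      _ ≤ 2 ^ n := pow_le_pow_right₀ (by norm_num) (by omega)
  calc 6 * √(2 ^ n) * 4 ^ o * 2 ^ w = √(2 ^ n) * (6 * 4 ^ o * 2 ^ w) := by ring
    _ < √(2 ^ n) * √(2 ^ n) := mul_lt_mul_of_pos_left h3 hX0
    _ = 2 ^ n := hX

theorem facts_cw (hK : Fintype.card K = 2) (n : ℕ) (hn0 : 0 < n) (g : ℕ → ℕ) (T : Finset K[X]) (hT : T ⊆ facts K n)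
    (hTd : ∀ h ∈ T, h.natDegree < 10) : ∑ h ∈ T, (g h.natDegree : ℝ) ≤ cw n g := by
  have h := facts_weight K hK n hn0 (fun D => (g D : ℝ)) (fun D => Nat.cast_nonneg _) (Finset.Ioo 0 10)
    (fun D hD => (Finset.mem_Ioo.1 hD).1) T hT (fun h hh => Finset.mem_Ioo.2 ⟨facts_pos K n hn0 h (hT hh), hTd h hh⟩)
  refine h.trans (le_of_eq ?_)
  have e : Finset.Ioo 0 10 = ({1,2,3,4,5,6,7,8,9} : Finset ℕ) := by decide
  rw [e]
  simp only [cw, cD]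
  push_cast
  simp
  ring

theorem fin_case (hK : Fintype.card K = 2) (n D0 k : ℕ) (hn0 : 0 < n) (hD0 : D0 < 10) (hchk : chk n D0 k = true)
    (hQ : Fintype.card L = 2 ^ n)
    (f₁ f₂ : L[X]) (hf : GoodPair f₁ f₂) :
    ∃ α : L, f₂.eval α ≠ 0 ∧ orderOf α = Fintype.card L - 1 ∧
      orderOf (f₁.eval α / f₂.eval α) = Fintype.card L - 1 ∧
      LinearIndependent K (fun i : Fin n => α ^ Fintype.card K ^ (i : ℕ)) ∧
      Submodule.span K (Set.range (fun i : Fin n => α ^ Fintype.card K ^ (i : ℕ))) = ⊤ := by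
  classical
  set P : Finset ℕ := ((pl n).take k).toFinset with hP
  set S : Finset ℕ := (2 ^ n - 1).primeFactors \ P with hS
  set Co : Finset K[X] := (facts K n).filter (fun h => h.natDegree ≤ D0) with hCo
  have hPsub : P ⊆ (2 ^ n - 1).primeFactors := by
    intro p hp
    rw [hP, List.mem_toFinset] at hp
    exact ((mem_pl n hn0 p).1 (List.mem_of_mem_take hp)).1
  refine criterion hK n hn0 hQ f₁ f₂ hf P S Finset.disjoint_sdiff (Finset.union_sdiff_of_subset hPsub)
    Co (Finset.filter_subset _ _) ?_
  have hPc : P.card ≤ k := (List.toFinset_card_le _).trans (List.length_take_le _ _)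
  have hSsub : S ⊆ ((pl n).drop k).toFinset ∪ bigR n := by
    intro p hp
    rw [hS, Finset.mem_sdiff] at hp
    rw [Finset.mem_union, List.mem_toFinset, bigR, Finset.mem_filter]
    by_cases h5 : p < 512
    · left
      have h1 := (mem_pl n hn0 p).2 ⟨hp.1, h5⟩
      rw [← List.take_append_drop k (pl n), List.mem_append] at h1
      exact h1.resolve_left fun h => hp.2 (by rw [hP, List.mem_toFinset]; exact h)
    · right; exact ⟨hp.1, by omega⟩
  have hR := bigR_card n hn0
  have hSc : S.card ≤ cs n k := by
    refine (Finset.card_le_card hSsub).trans ((Finset.card_union_le _ _).trans ?_)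
    exact add_le_add (List.toFinset_card_le _) hR
  have hSs : ∑ p ∈ S, (1 / p : ℝ) * 2 ^ 20 ≤ (((((pl n).drop k).map (fun p => 2 ^ 20 / p + 1)).sum : ℕ) : ℝ) + cr n * 2 ^ 11 := by
    have hnn : ∀ p : ℕ, (0:ℝ) ≤ 1 / p * 2 ^ 20 := fun p => by positivity
    refine (Finset.sum_le_sum_of_subset_of_nonneg hSsub fun p _ _ => hnn p).trans ?_
    refine le_trans (b := ∑ p ∈ ((pl n).drop k).toFinset, (1 / p : ℝ) * 2 ^ 20 + ∑ p ∈ bigR n, (1 / p : ℝ) * 2 ^ 20) ?_ ?_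
    · rw [← Finset.sum_union_inter]
      exact le_add_of_nonneg_right (Finset.sum_nonneg fun p _ => hnn p)
    · refine add_le_add ?_ ?_
      · rw [← List.sum_toFinset _ ((pl_nodup n).sublist (List.drop_sublist _ _)), Nat.cast_sum]
        refine Finset.sum_le_sum fun p hp => ?_
        rw [List.mem_toFinset] at hp
        have hp0 : 0 < p := (Nat.prime_of_mem_primeFactors ((mem_pl n hn0 p).1 (List.mem_of_mem_drop hp)).1).pos
        have hp0' : (0:ℝ) < p := by exact_mod_cast hp0
        rw [one_div, ← div_eq_inv_mul, div_le_iff₀ hp0']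
        have := Nat.lt_div_mul_add (a := 2 ^ 20) hp0
        have h2 : 2 ^ 20 ≤ (2 ^ 20 / p + 1) * p := by rw [add_mul, one_mul]; omega
        exact_mod_cast h2
      · calc ∑ p ∈ bigR n, (1 / p : ℝ) * 2 ^ 20 ≤ ∑ p ∈ bigR n, (2 ^ 11 : ℝ) := by
              refine Finset.sum_le_sum fun p hp => ?_
              have h5 := (Finset.mem_filter.1 hp).2
              have h5' : (512:ℝ) ≤ p := by exact_mod_cast h5
              rw [one_div, ← div_eq_inv_mul, div_le_iff₀ (by linarith)]
              linarith
          _ = (bigR n).card * 2 ^ 11 := by simp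
          _ ≤ cr n * 2 ^ 11 := by
              have : ((bigR n).card : ℝ) ≤ cr n := by exact_mod_cast hR
              nlinarith
  have hW : Co.card ≤ cW n D0 := by
    have h1 := facts_cw hK n hn0 (fun D => bif Nat.ble D D0 then 1 else 0) Co (Finset.filter_subset _ _)
      (fun h hh => (Finset.mem_filter.1 hh).2.trans_lt hD0)
    rw [Finset.sum_congr rfl (g := fun _ => (1:ℝ)) (by
      intro h hh
      have h2 : Nat.ble h.natDegree D0 = true := by rw [Nat.ble_eq]; exact (Finset.mem_filter.1 hh).2
      simp only [h2, cond_true, Nat.cast_one])] at h1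
    rw [Finset.sum_const, nsmul_eq_mul, mul_one] at h1
    exact_mod_cast h1
  have hnc : ∀ h ∈ facts K n \ Co, Nat.ble h.natDegree D0 = false := by
    intro h hh
    rw [Finset.mem_sdiff, hCo, Finset.mem_filter] at hh
    rw [← Bool.not_eq_true, Nat.ble_eq]
    exact fun h2 => hh.2 ⟨hh.1, h2⟩
  have hgen : ∀ (g : ℕ → ℕ) (φ : K[X] → ℝ) (b : ℝ), (0 ≤ b) → (∀ h ∈ facts K n \ Co, h.natDegree < 10 → φ h = g h.natDegree) →
      (∀ h ∈ facts K n \ Co, 10 ≤ h.natDegree → φ h ≤ b) → ∑ h ∈ facts K n \ Co, φ h ≤ cw n g + (n / 10 : ℕ) * b := by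
    intro g φ b hb h1 h2
    rw [← Finset.sum_filter_add_sum_filter_not _ (fun h => h.natDegree < 10)]
    refine add_le_add ?_ ?_
    · rw [Finset.sum_congr rfl (g := fun h => (g h.natDegree : ℝ)) (fun h hh => h1 h (Finset.mem_filter.1 hh).1 (Finset.mem_filter.1 hh).2)]
      exact facts_cw hK n hn0 g _ ((Finset.filter_subset _ _).trans Finset.sdiff_subset) (fun h hh => (Finset.mem_filter.1 hh).2)
    · refine (Finset.sum_le_sum (g := fun _ => b) (fun h hh => h2 h (Finset.mem_filter.1 hh).1 (by have := (Finset.mem_filter.1 hh).2; omega))).trans ?_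
      rw [Finset.sum_const, nsmul_eq_mul]
      refine mul_le_mul_of_nonneg_right (Nat.cast_le.2 ?_) hb
      exact facts_big K n hn0 10 (by norm_num) _ ((Finset.filter_subset _ _).trans Finset.sdiff_subset)
        (fun h hh => by have := (Finset.mem_filter.1 hh).2; omega)
  have hH : (facts K n \ Co).card ≤ cH n D0 := by
    have h1 := hgen (fun D => bif Nat.ble D D0 then 0 else 1) (fun _ => 1) 1 (by norm_num)
      (fun h hh _ => by simp only [hnc h hh, cond_false, Nat.cast_one]) (fun _ _ _ => le_rfl)
    rw [Finset.sum_const, nsmul_eq_mul, mul_one, mul_one] at h1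
    rw [cH]
    exact_mod_cast h1
  have hE : ∑ h ∈ facts K n \ Co, (1 / 2 ^ h.natDegree : ℝ) * 2 ^ 20 ≤
      ((cw n (fun D => bif Nat.ble D D0 then 0 else 2 ^ (20 - D)) : ℕ) : ℝ) + ((n / 10 : ℕ) : ℝ) * 2 ^ 10 := by
    refine hgen (fun D => bif Nat.ble D D0 then 0 else 2 ^ (20 - D)) _ (2 ^ 10) (by norm_num) ?_ ?_
    · intro h hh h10
      simp only [hnc h hh, cond_false]
      push_cast
      rw [one_div, ← div_eq_inv_mul, div_eq_iff (by positivity), ← pow_add]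
      congr 1; omega
    · intro h hh h10
      rw [one_div, ← div_eq_inv_mul, div_le_iff₀ (by positivity), ← pow_add]
      exact pow_le_pow_right₀ (by norm_num) (by omega)
  have hT : ((4:ℝ) ^ P.card * (1 + 2 * S.card) + (4 ^ P.card - 1) * (facts K n \ Co).card) ≤ cT n D0 k := by
    have h1 : (1:ℝ) ≤ 4 ^ P.card := one_le_pow₀ (by norm_num)
    have h2 : (4:ℝ) ^ P.card ≤ 4 ^ k := pow_le_pow_right₀ (by norm_num) hPc
    have h3 : ((cT n D0 k : ℕ) : ℝ) = 4 ^ k * (1 + 2 * cs n k) + (4 ^ k - 1) * cH n D0 := by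
      rw [cT]; push_cast [Nat.one_le_pow]
      rfl
    rw [h3]
    have h4 : (S.card : ℝ) ≤ cs n k := by exact_mod_cast hSc
    have h5 : ((facts K n \ Co).card : ℝ) ≤ cH n D0 := by exact_mod_cast hH
    refine add_le_add ?_ ?_
    · exact mul_le_mul h2 (by linarith) (by positivity) (by positivity)
    · exact mul_le_mul (by linarith) h5 (by positivity) (by linarith)
  set Tr : ℝ := ((4:ℝ) ^ P.card * (1 + 2 * S.card) + (4 ^ P.card - 1) * (facts K n \ Co).card) with hTr
  set δ : ℝ := 1 - 2 * ∑ p ∈ S, (1 / p : ℝ) - ∑ h ∈ facts K n \ Co, (1 / 2 ^ h.natDegree : ℝ) with hδ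
  have hchk' : 36 * 4 ^ cW n D0 * cT n D0 k ^ 2 * 2 ^ 40 < 2 ^ n * (2 ^ 20 - cE n D0 k) ^ 2 := by
    rw [chk] at hchk
    rwa [Nat.blt_eq] at hchk
  have hnum : cE n D0 k < 2 ^ 20 := by
    by_contra hc
    rw [Nat.sub_eq_zero_of_le (by omega)] at hchk'
    simp at hchk'
  have hδ2 : ((2 ^ 20 - cE n D0 k : ℕ) : ℝ) ≤ δ * 2 ^ 20 := by
    rw [Nat.cast_sub hnum.le, hδ, sub_mul, sub_mul, mul_assoc, Finset.sum_mul, Finset.sum_mul, cE]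
    push_cast at hSs hE ⊢
    linarith
  have hX2 : √((2:ℝ) ^ n) * √(2 ^ n) = 2 ^ n := Real.mul_self_sqrt (by positivity)
  have hX0 : 0 < √((2:ℝ) ^ n) := Real.sqrt_pos.2 (by positivity)
  set x := √((2:ℝ) ^ n)
  set N : ℕ := 2 ^ 20 - cE n D0 k
  have hc2 : (6 * 2 ^ cW n D0 * cT n D0 k * 2 ^ 20 : ℝ) < x * N := by
    refine lt_of_pow_lt_pow_left₀ 2 (by positivity) ?_
    have h1 : ((36 * 4 ^ cW n D0 * cT n D0 k ^ 2 * 2 ^ 40 : ℕ) : ℝ) < ((2 ^ n * N ^ 2 : ℕ) : ℝ) := Nat.cast_lt.2 hchk'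
    push_cast at h1
    have h4 : (4:ℝ) ^ cW n D0 = (2 ^ cW n D0) ^ 2 := by rw [← pow_mul, mul_comm, pow_mul]; norm_num
    rw [h4, ← hX2] at h1
    calc _ = 36 * (2 ^ cW n D0) ^ 2 * (cT n D0 k : ℝ) ^ 2 * 2 ^ 40 := by ring
      _ < x * x * (N : ℝ) ^ 2 := by convert h1 using 2; norm_num
      _ = _ := by ring
  have hWr : (2:ℝ) ^ Co.card ≤ 2 ^ cW n D0 := pow_le_pow_right₀ (by norm_num) hW
  have hTr0 : 0 ≤ Tr := by
    have : (1:ℝ) ≤ 4 ^ P.card := one_le_pow₀ (by norm_num)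
    have h2 : (0:ℝ) ≤ 4 ^ P.card - 1 := by linarith
    positivity
  have hfin : 6 * 2 ^ Co.card * Tr < x * δ := by
    have h1 : 6 * 2 ^ Co.card * Tr ≤ 6 * 2 ^ cW n D0 * cT n D0 k := by
      refine mul_le_mul (by linarith) hT hTr0 (by positivity)
    have h2 : x * N ≤ x * (δ * 2 ^ 20) := mul_le_mul_of_nonneg_left hδ2 hX0.le
    nlinarith
  rw [div_mul_eq_mul_div, lt_div_iff₀ (by positivity), ← hX2]
  calc 6 * x * Tr * 2 ^ Co.card = x * (6 * 2 ^ Co.card * Tr) := by ring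
    _ < x * (x * δ) := mul_lt_mul_of_pos_left hfin hX0
    _ = x * x * δ := by ring

end P15


theorem stmt11 (n : ℕ) (hn : 3 ≤ n)
    (h : n ∈ ({13, 17, 19, 21, 22, 23} : Finset ℕ) ∨ 25 ≤ n) :
    memB 3 2 2 n := by
  classical
  intro K L _ _ _ _ _ hK hQ f hf
  have : CharP L 2 := charP_two_of_card (K := K) hK
  obtain ⟨f₁, f₂, h2, rfl, hd1, hd2, hc, k, g, hk0, hg, hi, hX, hk, hdvd, hnd⟩ := hf
  have hgp : GoodPair f₁ f₂ := goodPair_of f₁ f₂ h2 hd1 hd2 hc k g hg hi hX hk hdvd hnd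
  have main : ∃ α : L, f₂.eval α ≠ 0 ∧ orderOf α = Fintype.card L - 1 ∧
      orderOf (f₁.eval α / f₂.eval α) = Fintype.card L - 1 ∧
      LinearIndependent K (fun i : Fin n => α ^ Fintype.card K ^ (i : ℕ)) ∧
      Submodule.span K (Set.range (fun i : Fin n => α ^ Fintype.card K ^ (i : ℕ))) = ⊤ := by
    have hn0 : 0 < n := by omega
    by_cases hbig : 541 ≤ n
    · exact big_case hK n hbig hQ f₁ f₂ hgp
    · obtain ⟨D0, k', hD0, hchk⟩ : ∃ D0 k', D0 < 10 ∧ chk n D0 k' = true := by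
        have hcases : n = 13 ∨ n = 17 ∨ n = 19 ∨ n = 21 ∨ (22 ≤ n ∧ n < 22 + 2) ∨ (25 ≤ n ∧ n < 25 + 18) ∨
            (43 ≤ n ∧ n < 43 + 498) := by
          simp only [Finset.mem_insert, Finset.mem_singleton] at h
          omega
        obtain ⟨a1, a2, a3, a4⟩ := chk_a
        rcases hcases with h | h | h | h | h | h | h
        · exact ⟨1, 0, by norm_num, by rw [h]; exact a1⟩
        · exact ⟨1, 0, by norm_num, by rw [h]; exact a2⟩
        · exact ⟨1, 0, by norm_num, by rw [h]; exact a3⟩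
        · exact ⟨1, 0, by norm_num, by rw [h]; exact a4⟩
        · exact ⟨2, 2, by norm_num, chkRange_spec _ _ _ _ chk_b1 n h.1 h.2⟩
        · exact ⟨2, 2, by norm_num, chkRange_spec _ _ _ _ chk_b2 n h.1 h.2⟩
        · exact ⟨2, 6, by norm_num, chkRange_spec _ _ _ _ chk_c n h.1 h.2⟩
      exact fin_case hK n D0 k' hn0 hD0 hchk hQ f₁ f₂ hgp
  obtain ⟨α, hf2, ho1, ho2, hl, hs⟩ := main
  refine ⟨α, ho1, ⟨hl, hs⟩, ?_⟩
  have hev : ratEval (algebraMap L[X] (RatFunc L) f₁ / algebraMap L[X] (RatFunc L) f₂) α =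
      f₁.eval α / f₂.eval α := by
    rw [ratEval]
    have e2 : RatFunc.eval (RingHom.id L) α (algebraMap L[X] (RatFunc L) f₂) = f₂.eval α := by
      rw [RatFunc.eval_algebraMap]; rfl
    have e1 : RatFunc.eval (RingHom.id L) α (algebraMap L[X] (RatFunc L) f₁) = f₁.eval α := by
      rw [RatFunc.eval_algebraMap]; rfl
    have hne : algebraMap L[X] (RatFunc L) f₂ ≠ 0 := RatFunc.algebraMap_ne_zero h2
    have hdv : (algebraMap L[X] (RatFunc L) f₁ / algebraMap L[X] (RatFunc L) f₂).denom ∣ f₂ :=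
      RatFunc.denom_div_dvd f₁ f₂
    have hd0 : (algebraMap L[X] (RatFunc L) f₁ / algebraMap L[X] (RatFunc L) f₂).denom.eval₂ (RingHom.id L) α ≠ 0 := by
      intro h0
      obtain ⟨t, ht⟩ := hdv
      apply hf2
      rw [ht, eval_mul, ← eval₂_id, h0, zero_mul]
    rw [eq_div_iff hf2, ← e2, ← RatFunc.eval_mul _ _ hd0 (by rw [RatFunc.denom_algebraMap]; simp), div_mul_cancel₀ _ hne, e1]
  rw [hev]
  exact ho2
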